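/- arXiv:1801.07325 — 4 statements merged into one kernel-verified Lean document; each statement's English description precedes it below -/
import Mathlib

section
/- Let n ≥ 1 and γ > −1/2. Let f be a real algebraic polynomial on 𝔹^n and let h ∈ C^∞(𝔹^n) be bounded on 𝔹^n and satisfy ∫_{𝔹^n} [Σ_{i=1}^n (∂_i h(x))² − (Σ_{i=1}^n x_i ∂_i h(x))²] (1−‖x‖²)^{γ−1/2} dx < ∞. Then ∫_{𝔹^n} h(x) Lf(x) (1−‖x‖²)^{γ−1/2} dx = −∫_{𝔹^n} Σ_{i=1}^n Σ_{j=1}^n (δ_{ij} − x_i x_j) ∂_i f(x) ∂_j h(x) (1−‖x‖²)^{γ−1/2} dx. -/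
open MeasureTheory MvPolynomial Real

noncomputable section

/-- The differential operator
`L f = Σ_i ∂_i² f − Σ_{i,j} x_i x_j ∂_i ∂_j f − (n + 2γ) Σ_i x_i ∂_i f`
acting on polynomials. -/
def ballOp (n : ℕ) (γ : ℝ) (f : MvPolynomial (Fin n) ℝ) : MvPolynomial (Fin n) ℝ :=
  (∑ i, pderiv i (pderiv i f))
    - (∑ i, ∑ j, X i * X j * pderiv i (pderiv j f))
    - C ((n : ℝ) + 2 * γ) * ∑ i, X i * pderiv i f

/-- The open Euclidean unit ball in coordinates. -/
abbrev coordBall (n : ℕ) : Set (Fin n → ℝ) := {x | (∑ i, (x i) ^ 2) < 1}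

theorem isOpen_coordBall (n : ℕ) : IsOpen (coordBall n) :=
  isOpen_lt (by fun_prop) continuous_const

theorem measurableSet_coordBall (n : ℕ) : MeasurableSet (coordBall n) :=
  (isOpen_coordBall n).measurableSet

theorem abs_le_one_of_sum_sq_le_one {n : ℕ} {x : Fin n → ℝ} (hx : ∑ i, (x i) ^ 2 ≤ 1)
    (i : Fin n) : |x i| ≤ 1 :=
  abs_le_one_iff_mul_self_le_one.2 <| by
    have := Finset.single_le_sum (f := fun i => (x i) ^ 2) (fun j _ => sq_nonneg _)
      (Finset.mem_univ i)
    nlinarith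

theorem isCompact_sum_sq_le_one (n : ℕ) :
    IsCompact {x : Fin n → ℝ | (∑ i, (x i) ^ 2) ≤ 1} := by
  refine Metric.isCompact_of_isClosed_isBounded
    (isClosed_le (by fun_prop) continuous_const) ?_
  refine (Metric.isBounded_closedBall (x := (0 : Fin n → ℝ)) (r := 1)).subset fun x hx => ?_
  rw [mem_closedBall_zero_iff, pi_norm_le_iff_of_nonneg zero_le_one]
  exact fun i => abs_le_one_of_sum_sq_le_one hx i

/-- The Jacobi weight is integrable on the unit ball. -/
theorem integrableOn_coordBall_rpow {n : ℕ} (hn : 1 ≤ n) {a : ℝ} (ha : -1 < a) :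
    IntegrableOn (fun x : Fin n → ℝ => (1 - ∑ i, (x i) ^ 2) ^ a) (coordBall n) := by
  have hne : Nonempty (Fin n) := ⟨⟨0, hn⟩⟩
  have hball : (WithLp.toLp 2 : (Fin n → ℝ) → EuclideanSpace ℝ (Fin n)) ⁻¹'
      Metric.ball (0 : EuclideanSpace ℝ (Fin n)) 1 = coordBall n := by
    ext x
    simp only [Set.mem_preimage, mem_ball_zero_iff, Set.mem_ofPred_eq]
    rw [← sq_lt_one_iff₀ (norm_nonneg _), EuclideanSpace.real_norm_sq_eq]
  have hfun : (fun x : Fin n → ℝ => (1 - ∑ i, (x i) ^ 2) ^ a) =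
      (fun y : EuclideanSpace ℝ (Fin n) => (fun r : ℝ => (1 - r ^ 2) ^ a) ‖y‖) ∘
        (WithLp.toLp 2 : (Fin n → ℝ) → EuclideanSpace ℝ (Fin n)) := by
    ext x
    simp [EuclideanSpace.real_norm_sq_eq]
  rw [hfun, ← hball, (PiLp.volume_preserving_toLp (Fin n)).integrableOn_comp_preimage
    (MeasurableEquiv.toLp 2 (Fin n → ℝ)).measurableEmbedding]
  refine (integrableOn_fun_norm_addHaar volume (f := fun r : ℝ => (1 - r ^ 2) ^ a)).2 ?_
  have h1 : IntervalIntegrable (fun r : ℝ => (1 - r) ^ a) volume 0 1 := by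
    simpa using ((intervalIntegral.intervalIntegrable_rpow' (a := 0) (b := 1) ha).comp_sub_left 1).symm
  rw [intervalIntegrable_iff_integrableOn_Ioo_of_le zero_le_one] at h1
  have hc : ContinuousOn (fun r : ℝ => r ^ (Module.finrank ℝ (EuclideanSpace ℝ (Fin n)) - 1)
      * (1 + r) ^ a) (Set.Icc 0 1) :=
    (continuousOn_id.pow _).mul <| (continuousOn_const.add continuousOn_id).rpow_const
      fun r hr => Or.inl (add_pos_of_pos_of_nonneg one_pos hr.1).ne'
  obtain ⟨C, hC⟩ := isCompact_Icc.exists_bound_of_continuousOn hc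
  refine (h1.bdd_mul (c := C)
    ((hc.mono Set.Ioo_subset_Icc_self).aestronglyMeasurable measurableSet_Ioo) ?_).congr ?_
  · filter_upwards [ae_restrict_mem measurableSet_Ioo] with r hr
    exact hC r (Set.Ioo_subset_Icc_self hr)
  · filter_upwards [ae_restrict_mem measurableSet_Ioo] with r hr
    rw [smul_eq_mul, show 1 - r ^ 2 = (1 + r) * (1 - r) by ring,
      mul_rpow (by linarith [hr.1]) (by linarith [hr.2]), mul_assoc]

theorem hasFDerivAt_eval {σ : Type*} [Fintype σ] (p : MvPolynomial σ ℝ) (x : σ → ℝ) :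
    HasFDerivAt (fun y : σ → ℝ => eval y p)
      (∑ i, eval x (pderiv i p) • ContinuousLinearMap.proj (R := ℝ) (φ := fun _ : σ => ℝ) i) x := by
  classical
  induction p using MvPolynomial.induction_on with
  | C a => simpa using hasFDerivAt_const a x
  | add p q hp hq =>
    simp only [map_add, add_smul, Finset.sum_add_distrib]
    exact hp.add hq
  | mul_X p j hp =>
    have := hp.mul (hasFDerivAt_apply (𝕜 := ℝ) j x)
    simp only [map_mul, eval_X]
    refine this.congr_fderiv ?_
    ext v
    simp [pderiv_X, Pi.single_apply, add_mul, Finset.sum_add_distrib, Finset.mul_sum,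
      apply_ite, ite_mul, mul_assoc]

theorem fderiv_eval_single {σ : Type*} [Fintype σ] [DecidableEq σ] (p : MvPolynomial σ ℝ)
    (x : σ → ℝ) (j : σ) :
    fderiv ℝ (fun y : σ → ℝ => eval y p) x (Pi.single j 1) = eval x (pderiv j p) := by
  rw [(hasFDerivAt_eval p x).fderiv]
  simp [Pi.single_apply]

theorem contDiff_eval {σ : Type*} [Fintype σ] (p : MvPolynomial σ ℝ) {k : WithTop ℕ∞} :
    ContDiff ℝ k (fun y : σ → ℝ => eval y p) := by
  induction p using MvPolynomial.induction_on with
  | C a => simpa using contDiff_const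
  | add p q hp hq => simpa using hp.add hq
  | mul_X p j hp => simpa using hp.mul (contDiff_apply ℝ ℝ j)

/-- The integral of a partial derivative of a compactly supported function vanishes. -/
theorem integral_fderiv_apply_eq_zero {E : Type*} [NormedAddCommGroup E] [NormedSpace ℝ E]
    [FiniteDimensional ℝ E] [MeasurableSpace E] [BorelSpace E] (μ : Measure E)
    [μ.IsAddHaarMeasure] {g : E → ℝ} (hg : ContDiff ℝ 1 g) (hc : HasCompactSupport g) (v : E) :
    ∫ x, fderiv ℝ g x v ∂μ = 0 := by
  have hd : Integrable (fun x => fderiv ℝ g x v) μ :=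
    ((hg.continuous_fderiv one_ne_zero).clm_apply continuous_const).integrable_of_hasCompactSupport
      (hc.fderiv_apply (𝕜 := ℝ) v)
  have := integral_mul_fderiv_eq_neg_fderiv_mul_of_integrable (μ := μ) (f := fun _ => (1 : ℝ))
    (g := g) (v := v) (by simp) (by simpa using hd)
    (by simpa using hg.continuous.integrable_of_hasCompactSupport hc) (by simp)
    (fun x _ => (hg.differentiable one_ne_zero) x)
  simpa using this

/-- A smooth step from `0` to `1`, located in `[1, 2]`. -/
theorem exists_smooth_step : ∃ s : ℝ → ℝ, ContDiff ℝ 1 s ∧ (∀ t ≤ 1, s t = 0) ∧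
    (∀ t, |s t| ≤ 1) ∧ (∀ t, 2 < t → s t = 1 ∧ deriv s t = 0) ∧
    ∃ C : ℝ, ∀ t, |t * deriv s t| ≤ C := by
  have hs : ContDiff ℝ 1 (fun t : ℝ => smoothTransition (t - 1)) :=
    (smoothTransition.contDiff (n := 1)).comp (contDiff_id.sub contDiff_const)
  have hlt : ∀ t : ℝ, t < 1 → deriv (fun t : ℝ => smoothTransition (t - 1)) t = 0 := by
    intro t ht
    have : (fun t : ℝ => smoothTransition (t - 1)) =ᶠ[nhds t] fun _ => 0 := by
      filter_upwards [eventually_lt_nhds ht] with u hu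
      exact smoothTransition.zero_of_nonpos (by linarith)
    simpa using this.deriv_eq
  have hgt : ∀ t : ℝ, 2 < t → deriv (fun t : ℝ => smoothTransition (t - 1)) t = 0 := by
    intro t ht
    have : (fun t : ℝ => smoothTransition (t - 1)) =ᶠ[nhds t] fun _ => 1 := by
      filter_upwards [eventually_gt_nhds ht] with u hu
      exact smoothTransition.one_of_one_le (by linarith)
    simpa using this.deriv_eq
  refine ⟨_, hs, fun t ht => smoothTransition.zero_of_nonpos (by linarith), fun t => ?_,
    fun t ht => ⟨smoothTransition.one_of_one_le (by linarith), hgt t ht⟩, ?_⟩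
  · rw [abs_of_nonneg (smoothTransition.nonneg _)]
    exact smoothTransition.le_one _
  · obtain ⟨C, hC⟩ := (HasCompactSupport.intro (isCompact_Icc (a := (1 : ℝ)) (b := 2))
      (f := fun t => t * deriv (fun t : ℝ => smoothTransition (t - 1)) t) (fun t ht => by
        rw [Set.mem_Icc, not_and_or, not_le, not_le] at ht
        rcases ht with ht | ht
        · simp only [hlt t ht, mul_zero]
        · simp only [hgt t ht, mul_zero])).exists_bound_of_continuous
      (continuous_id.mul (hs.continuous_deriv le_rfl))
    exact ⟨C, hC⟩

theorem hasFDerivAt_one_sub_sum_sq {n : ℕ} (x : Fin n → ℝ) :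
    HasFDerivAt (fun y : Fin n → ℝ => 1 - ∑ i, (y i) ^ 2)
      (-∑ i, (2 * x i) • ContinuousLinearMap.proj (R := ℝ) (φ := fun _ : Fin n => ℝ) i) x := by
  refine (HasFDerivAt.fun_sum fun i _ => ?_).const_sub 1
  simpa using (hasFDerivAt_apply (𝕜 := ℝ) i x).pow 2

/-- Multiplying by a cutoff of the boundary of the ball gives compactly supported functions. -/
theorem contDiff_cutoff_mul {n : ℕ} {s : ℝ → ℝ} (hs : ContDiff ℝ 1 s) (hs0 : ∀ t ≤ 1, s t = 0)
    {c : ℝ} (hc : 0 ≤ c) {v : (Fin n → ℝ) → ℝ} (hv : ContDiffOn ℝ 1 v (coordBall n)) :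
    ContDiff ℝ 1 (fun x => s (c * (1 - ∑ i, (x i) ^ 2)) * v x) ∧
    ∀ x ∉ coordBall n, (fun x => s (c * (1 - ∑ i, (x i) ^ 2)) * v x) =ᶠ[nhds x] 0 := by
  have hout : ∀ x ∉ coordBall n,
      (fun x => s (c * (1 - ∑ i, (x i) ^ 2)) * v x) =ᶠ[nhds x] 0 := by
    intro x hx
    have hcont : Continuous fun y : Fin n → ℝ => c * (1 - ∑ i, (y i) ^ 2) := by fun_prop
    have hx1 : c * (1 - ∑ i, (x i) ^ 2) < 1 :=
      (mul_nonpos_of_nonneg_of_nonpos hc (sub_nonpos.2 (not_lt.1 hx))).trans_lt one_pos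
    filter_upwards [hcont.continuousAt.eventually_lt_const hx1] with y hy
    simp [hs0 _ hy.le]
  refine ⟨contDiff_iff_contDiffAt.2 fun x => ?_, hout⟩
  by_cases hx : x ∈ coordBall n
  · refine ContDiffAt.mul ?_ (hv.contDiffAt ((isOpen_coordBall n).mem_nhds hx))
    exact (hs.comp (by fun_prop)).contDiffAt
  · exact contDiffAt_const.congr_of_eventuallyEq (hout x hx)

/-- The divergence theorem for vector fields whose normal component decays at the boundary. -/
theorem setIntegral_divergence_eq_zero {n : ℕ} {V : Fin n → (Fin n → ℝ) → ℝ}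
    (hV : ∀ j, ContDiffOn ℝ 1 (V j) (coordBall n)) {g : (Fin n → ℝ) → ℝ}
    (hg : IntegrableOn g (coordBall n))
    (hVg : ∀ x ∈ coordBall n, |∑ j, x j * V j x| ≤ (1 - ∑ i, (x i) ^ 2) * g x)
    (hdiv : IntegrableOn (fun x => ∑ j, fderiv ℝ (V j) x (Pi.single j 1)) (coordBall n)) :
    ∫ x in coordBall n, ∑ j, fderiv ℝ (V j) x (Pi.single j 1) = 0 := by
  obtain ⟨s, hs, hs0, hs1, hs2, C, hC⟩ := exists_smooth_step
  have hC0 : 0 ≤ C := (abs_nonneg _).trans (hC 0)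
  set G : ℕ → Fin n → (Fin n → ℝ) → ℝ :=
    fun k j x => s (((k : ℝ) + 1) * (1 - ∑ i, (x i) ^ 2)) * V j x with hG
  have hGs := fun k j => contDiff_cutoff_mul hs hs0 (Nat.cast_add_one_pos (α := ℝ) k).le (hV j)
  have hGc : ∀ k j, HasCompactSupport (G k j) := fun k j =>
    HasCompactSupport.intro (isCompact_sum_sq_le_one n) fun x hx =>
      ((hGs k j).2 x fun h => hx (Set.mem_ofPred.2 (le_of_lt h))).self_of_nhds
  have hcont : ∀ k j, Continuous fun x => fderiv ℝ (G k j) x (Pi.single j 1) := fun k j =>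
    ((hGs k j).1.continuous_fderiv one_ne_zero).clm_apply continuous_const
  have hzero : ∀ k, ∫ x in coordBall n, ∑ j, fderiv ℝ (G k j) x (Pi.single j 1) = 0 := by
    intro k
    rw [setIntegral_eq_integral_of_forall_compl_eq_zero, integral_finsetSum]
    · exact Finset.sum_eq_zero fun j _ =>
        integral_fderiv_apply_eq_zero volume (hGs k j).1 (hGc k j) _
    · exact fun j _ => (hcont k j).integrable_of_hasCompactSupport
        ((hGc k j).fderiv_apply (𝕜 := ℝ) _)
    · intro x hx
      refine Finset.sum_eq_zero fun j _ => ?_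
      rw [((hGs k j).2 x hx).fderiv_eq]
      simp
  have hform : ∀ k, ∀ x ∈ coordBall n, ∑ j, fderiv ℝ (G k j) x (Pi.single j 1) =
      s (((k : ℝ) + 1) * (1 - ∑ i, (x i) ^ 2)) * ∑ j, fderiv ℝ (V j) x (Pi.single j 1) -
      2 * (((k : ℝ) + 1) * deriv s (((k : ℝ) + 1) * (1 - ∑ i, (x i) ^ 2))) *
        ∑ j, x j * V j x := by
    intro k x hx
    rw [Finset.mul_sum, Finset.mul_sum, ← Finset.sum_sub_distrib]
    refine Finset.sum_congr rfl fun j _ => ?_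
    have h1 : HasFDerivAt (V j) (fderiv ℝ (V j) x) x :=
      (((hV j).contDiffAt ((isOpen_coordBall n).mem_nhds hx)).differentiableAt
        one_ne_zero).hasFDerivAt
    have h2 := (hs.differentiable one_ne_zero
      (((k : ℝ) + 1) * (1 - ∑ i, (x i) ^ 2))).hasDerivAt.comp_hasFDerivAt x
      ((hasFDerivAt_one_sub_sum_sq x).const_mul ((k : ℝ) + 1))
    have h3 : HasFDerivAt (G k j) _ x := h2.mul h1
    rw [h3.fderiv]
    simp [Pi.single_apply]
    ring
  have hlim : Filter.Tendsto
      (fun k : ℕ => ∫ x in coordBall n, ∑ j, fderiv ℝ (G k j) x (Pi.single j 1)) Filter.atTop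
      (nhds (∫ x in coordBall n, ∑ j, fderiv ℝ (V j) x (Pi.single j 1))) := by
    refine tendsto_integral_of_dominated_convergence
      (fun x => |∑ j, fderiv ℝ (V j) x (Pi.single j 1)| + 2 * C * g x)
      (fun k => (continuous_finsetSum _ fun j _ => hcont k j).aestronglyMeasurable)
      (hdiv.abs.add (hg.const_mul _)) (fun k => ?_) ?_
    · filter_upwards [ae_restrict_mem (measurableSet_coordBall n)] with x hx
      rw [hform k x hx, norm_eq_abs]
      set ρ := 1 - ∑ i, (x i) ^ 2 with hρ
      have hρ0 : 0 < ρ := sub_pos.2 hx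
      have hg0 : 0 ≤ g x := by
        by_contra! hlt
        nlinarith [hVg x hx, abs_nonneg (∑ j, x j * V j x)]
      refine (abs_sub _ _).trans (add_le_add ?_ ?_)
      · rw [abs_mul]
        exact mul_le_of_le_one_left (abs_nonneg _) (hs1 _)
      · calc |2 * (((k : ℝ) + 1) * deriv s (((k : ℝ) + 1) * ρ)) * ∑ j, x j * V j x|
            = 2 * |((k : ℝ) + 1) * deriv s (((k : ℝ) + 1) * ρ)| * |∑ j, x j * V j x| := by
              rw [abs_mul, abs_mul, abs_two]
          _ ≤ 2 * |((k : ℝ) + 1) * deriv s (((k : ℝ) + 1) * ρ)| * (ρ * g x) := by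
              gcongr
              exact hVg x hx
          _ = 2 * |((k : ℝ) + 1) * ρ * deriv s (((k : ℝ) + 1) * ρ)| * g x := by
              rw [mul_right_comm ((k : ℝ) + 1) ρ, abs_mul _ ρ, abs_of_pos hρ0]
              ring
          _ ≤ 2 * C * g x := by
              gcongr
              exact hC _
    · filter_upwards [ae_restrict_mem (measurableSet_coordBall n)] with x hx
      refine tendsto_const_nhds.congr' ?_
      have hρ0 : 0 < 1 - ∑ i, (x i) ^ 2 := sub_pos.2 hx
      obtain ⟨K, hK⟩ := exists_nat_gt (2 / (1 - ∑ i, (x i) ^ 2))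
      filter_upwards [Filter.eventually_ge_atTop K] with k hk
      have hKk : (K : ℝ) ≤ k := by exact_mod_cast hk
      have : 2 < ((k : ℝ) + 1) * (1 - ∑ i, (x i) ^ 2) := by
        rw [← div_lt_iff₀ hρ0]
        linarith
      rw [hform k x hx, (hs2 _ this).1, (hs2 _ this).2]
      ring
  simp only [hzero] at hlim
  exact (tendsto_nhds_unique tendsto_const_nhds hlim).symm

/-- The vector field `(I - x xᵀ) ∇ f`, as a tuple of polynomials. -/
def ballField {n : ℕ} (f : MvPolynomial (Fin n) ℝ) (j : Fin n) : MvPolynomial (Fin n) ℝ :=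
  pderiv j f - X j * ∑ i, X i * pderiv i f

theorem eval_ballOp {n : ℕ} (γ : ℝ) (f : MvPolynomial (Fin n) ℝ) (x : Fin n → ℝ) :
    eval x (ballOp n γ f) = ∑ j, eval x (pderiv j (ballField f j)) -
      (2 * γ - 1) * ∑ i, x i * eval x (pderiv i f) := by
  simp [ballOp, ballField, pderiv_X, Pi.single_apply, Finset.sum_add_distrib,
    Finset.sum_sub_distrib, mul_add, Finset.mul_sum]
  simp only [← Finset.mul_sum, mul_assoc]
  ring

theorem sum_mul_eval_ballField {n : ℕ} (f : MvPolynomial (Fin n) ℝ) (x : Fin n → ℝ) :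
    ∑ j, x j * eval x (ballField f j) =
      (1 - ∑ i, (x i) ^ 2) * ∑ i, x i * eval x (pderiv i f) := by
  simp only [ballField, map_sub, map_mul, map_sum, eval_X, mul_sub, Finset.sum_sub_distrib,
    sub_mul, one_mul, Finset.sum_mul _ _ (∑ i, x i * eval x (pderiv i f)), ← mul_assoc, pow_two]

theorem sum_eval_ballField_mul {n : ℕ} (f : MvPolynomial (Fin n) ℝ) (x u : Fin n → ℝ) :
    ∑ j, eval x (ballField f j) * u j =
      ∑ i, ∑ j, ((if i = j then (1 : ℝ) else 0) - x i * x j) * eval x (pderiv i f) * u j := by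
  rw [Finset.sum_comm]
  refine Finset.sum_congr rfl fun j _ => ?_
  simp only [ballField, map_sub, map_mul, map_sum, eval_X, sub_mul, Finset.sum_sub_distrib,
    ite_mul, one_mul, zero_mul, Finset.sum_ite_eq', Finset.mem_univ, if_true, Finset.mul_sum,
    Finset.sum_mul]
  congr 1
  exact Finset.sum_congr rfl fun i _ => by ring

theorem sum_sq_sub_sq_sum_nonneg {n : ℕ} {x : Fin n → ℝ} (hx : ∑ i, (x i) ^ 2 ≤ 1)
    (u : Fin n → ℝ) : 0 ≤ (∑ i, (u i) ^ 2) - (∑ i, x i * u i) ^ 2 := by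
  have h1 := Finset.sum_mul_sq_le_sq_mul_sq Finset.univ x u
  have h2 : 0 ≤ ∑ i, (u i) ^ 2 := Finset.sum_nonneg fun i _ => sq_nonneg _
  nlinarith

theorem abs_sum_sub_mul_sum_le {n : ℕ} {x : Fin n → ℝ} (hx : ∑ i, (x i) ^ 2 ≤ 1)
    (u v : Fin n → ℝ) : |(∑ i, u i * v i) - (∑ i, x i * u i) * ∑ i, x i * v i| ≤
      ((∑ i, (u i) ^ 2) - (∑ i, x i * u i) ^ 2) + ((∑ i, (v i) ^ 2) - (∑ i, x i * v i) ^ 2) := by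
  have hu := sum_sq_sub_sq_sum_nonneg hx u
  have hv := sum_sq_sub_sq_sum_nonneg hx v
  have ha := sum_sq_sub_sq_sum_nonneg hx (u + v)
  have hs := sum_sq_sub_sq_sum_nonneg hx (u - v)
  simp only [Pi.add_apply, Pi.sub_apply, add_sq, sub_sq, mul_add, mul_sub, Finset.sum_add_distrib,
    Finset.sum_sub_distrib, mul_assoc, ← Finset.mul_sum] at ha hs
  rw [abs_le]
  constructor <;> linarith

/-- A bounded function that is continuous on the ball is integrable for the Jacobi weight. -/
theorem integrableOn_coordBall_mul_rpow {n : ℕ} (hn : 1 ≤ n) {a : ℝ} (ha : -1 < a)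
    {h : (Fin n → ℝ) → ℝ} (hc : ContinuousOn h (coordBall n))
    (hbd : ∃ M : ℝ, ∀ x ∈ coordBall n, |h x| ≤ M) (p : MvPolynomial (Fin n) ℝ) :
    IntegrableOn (fun x => h x * eval x p * (1 - ∑ i, (x i) ^ 2) ^ a) (coordBall n) := by
  obtain ⟨M, hM⟩ := hbd
  obtain ⟨K, hK⟩ := (isCompact_sum_sq_le_one n).exists_bound_of_continuousOn
    (contDiff_eval p (k := 0)).continuous.continuousOn
  refine (integrableOn_coordBall_rpow hn ha).bdd_mul (c := M * K)
    ((hc.mul (contDiff_eval p (k := 0)).continuous.continuousOn).aestronglyMeasurable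
      (measurableSet_coordBall n)) ?_
  filter_upwards [ae_restrict_mem (measurableSet_coordBall n)] with x hx
  rw [norm_mul]
  exact mul_le_mul (hM x hx) (hK x (le_of_lt hx)) (norm_nonneg _) ((abs_nonneg _).trans (hM x hx))

/-- Green's theorem on the unit ball: for a polynomial `f` and a bounded smooth function `h`
on `𝔹^n` whose weighted gradient is square integrable,
`∫ h Lf dμ = −∫ Σ_{i,j} (δ_{ij} − x_i x_j) ∂_i f ∂_j h dμ`,
where `dμ = (1−‖x‖²)^{γ−1/2} dx`. -/
theorem stmt3 (n : ℕ) (hn : 1 ≤ n) (γ : ℝ) (hγ : -(1 / 2 : ℝ) < γ)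
    (f : MvPolynomial (Fin n) ℝ) (h : (Fin n → ℝ) → ℝ)
    (hsm : ContDiffOn ℝ (⊤ : ℕ∞) h {x : Fin n → ℝ | (∑ i, (x i) ^ 2) < 1})
    (hbd : ∃ M : ℝ, ∀ x : Fin n → ℝ, (∑ i, (x i) ^ 2) < 1 → |h x| ≤ M)
    (hint : ∫⁻ x in {x : Fin n → ℝ | (∑ i, (x i) ^ 2) < 1},
        ENNReal.ofReal (((∑ i, (fderiv ℝ h x (Pi.single i 1)) ^ 2)
            - (∑ i, x i * fderiv ℝ h x (Pi.single i 1)) ^ 2)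
          * (1 - ∑ i, (x i) ^ 2) ^ (γ - 1 / 2)) < ⊤) :
    ∫ x in {x : Fin n → ℝ | (∑ i, (x i) ^ 2) < 1},
        h x * eval x (ballOp n γ f) * (1 - ∑ i, (x i) ^ 2) ^ (γ - 1 / 2)
      = -∫ x in {x : Fin n → ℝ | (∑ i, (x i) ^ 2) < 1},
          (∑ i, ∑ j, ((if i = j then (1 : ℝ) else 0) - x i * x j)
              * eval x (pderiv i f) * fderiv ℝ h x (Pi.single j 1))
            * (1 - ∑ i, (x i) ^ 2) ^ (γ - 1 / 2) := by
  set a : ℝ := γ - 1 / 2 with ha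
  have ha1 : -1 < a := by linarith
  have hC1 : ContDiffOn ℝ 1 h (coordBall n) := hsm.of_le (by exact_mod_cast le_top)
  have hdc : ∀ j, ContinuousOn (fun x => fderiv ℝ h x (Pi.single j 1)) (coordBall n) := fun j =>
    (hC1.continuousOn_fderiv_of_isOpen (isOpen_coordBall n) le_rfl).clm_apply continuousOn_const
  have hρd : ContDiffOn ℝ 1 (fun x : Fin n → ℝ => (1 - ∑ i, (x i) ^ 2) ^ a) (coordBall n) :=
    ContDiffOn.rpow_const_of_ne (by fun_prop) fun x hx => (sub_pos.2 hx).ne'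
  have hI1 : IntegrableOn (fun x => h x * eval x (ballOp n γ f) * (1 - ∑ i, (x i) ^ 2) ^ a)
      (coordBall n) := integrableOn_coordBall_mul_rpow hn ha1 hC1.continuousOn hbd _
  have hQh : IntegrableOn (fun x => ((∑ i, (fderiv ℝ h x (Pi.single i 1)) ^ 2)
      - (∑ i, x i * fderiv ℝ h x (Pi.single i 1)) ^ 2) * (1 - ∑ i, (x i) ^ 2) ^ a)
      (coordBall n) := by
    refine ⟨ContinuousOn.aestronglyMeasurable ?_ (measurableSet_coordBall n), ?_⟩
    · refine ContinuousOn.mul ?_ hρd.continuousOn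
      have := hdc
      fun_prop
    · rw [hasFiniteIntegral_iff_ofReal]
      · exact hint
      · filter_upwards [ae_restrict_mem (measurableSet_coordBall n)] with x hx
        exact mul_nonneg (sum_sq_sub_sq_sum_nonneg (le_of_lt hx) _)
          (rpow_nonneg (sub_pos.2 hx).le _)
  have hQf : IntegrableOn (fun x => ((∑ i, (eval x (pderiv i f)) ^ 2)
      - (∑ i, x i * eval x (pderiv i f)) ^ 2) * (1 - ∑ i, (x i) ^ 2) ^ a) (coordBall n) := by
    refine (integrableOn_coordBall_mul_rpow hn ha1 (h := fun _ => 1) continuousOn_const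
      ⟨1, by simp⟩ ((∑ i, (pderiv i f) ^ 2) - (∑ i, X i * pderiv i f) ^ 2)).congr_fun
      (fun x _ => by simp) (measurableSet_coordBall n)
  have hI2 : IntegrableOn (fun x =>
      (∑ i, ∑ j, ((if i = j then (1 : ℝ) else 0) - x i * x j)
        * eval x (pderiv i f) * fderiv ℝ h x (Pi.single j 1))
        * (1 - ∑ i, (x i) ^ 2) ^ a) (coordBall n) := by
    simp only [← sum_eval_ballField_mul f _ fun j => fderiv ℝ h _ (Pi.single j 1)]
    refine (hQf.add hQh).mono' (ContinuousOn.aestronglyMeasurable ?_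
      (measurableSet_coordBall n)) ?_
    · refine (continuousOn_finsetSum _ fun j _ => ?_).mul hρd.continuousOn
      exact (contDiff_eval _ (k := 0)).continuous.continuousOn.mul (hdc j)
    · filter_upwards [ae_restrict_mem (measurableSet_coordBall n)] with x hx
      have hρ : 0 ≤ (1 - ∑ i, (x i) ^ 2) ^ a := rpow_nonneg (sub_pos.2 hx).le _
      rw [norm_mul, norm_of_nonneg hρ, Pi.add_apply, ← add_mul]
      refine mul_le_mul_of_nonneg_right ?_ hρ
      refine le_of_eq_of_le ?_ (abs_sum_sub_mul_sum_le (le_of_lt hx) (fun i => eval x (pderiv i f))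
        fun j => fderiv ℝ h x (Pi.single j 1))
      simp only [ballField, map_sub, map_mul, map_sum, eval_X, sub_mul, Finset.sum_sub_distrib,
        norm_eq_abs]
      rw [Finset.mul_sum]
      congr 2
      exact Finset.sum_congr rfl fun j _ => by ring
  set V : Fin n → (Fin n → ℝ) → ℝ :=
    fun j x => h x * eval x (ballField f j) * (1 - ∑ i, (x i) ^ 2) ^ a with hV
  have hVdiff : ∀ j, ContDiffOn ℝ 1 (V j) (coordBall n) := fun j =>
    (hC1.mul (contDiff_eval _).contDiffOn).mul hρd
  have hdiv : ∀ x ∈ coordBall n, ∑ j, fderiv ℝ (V j) x (Pi.single j 1) =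
      h x * eval x (ballOp n γ f) * (1 - ∑ i, (x i) ^ 2) ^ a +
      (∑ i, ∑ j, ((if i = j then (1 : ℝ) else 0) - x i * x j)
        * eval x (pderiv i f) * fderiv ℝ h x (Pi.single j 1)) * (1 - ∑ i, (x i) ^ 2) ^ a := by
    intro x hx
    have hρ : 0 < 1 - ∑ i, (x i) ^ 2 := sub_pos.2 hx
    have hterm : ∀ j, fderiv ℝ (V j) x (Pi.single j 1) =
        eval x (ballField f j) * fderiv ℝ h x (Pi.single j 1) * (1 - ∑ i, (x i) ^ 2) ^ a
        + h x * (1 - ∑ i, (x i) ^ 2) ^ a * eval x (pderiv j (ballField f j))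
        - 2 * a * h x * (1 - ∑ i, (x i) ^ 2) ^ (a - 1) * (x j * eval x (ballField f j)) := by
      intro j
      have h1 : HasFDerivAt h (fderiv ℝ h x) x :=
        ((hC1.contDiffAt ((isOpen_coordBall n).mem_nhds hx)).differentiableAt
          one_ne_zero).hasFDerivAt
      have h2 : HasFDerivAt (V j) _ x := (h1.mul (hasFDerivAt_eval (ballField f j) x)).mul
        ((hasFDerivAt_one_sub_sum_sq x).rpow_const (p := a) (Or.inl hρ.ne'))
      rw [h2.fderiv]
      simp [Pi.single_apply]
      ring
    simp only [hterm, Finset.sum_sub_distrib, Finset.sum_add_distrib, ← Finset.mul_sum,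
      ← Finset.sum_mul, sum_mul_eval_ballField, eval_ballOp,
      sum_eval_ballField_mul f x fun j => fderiv ℝ h x (Pi.single j 1)]
    have hpow : (1 - ∑ i, (x i) ^ 2) ^ a =
        (1 - ∑ i, (x i) ^ 2) ^ (a - 1) * (1 - ∑ i, (x i) ^ 2) := by
      rw [rpow_sub_one hρ.ne', div_mul_cancel₀ _ hρ.ne']
    rw [hpow, show γ = a + 1 / 2 by rw [ha]; ring]
    ring
  have hzero := setIntegral_divergence_eq_zero hVdiff
    (integrableOn_coordBall_mul_rpow hn ha1 hC1.continuousOn hbd (∑ i, X i * pderiv i f)).abs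
    (fun x hx => le_of_eq <| by
      have : ∑ j, x j * V j x = h x * (1 - ∑ i, (x i) ^ 2) ^ a *
          ∑ j, x j * eval x (ballField f j) := by
        rw [Finset.mul_sum]
        exact Finset.sum_congr rfl fun j _ => by simp only [hV]; ring
      rw [this, sum_mul_eval_ballField, ← abs_of_pos (sub_pos.2 hx : 0 < 1 - ∑ i, (x i) ^ 2),
        ← abs_mul, abs_of_pos (sub_pos.2 hx : 0 < 1 - ∑ i, (x i) ^ 2)]
      congr 1
      simp only [map_sum, map_mul, eval_X]
      ring)
    ((hI1.add hI2).congr_fun (fun x hx => (hdiv x hx).symm) (measurableSet_coordBall n))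
  rw [setIntegral_congr_fun (measurableSet_coordBall n) hdiv, integral_add hI1 hI2] at hzero
  exact eq_neg_of_add_eq_zero_left hzero

end
end

section
/- Let n ≥ 1 and κ_1,…,κ_{n+1} > −1/2. Let f be a real algebraic polynomial on 𝕋^n and let h ∈ C^∞(𝕋^n) be bounded on 𝕋^n and satisfy ∫_{𝕋^n} 4[Σ_{i=1}^n x_i (∂_i h(x))² − (Σ_{i=1}^n x_i ∂_i h(x))²] Π_{i=1}^n x_i^{κ_i−1/2} (1−|x|)^{κ_{n+1}−1/2} dx < ∞. Then ∫_{𝕋^n} h(x) · 4 L_T f(x) · Π_{i=1}^n x_i^{κ_i−1/2} (1−|x|)^{κ_{n+1}−1/2} dx = −∫_{𝕋^n} Σ_{i=1}^n Σ_{j=1}^n 4(δ_{ij} x_i − x_i x_j) ∂_i f(x) ∂_j h(x) Π_{i=1}^n x_i^{κ_i−1/2} (1−|x|)^{κ_{n+1}−1/2} dx. -/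
open MeasureTheory MvPolynomial Real

noncomputable section

/-- The open simplex `𝕋^n = {x ∈ ℝ^n : x_i > 0, |x| < 1}`. -/
def simplexSet (n : ℕ) : Set (Fin n → ℝ) := {x | (∀ i, 0 < x i) ∧ (∑ i, x i) < 1}

/-- The weight `Π_i x_i^{κ_i - 1/2} (1 - |x|)^{κ_{n+1} - 1/2}` on `𝕋^n`. -/
def simplexW (n : ℕ) (κ : Fin (n + 1) → ℝ) (x : Fin n → ℝ) : ℝ :=
  (∏ i : Fin n, (x i) ^ (κ i.castSucc - 1 / 2)) * (1 - ∑ i, x i) ^ (κ (Fin.last n) - 1 / 2)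

/-- The differential operator
`L_T f = Σ_i x_i ∂_i² f − Σ_{i,j} x_i x_j ∂_i ∂_j f + Σ_i (κ_i + 1/2 − (|κ| + (n+1)/2) x_i) ∂_i f`
acting on polynomials. -/
def simplexOp (n : ℕ) (κ : Fin (n + 1) → ℝ) (f : MvPolynomial (Fin n) ℝ) :
    MvPolynomial (Fin n) ℝ :=
  (∑ i, X i * pderiv i (pderiv i f))
    - (∑ i, ∑ j, X i * X j * pderiv i (pderiv j f))
    + ∑ i, (C (κ i.castSucc + 1 / 2) - C ((∑ j, κ j) + ((n : ℝ) + 1) / 2) * X i) * pderiv i f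


open Filter Topology

theorem isOpen_simplexSet (n : ℕ) : IsOpen (simplexSet n) := by
  have h1 : IsOpen {x : Fin n → ℝ | ∀ i, 0 < x i} := by
    simp only [Set.ofPred_forall]
    exact isOpen_iInter_of_finite fun i => isOpen_lt continuous_const (continuous_apply i)
  have h2 : IsOpen {x : Fin n → ℝ | ∑ i, x i < 1} := isOpen_lt (by fun_prop) continuous_const
  exact h1.inter h2

theorem simplexSet_subset_Icc (n : ℕ) : simplexSet n ⊆ Set.Icc 0 1 := fun _ hx =>
  ⟨fun i => (hx.1 i).le, fun i =>
    (Finset.single_le_sum (fun j _ => (hx.1 j).le) (Finset.mem_univ i)).trans hx.2.le⟩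

theorem simplexW_nonneg {n : ℕ} (κ : Fin (n + 1) → ℝ) {x : Fin n → ℝ} (hx : x ∈ simplexSet n) :
    0 ≤ simplexW n κ x :=
  mul_nonneg (Finset.prod_nonneg fun i _ => rpow_nonneg (hx.1 i).le _)
    (rpow_nonneg (sub_nonneg.2 hx.2.le) _)

theorem integrable_indicator_Ioo_rpow {a : ℝ} (ha : -1 < a) :
    Integrable ((Set.Ioo (0 : ℝ) 1).indicator fun t => t ^ a) := by
  rw [integrable_indicator_iff measurableSet_Ioo]
  have h := intervalIntegral.intervalIntegrable_rpow' ha (a := 0) (b := 1)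
  rw [intervalIntegrable_iff_integrableOn_Ioo_of_le zero_le_one] at h
  exact h

/-- The Dirichlet weight is integrable over the simplex. -/
theorem integrableOn_simplexW (n : ℕ) (κ : Fin (n + 1) → ℝ) (hκ : ∀ i, -(1 / 2 : ℝ) < κ i) :
    IntegrableOn (simplexW n κ) (simplexSet n) := by
  have hp : ∀ i, Integrable ((Set.Ioo (0 : ℝ) 1).indicator fun t => t ^ (κ i - 1 / 2)) :=
    fun i => integrable_indicator_Ioo_rpow (by linarith [hκ i])
  set p : Fin (n + 1) → ℝ → ℝ :=
    fun i => (Set.Ioo (0 : ℝ) 1).indicator fun t => t ^ (κ i - 1 / 2) with hpdef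
  have hG : Integrable (fun z : (Fin n → ℝ) × ℝ =>
      (∏ i : Fin n, p i.castSucc (z.1 i)) * p (Fin.last n) z.2)
      ((volume : Measure (Fin n → ℝ)).prod volume) :=
    (Integrable.fintype_prod (f := fun i : Fin n => p i.castSucc)
      fun i => hp i.castSucc).mul_prod (hp (Fin.last n))
  have hmp : MeasurePreserving (fun z : (Fin n → ℝ) × ℝ => (z.1, z.2 - ∑ i, z.1 i))
      ((volume : Measure (Fin n → ℝ)).prod volume)
      ((volume : Measure (Fin n → ℝ)).prod volume) := by
    refine (MeasurePreserving.id _).skew_product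
      (g := fun (x : Fin n → ℝ) (t : ℝ) => t - ∑ i, x i) ?_ (ae_of_all _ fun x => ?_)
    · simp only [Function.uncurry_def]
      fun_prop
    · exact (measurePreserving_sub_right volume _).map_eq
  have hae := ((hmp.integrable_comp hG.aestronglyMeasurable).2 hG).prod_left_ae
  obtain ⟨r, hr, hr0, hr1⟩ : ∃ r : ℝ, Integrable (fun x : Fin n → ℝ =>
      (∏ i : Fin n, p i.castSucc (x i)) * p (Fin.last n) (r - ∑ i, x i)) ∧ 0 < r ∧ r < 1 := by
    have hne : (ae ((volume : Measure ℝ).restrict (Set.Ioo 0 1))).NeBot := by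
      rw [ae_neBot, Ne, Measure.restrict_eq_zero]; simp
    obtain ⟨r, h1, h2⟩ := ((ae_restrict_of_ae hae).and
      (ae_restrict_mem (measurableSet_Ioo (a := (0 : ℝ)) (b := 1)))).exists
    exact ⟨r, h1, h2.1, h2.2⟩
  have hs := ((integrable_comp_smul_iff volume _ hr0.ne').2 hr).integrableOn (s := simplexSet n)
  refine IntegrableOn.congr_fun (hs.const_mul (((∏ i : Fin n, r ^ (κ i.castSucc - 1 / 2)) *
    r ^ (κ (Fin.last n) - 1 / 2))⁻¹)) (fun x hx => ?_)
    (isOpen_simplexSet n).measurableSet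
  have hs0 : 0 < 1 - ∑ i, x i := sub_pos.2 hx.2
  have hsum : 0 ≤ ∑ i, x i := Finset.sum_nonneg fun i _ => (hx.1 i).le
  have e1 : ∀ i : Fin n, p i.castSucc ((r • x) i) =
      r ^ (κ i.castSucc - 1 / 2) * x i ^ (κ i.castSucc - 1 / 2) := fun i => by
    have h1 : x i ≤ 1 := (simplexSet_subset_Icc n hx).2 i
    have h0 := hx.1 i
    rw [hpdef, Pi.smul_apply, smul_eq_mul]
    rw [← mul_rpow hr0.le h0.le]
    exact Set.indicator_of_mem (s := Set.Ioo (0 : ℝ) 1) ⟨by positivity, by nlinarith⟩ _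
  have e2 : p (Fin.last n) (r - ∑ i, (r • x) i) =
      r ^ (κ (Fin.last n) - 1 / 2) * (1 - ∑ i, x i) ^ (κ (Fin.last n) - 1 / 2) := by
    have : r - ∑ i, (r • x) i = r * (1 - ∑ i, x i) := by
      simp only [Pi.smul_apply, smul_eq_mul, ← Finset.mul_sum]; ring
    rw [this, ← mul_rpow hr0.le hs0.le, hpdef]
    exact Set.indicator_of_mem (s := Set.Ioo (0 : ℝ) 1) ⟨by positivity, by nlinarith⟩ _
  simp only [e1, e2, Finset.prod_mul_distrib, simplexW]
  have : 0 < ∏ i : Fin n, r ^ (κ i.castSucc - 1 / 2) :=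
    Finset.prod_pos fun i _ => rpow_pos_of_pos hr0 _
  have := rpow_pos_of_pos hr0 (κ (Fin.last n) - 1 / 2)
  rw [inv_mul_eq_div, div_eq_iff (by positivity)]
  ring

theorem contDiff_eval_mvPolynomial {n : ℕ} {m : WithTop ℕ∞} (p : MvPolynomial (Fin n) ℝ) :
    ContDiff ℝ m fun x => eval x p :=
  (AnalyticOnNhd.eval_mvPolynomial (𝕜 := ℝ) p).contDiff

theorem fderiv_eval_mvPolynomial {n : ℕ} (p : MvPolynomial (Fin n) ℝ) (x : Fin n → ℝ)
    (j : Fin n) : fderiv ℝ (fun y => eval y p) x (Pi.single j 1) = eval x (pderiv j p) := by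
  have hd : ∀ q : MvPolynomial (Fin n) ℝ, DifferentiableAt ℝ (fun y => eval y q) x := fun q =>
    ((contDiff_eval_mvPolynomial q (m := 1)).differentiable one_ne_zero).differentiableAt
  induction p using MvPolynomial.induction_on with
  | C a => simp
  | add p q hp hq =>
    simp only [map_add]
    rw [fderiv_fun_add (hd p) (hd q), _root_.add_apply, hp, hq]
  | mul_X p i hp =>
    have hX : HasFDerivAt (fun y : Fin n → ℝ => y i) (ContinuousLinearMap.proj i) x :=
      hasFDerivAt_apply (𝕜 := ℝ) (F' := fun _ => ℝ) i x
    simp only [eval_mul, eval_X]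
    rw [fderiv_fun_mul (hd p) hX.differentiableAt, hX.fderiv]
    simp only [_root_.add_apply, _root_.smul_apply, hp, smul_eq_mul,
      ContinuousLinearMap.proj_apply, Derivation.leibniz, pderiv_X, eval_add, eval_mul, eval_X]
    rcases eq_or_ne i j with rfl | hij
    · simp
    · simp [hij]

theorem exists_abs_eval_le {n : ℕ} (p : MvPolynomial (Fin n) ℝ) :
    ∃ C : ℝ, 0 ≤ C ∧ ∀ x ∈ simplexSet n, |eval x p| ≤ C := by
  obtain ⟨C, hC⟩ := (isCompact_Icc (a := (0 : Fin n → ℝ)) (b := 1)).exists_bound_of_continuousOn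
    (contDiff_eval_mvPolynomial p (m := 0)).continuous.continuousOn
  exact ⟨|C|, abs_nonneg C, fun x hx => (hC x (simplexSet_subset_Icc n hx)).trans (le_abs_self C)⟩

/-- The product of functions of the barycentric coordinates `x_1, …, x_n, 1 - |x|`. -/
def baryProd {n : ℕ} (u : Fin n → ℝ → ℝ) (v : ℝ → ℝ) (x : Fin n → ℝ) : ℝ :=
  (∏ i, u i (x i)) * v (1 - ∑ i, x i)

theorem contDiffAt_baryProd {n : ℕ} {m : WithTop ℕ∞} {u : Fin n → ℝ → ℝ} {v : ℝ → ℝ}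
    {x : Fin n → ℝ} (hu : ∀ i, ContDiffAt ℝ m (u i) (x i))
    (hv : ContDiffAt ℝ m v (1 - ∑ i, x i)) : ContDiffAt ℝ m (baryProd u v) x := by
  refine ContDiffAt.mul (contDiffAt_prod fun i _ => ?_) ?_
  · exact (hu i).comp x (contDiff_apply ℝ ℝ i).contDiffAt
  · exact hv.comp x (f := fun x : Fin n → ℝ => 1 - ∑ i, x i) (by fun_prop)

theorem fderiv_baryProd {n : ℕ} {u : Fin n → ℝ → ℝ} {v : ℝ → ℝ} {x : Fin n → ℝ}
    (hu : ∀ i, DifferentiableAt ℝ (u i) (x i)) (hv : DifferentiableAt ℝ v (1 - ∑ i, x i))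
    (j : Fin n) : fderiv ℝ (baryProd u v) x (Pi.single j 1) =
      deriv (u j) (x j) * (∏ i ∈ Finset.univ.erase j, u i (x i)) * v (1 - ∑ i, x i)
        - (∏ i, u i (x i)) * deriv v (1 - ∑ i, x i) := by
  have h1 : HasFDerivAt (fun x : Fin n → ℝ => ∏ i, u i (x i)) _ x :=
    HasFDerivAt.finsetProd (u := Finset.univ) (g := fun i (x : Fin n → ℝ) => u i (x i))
      fun i _ => ((hu i).hasDerivAt.comp_hasFDerivAt x
        (hasFDerivAt_apply (𝕜 := ℝ) (F' := fun _ => ℝ) i x))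
  have h2 : HasFDerivAt (fun x : Fin n → ℝ => v (1 - ∑ i, x i)) _ x :=
    hv.hasDerivAt.comp_hasFDerivAt x ((HasFDerivAt.fun_sum (u := Finset.univ) fun i _ =>
      hasFDerivAt_apply (𝕜 := ℝ) (F' := fun _ => ℝ) i x).const_sub 1)
  rw [show baryProd u v = fun x => (∏ i, u i (x i)) * v (1 - ∑ i, x i) from rfl,
    (h1.fun_mul h2).fderiv]
  simp only [_root_.add_apply, _root_.smul_apply, smul_eq_mul,
    _root_.neg_apply, _root_.sum_apply, ContinuousLinearMap.proj_apply]
  have e1 : ∀ g : Fin n → ℝ, ∑ i, g i * (Pi.single j 1 : Fin n → ℝ) i = g j := fun g => by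
    simp [Pi.single_apply]
  have e2 : ∑ i, (Pi.single j 1 : Fin n → ℝ) i = 1 := by simp
  simp only [← mul_assoc]
  rw [e1, e2]
  ring

/-- The derivative of a barycentric product along the field `x_j (p_j - ∑ x_i p_i)`, expressed
through the Euler derivatives `t u'(t)` of the factors. -/
theorem sum_mul_fderiv_baryProd {n : ℕ} {u : Fin n → ℝ → ℝ} {v : ℝ → ℝ} {x : Fin n → ℝ}
    (hu : ∀ i, DifferentiableAt ℝ (u i) (x i)) (hv : DifferentiableAt ℝ v (1 - ∑ i, x i))
    (p : Fin n → ℝ) :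
    ∑ j, x j * (p j - ∑ i, x i * p i) * fderiv ℝ (baryProd u v) x (Pi.single j 1) =
      (∑ j, (p j - ∑ i, x i * p i) * (x j * deriv (u j) (x j)) *
          ((∏ i ∈ Finset.univ.erase j, u i (x i)) * v (1 - ∑ i, x i)))
        - (∑ i, x i * p i) * (∏ i, u i (x i)) *
          ((1 - ∑ i, x i) * deriv v (1 - ∑ i, x i)) := by
  have key : ∑ j, x j * (p j - ∑ i, x i * p i) = (∑ i, x i * p i) * (1 - ∑ i, x i) := by
    simp only [mul_sub, Finset.sum_sub_distrib, ← Finset.sum_mul]; ring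
  rw [show (∑ i, x i * p i) * (∏ i, u i (x i)) * ((1 - ∑ i, x i) * deriv v (1 - ∑ i, x i)) =
    (∑ j, x j * (p j - ∑ i, x i * p i)) * ((∏ i, u i (x i)) * deriv v (1 - ∑ i, x i)) by
      rw [key]; ring, Finset.sum_mul, ← Finset.sum_sub_distrib]
  refine Finset.sum_congr rfl fun j _ => ?_
  rw [fderiv_baryProd hu hv]
  ring

/-- A smooth step vanishing for `t ≤ 1` and equal to `1` for `t ≥ 2`. -/
def smoothStep (t : ℝ) : ℝ := smoothTransition (t - 1)

theorem contDiff_smoothStep {m : ℕ∞} : ContDiff ℝ m smoothStep :=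
  smoothTransition.contDiff.comp (contDiff_id.sub contDiff_const)

theorem abs_smoothStep_le_one (t : ℝ) : |smoothStep t| ≤ 1 :=
  abs_le.2 ⟨by linarith [show 0 ≤ smoothStep t from smoothTransition.nonneg (t - 1)],
    smoothTransition.le_one _⟩

theorem smoothStep_of_le_one {t : ℝ} (ht : t ≤ 1) : smoothStep t = 0 :=
  smoothTransition.zero_of_nonpos (by linarith)

theorem smoothStep_of_two_le {t : ℝ} (ht : 2 ≤ t) : smoothStep t = 1 :=
  smoothTransition.one_of_one_le (by linarith)

theorem deriv_smoothStep_of_lt_one {t : ℝ} (ht : t < 1) : deriv smoothStep t = 0 := by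
  have : smoothStep =ᶠ[𝓝 t] fun _ => 0 :=
    (eventually_lt_nhds ht).mono fun y hy => smoothStep_of_le_one hy.le
  rw [this.deriv_eq, deriv_const]

theorem deriv_smoothStep_of_two_lt {t : ℝ} (ht : 2 < t) : deriv smoothStep t = 0 := by
  have : smoothStep =ᶠ[𝓝 t] fun _ => 1 :=
    (eventually_gt_nhds ht).mono fun y hy => smoothStep_of_two_le hy.le
  rw [this.deriv_eq, deriv_const]

theorem exists_abs_mul_deriv_smoothStep_le :
    ∃ C : ℝ, 0 ≤ C ∧ ∀ t : ℝ, |t * deriv smoothStep t| ≤ C := by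
  have hc : Continuous fun t : ℝ => t * deriv smoothStep t :=
    continuous_id.mul ((contDiff_smoothStep (m := 1)).continuous_deriv (by simp))
  obtain ⟨C, hC⟩ := (isCompact_Icc (a := (1 : ℝ)) (b := 2)).exists_bound_of_continuousOn
    hc.continuousOn
  refine ⟨|C|, abs_nonneg C, fun t => ?_⟩
  rcases lt_or_ge t 1 with h1 | h1
  · simp [deriv_smoothStep_of_lt_one h1]
  rcases lt_or_ge 2 t with h2 | h2
  · simp [deriv_smoothStep_of_two_lt h2]
  exact (hC t ⟨h1, h2⟩).trans (le_abs_self C)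

/-- A cutoff of the simplex at distance of order `1 / k` from its faces. -/
def simplexCutoff (n : ℕ) (k : ℝ) : (Fin n → ℝ) → ℝ :=
  baryProd (fun _ t => smoothStep (k * t)) fun t => smoothStep (k * t)

theorem contDiff_simplexCutoff (n : ℕ) (k : ℝ) : ContDiff ℝ 1 (simplexCutoff n k) := by
  have h : ContDiff ℝ 1 fun t => smoothStep (k * t) :=
    (contDiff_smoothStep (m := 1)).comp (contDiff_const.mul contDiff_id)
  exact contDiff_iff_contDiffAt.2 fun x =>
    contDiffAt_baryProd (fun _ => h.contDiffAt) h.contDiffAt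

theorem abs_simplexCutoff_le_one (n : ℕ) (k : ℝ) (x : Fin n → ℝ) : |simplexCutoff n k x| ≤ 1 := by
  rw [simplexCutoff, baryProd, abs_mul, Finset.abs_prod]
  exact mul_le_one₀ (Finset.prod_le_one (fun _ _ => abs_nonneg _)
    fun _ _ => abs_smoothStep_le_one _) (abs_nonneg _) (abs_smoothStep_le_one _)

theorem simplexCutoff_eventuallyEq_zero {n : ℕ} {k : ℝ} (hk : 0 < k) {x : Fin n → ℝ}
    (hx : x ∉ simplexSet n) : simplexCutoff n k =ᶠ[𝓝 x] 0 := by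
  rw [simplexSet, Set.mem_ofPred_eq, not_and_or, not_forall] at hx
  rcases hx with ⟨i, hi⟩ | hs
  · have : ∀ᶠ y : Fin n → ℝ in 𝓝 x, k * y i < 1 :=
      (continuous_const.mul (continuous_apply i)).continuousAt.eventually_lt_const
        (show k * x i < 1 by nlinarith [not_lt.1 hi])
    filter_upwards [this] with y hy
    simp only [simplexCutoff, baryProd, Pi.zero_apply]
    rw [Finset.prod_eq_zero (Finset.mem_univ i) (smoothStep_of_le_one hy.le), zero_mul]
  · have hc : Continuous fun y : Fin n → ℝ => k * (1 - ∑ i, y i) := by fun_prop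
    have : ∀ᶠ y : Fin n → ℝ in 𝓝 x, k * (1 - ∑ i, y i) < 1 :=
      hc.continuousAt.eventually_lt_const (by nlinarith [not_lt.1 hs])
    filter_upwards [this] with y hy
    simp only [simplexCutoff, baryProd, Pi.zero_apply]
    rw [smoothStep_of_le_one hy.le, mul_zero]

theorem eventually_simplexCutoff_eq_one {n : ℕ} {x : Fin n → ℝ} (hx : x ∈ simplexSet n) :
    ∀ᶠ k : ℝ in atTop, (∀ i, 2 < k * x i) ∧ 2 < k * (1 - ∑ i, x i) ∧ simplexCutoff n k x = 1 := by
  have h1 : ∀ᶠ k : ℝ in atTop, ∀ i, 2 < k * x i := eventually_all.2 fun i =>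
    (tendsto_id.atTop_mul_const (hx.1 i)).eventually_gt_atTop 2
  have h2 : ∀ᶠ k : ℝ in atTop, 2 < k * (1 - ∑ i, x i) :=
    (tendsto_id.atTop_mul_const (sub_pos.2 hx.2)).eventually_gt_atTop 2
  filter_upwards [h1, h2] with k h1 h2
  refine ⟨h1, h2, ?_⟩
  simp [simplexCutoff, baryProd, smoothStep_of_two_le (h1 _).le, smoothStep_of_two_le h2.le]

/-- The field `x_j (∂_j f - ∑ x_i ∂_i f)`, i.e. `∑_i (δ_{ij} x_i - x_i x_j) ∂_i f`. -/
def simplexField (n : ℕ) (f : MvPolynomial (Fin n) ℝ) (j : Fin n) : MvPolynomial (Fin n) ℝ :=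
  X j * (pderiv j f - ∑ i, X i * pderiv i f)

theorem eval_simplexField {n : ℕ} (f : MvPolynomial (Fin n) ℝ) (j : Fin n) (x : Fin n → ℝ) :
    eval x (simplexField n f j) =
      x j * (eval x (pderiv j f) - ∑ i, x i * eval x (pderiv i f)) := by
  simp [simplexField]

theorem sum_simplexField_mul_fderiv_simplexCutoff {n : ℕ} (f : MvPolynomial (Fin n) ℝ) (k : ℝ)
    (x : Fin n → ℝ) :
    ∑ j, eval x (simplexField n f j) * fderiv ℝ (simplexCutoff n k) x (Pi.single j 1) =
      (∑ j, (eval x (pderiv j f - ∑ i, X i * pderiv i f)) *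
          (k * x j * deriv smoothStep (k * x j)) *
          ((∏ i ∈ Finset.univ.erase j, smoothStep (k * x i)) * smoothStep (k * (1 - ∑ i, x i))))
        - eval x (∑ i, X i * pderiv i f) * (∏ i, smoothStep (k * x i)) *
          (k * (1 - ∑ i, x i) * deriv smoothStep (k * (1 - ∑ i, x i))) := by
  have h : Differentiable ℝ fun t => smoothStep (k * t) :=
    ((contDiff_smoothStep (m := 1)).comp (contDiff_const.mul contDiff_id)).differentiable
      (by simp)
  simp only [eval_simplexField, simplexCutoff]
  rw [sum_mul_fderiv_baryProd (fun _ => h _) (h _)]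
  simp only [deriv_comp_mul_left, smul_eq_mul, map_sub, map_sum, eval_mul, eval_X]
  congr 1
  · exact Finset.sum_congr rfl fun j _ => by ring
  · ring

theorem exists_abs_sum_simplexField_mul_fderiv_simplexCutoff_le {n : ℕ}
    (f : MvPolynomial (Fin n) ℝ) : ∃ C : ℝ, 0 ≤ C ∧ ∀ k : ℝ, ∀ x ∈ simplexSet n,
      |∑ j, eval x (simplexField n f j) * fderiv ℝ (simplexCutoff n k) x (Pi.single j 1)| ≤ C := by
  obtain ⟨B, hB0, hB⟩ := exists_abs_mul_deriv_smoothStep_le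
  choose A hA0 hA using fun j : Fin n =>
    exists_abs_eval_le (pderiv j f - ∑ i, X i * pderiv i f)
  obtain ⟨E, hE0, hE⟩ := exists_abs_eval_le (∑ i : Fin n, X i * pderiv i f)
  have hprod : ∀ (s : Finset (Fin n)) (k : ℝ) (x : Fin n → ℝ),
      |∏ i ∈ s, smoothStep (k * x i)| ≤ 1 := fun s k x => by
    rw [Finset.abs_prod]
    exact Finset.prod_le_one (fun _ _ => abs_nonneg _) fun _ _ => abs_smoothStep_le_one _
  refine ⟨(∑ j, A j * B * (1 * 1)) + E * 1 * B,
    add_nonneg (Finset.sum_nonneg fun j _ => by have := hA0 j; positivity) (by positivity),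
    fun k x hx => ?_⟩
  rw [sum_simplexField_mul_fderiv_simplexCutoff]
  refine (abs_sub _ _).trans (add_le_add ((Finset.abs_sum_le_sum_abs _ _).trans
    (Finset.sum_le_sum fun j _ => ?_)) ?_)
  · rw [abs_mul, abs_mul, abs_mul (∏ i ∈ _, _)]
    have := hA0 j
    gcongr
    exacts [hA j x hx, hB _, hprod _ _ _, abs_smoothStep_le_one _]
  · rw [abs_mul, abs_mul]
    gcongr
    exacts [hE x hx, hprod _ _ _, hB _]

theorem contDiffAt_simplexW {n : ℕ} (κ : Fin (n + 1) → ℝ) {x : Fin n → ℝ}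
    (hx : x ∈ simplexSet n) : ContDiffAt ℝ 1 (simplexW n κ) x :=
  contDiffAt_baryProd (u := fun i t => t ^ (κ i.castSucc - 1 / 2))
    (v := fun t => t ^ (κ (Fin.last n) - 1 / 2))
    (fun i => contDiffAt_id.rpow_const_of_ne (hx.1 i).ne')
    (contDiffAt_id.rpow_const_of_ne (sub_pos.2 hx.2).ne')

theorem sum_simplexField_mul_fderiv_simplexW {n : ℕ} (κ : Fin (n + 1) → ℝ)
    (f : MvPolynomial (Fin n) ℝ) {x : Fin n → ℝ} (hx : x ∈ simplexSet n) :
    ∑ j, eval x (simplexField n f j) * fderiv ℝ (simplexW n κ) x (Pi.single j 1) =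
      ((∑ j, (κ j.castSucc - 1 / 2) *
          (eval x (pderiv j f) - ∑ i, x i * eval x (pderiv i f)))
        - (κ (Fin.last n) - 1 / 2) * ∑ i, x i * eval x (pderiv i f)) * simplexW n κ x := by
  have hs : 0 < 1 - ∑ i, x i := sub_pos.2 hx.2
  have hd : ∀ a t : ℝ, 0 < t → HasDerivAt (fun t : ℝ => t ^ a) (a * t ^ (a - 1)) t :=
    fun a t ht => Real.hasDerivAt_rpow_const (Or.inl ht.ne')
  have hE : ∀ a t : ℝ, 0 < t → t * deriv (fun t : ℝ => t ^ a) t = a * t ^ a := fun a t ht => by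
    rw [(hd a t ht).deriv, rpow_sub_one ht.ne']
    field_simp
  have hW : simplexW n κ = baryProd (fun i t => t ^ (κ i.castSucc - 1 / 2))
    fun t => t ^ (κ (Fin.last n) - 1 / 2) := rfl
  simp only [eval_simplexField]
  rw [hW, sum_mul_fderiv_baryProd (fun i => (hd _ _ (hx.1 i)).differentiableAt)
    (hd _ _ hs).differentiableAt, hE _ _ hs, sub_mul (Finset.sum _ _)]
  congr 1
  · rw [Finset.sum_mul]
    refine Finset.sum_congr rfl fun j _ => ?_
    rw [hE _ _ (hx.1 j), baryProd, ← Finset.mul_prod_erase _ (fun i => x i ^ (κ i.castSucc - 1 / 2)) (Finset.mem_univ j)]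
    ring
  · rw [baryProd]; ring

theorem eval_sum_pderiv_simplexField {n : ℕ} (f : MvPolynomial (Fin n) ℝ) (x : Fin n → ℝ) :
    ∑ j, eval x (pderiv j (simplexField n f j)) =
      (∑ j, eval x (pderiv j f)) - ((n : ℝ) + 1) * (∑ i, x i * eval x (pderiv i f))
        + (∑ j, x j * eval x (pderiv j (pderiv j f)))
        - ∑ i, ∑ j, x i * x j * eval x (pderiv i (pderiv j f)) := by
  have h : ∀ j, eval x (pderiv j (simplexField n f j)) =
      eval x (pderiv j f) - (∑ i, x i * eval x (pderiv i f))
        + x j * eval x (pderiv j (pderiv j f))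
        - x j * eval x (pderiv j f) - ∑ i, x j * x i * eval x (pderiv j (pderiv i f)) := by
    intro j
    have hX : ∀ i, eval x (pderiv j (X i : MvPolynomial (Fin n) ℝ)) = if i = j then 1 else 0 :=
      fun i => by rcases eq_or_ne i j with rfl | hij <;> simp_all [pderiv_X]
    simp only [simplexField, Derivation.leibniz, map_sub, map_sum, smul_eq_mul, eval_add,
      eval_mul, eval_X, hX, if_true, mul_sub, Finset.sum_add_distrib, Finset.mul_sum]
    simp [mul_add, Finset.sum_add_distrib, mul_assoc]
    ring
  simp only [h, Finset.sum_sub_distrib, Finset.sum_add_distrib, Finset.sum_const,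
    Finset.card_univ, Fintype.card_fin, nsmul_eq_mul]
  ring

/-- The operator `simplexOp` is in divergence form with respect to the weight `simplexW`. -/
theorem sum_fderiv_simplexField_mul_simplexW {n : ℕ} (κ : Fin (n + 1) → ℝ)
    (f : MvPolynomial (Fin n) ℝ) {x : Fin n → ℝ} (hx : x ∈ simplexSet n) :
    (∑ j, eval x (simplexField n f j) * fderiv ℝ (simplexW n κ) x (Pi.single j 1))
      + (∑ j, eval x (pderiv j (simplexField n f j))) * simplexW n κ x =
      eval x (simplexOp n κ f) * simplexW n κ x := by
  rw [sum_simplexField_mul_fderiv_simplexW κ f hx, eval_sum_pderiv_simplexField, ← add_mul]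
  congr 1
  have h1 : ∀ E : ℝ, ∑ j : Fin n, (κ j.castSucc - 1 / 2) * (eval x (pderiv j f) - E) =
      (∑ j : Fin n, κ j.castSucc * eval x (pderiv j f)) - 1 / 2 * (∑ j, eval x (pderiv j f))
        - (∑ j : Fin n, κ j.castSucc) * E + n / 2 * E := fun E => by
    simp only [mul_sub, sub_mul, Finset.sum_sub_distrib, Finset.mul_sum, Finset.sum_mul,
      Finset.sum_const, Finset.card_univ, Fintype.card_fin, nsmul_eq_mul]
    ring
  have h2 : ∀ c : ℝ, ∑ j : Fin n, (κ j.castSucc + 1 / 2 - c * x j) * eval x (pderiv j f) =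
      (∑ j : Fin n, κ j.castSucc * eval x (pderiv j f)) + 1 / 2 * (∑ j, eval x (pderiv j f))
        - c * ∑ j, x j * eval x (pderiv j f) := fun c => by
    simp only [sub_mul, add_mul, Finset.sum_sub_distrib, Finset.sum_add_distrib, Finset.mul_sum,
      mul_assoc]
  simp only [simplexOp, eval_add, map_sub, map_sum, eval_mul, eval_X, eval_C, h2]
  rw [h1, Fin.sum_univ_castSucc]
  ring

theorem integral_fderiv_eq_zero_of_hasCompactSupport {n : ℕ} {g : (Fin n → ℝ) → ℝ}
    (hg : ContDiff ℝ 1 g) (hc : HasCompactSupport g) (v : Fin n → ℝ) :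
    Integrable (fun x => fderiv ℝ g x v) ∧ ∫ x, fderiv ℝ g x v = 0 := by
  have hi : Integrable (fun x => fderiv ℝ g x v) :=
    ((hg.continuous_fderiv one_ne_zero).clm_apply continuous_const).integrable_of_hasCompactSupport
      (hc.fderiv_apply (𝕜 := ℝ) v)
  refine ⟨hi, ?_⟩
  have := integral_mul_fderiv_eq_neg_fderiv_mul_of_integrable (μ := volume)
    (f := fun _ : Fin n → ℝ => (1 : ℝ)) (g := g) (v := v) (by simp) (by simpa using hi)
    (by simpa using hg.continuous.integrable_of_hasCompactSupport hc)
    (fun x _ => differentiableAt_const _) (fun x _ => (hg.differentiable one_ne_zero) x)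
  simpa using this

theorem sq_sum_mul_le_of_mem_simplexSet {n : ℕ} {x : Fin n → ℝ} (hx : x ∈ simplexSet n)
    (z : Fin n → ℝ) : (∑ i, x i * z i) ^ 2 ≤ ∑ i, x i * z i ^ 2 := by
  have h := Finset.sum_sq_le_sum_mul_sum_of_sq_le_mul Finset.univ (r := fun i => x i * z i)
    (f := x) (g := fun i => x i * z i ^ 2) (fun i _ => (hx.1 i).le)
    (fun i _ => mul_nonneg (hx.1 i).le (sq_nonneg _)) (fun i _ => le_of_eq (by ring))
  have h0 : 0 ≤ ∑ i, x i * z i ^ 2 :=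
    Finset.sum_nonneg fun i _ => mul_nonneg (hx.1 i).le (sq_nonneg _)
  nlinarith [hx.2]

theorem abs_dirichlet_form_le {n : ℕ} {x : Fin n → ℝ} (hx : x ∈ simplexSet n)
    (v w : Fin n → ℝ) :
    |∑ j, x j * (v j - ∑ i, x i * v i) * w j| ≤
      (∑ i, x i * v i ^ 2) + ((∑ i, x i * w i ^ 2) - (∑ i, x i * w i) ^ 2) := by
  have h1 := sq_sum_mul_le_of_mem_simplexSet hx (fun i => v i + w i)
  have h2 := sq_sum_mul_le_of_mem_simplexSet hx (fun i => v i - w i)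
  have h3 := sq_sum_mul_le_of_mem_simplexSet hx w
  have h4 := sq_sum_mul_le_of_mem_simplexSet hx v
  have e : ∑ j, x j * (v j - ∑ i, x i * v i) * w j =
      (∑ j, x j * (v j * w j)) - (∑ i, x i * v i) * ∑ i, x i * w i := by
    rw [Finset.mul_sum, ← Finset.sum_sub_distrib]
    exact Finset.sum_congr rfl fun j _ => by ring
  have e1 : ∑ i, x i * (v i + w i) ^ 2 =
      (∑ i, x i * v i ^ 2) + 2 * (∑ j, x j * (v j * w j)) + ∑ i, x i * w i ^ 2 := by
    rw [Finset.mul_sum, ← Finset.sum_add_distrib, ← Finset.sum_add_distrib]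
    exact Finset.sum_congr rfl fun j _ => by ring
  have e2 : ∑ i, x i * (v i - w i) ^ 2 =
      (∑ i, x i * v i ^ 2) - 2 * (∑ j, x j * (v j * w j)) + ∑ i, x i * w i ^ 2 := by
    rw [Finset.mul_sum, ← Finset.sum_sub_distrib, ← Finset.sum_add_distrib]
    exact Finset.sum_congr rfl fun j _ => by ring
  have e3 : ∑ i, x i * (v i + w i) = (∑ i, x i * v i) + ∑ i, x i * w i := by
    simp only [mul_add, Finset.sum_add_distrib]
  have e4 : ∑ i, x i * (v i - w i) = (∑ i, x i * v i) - ∑ i, x i * w i := by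
    simp only [mul_sub, Finset.sum_sub_distrib]
  rw [e1, e3] at h1
  rw [e2, e4] at h2
  rw [e, abs_le]
  constructor <;> nlinarith [sq_nonneg (∑ i, x i * v i)]

/-- The compactly supported field to which the divergence theorem is applied. -/
def cutoffField (n : ℕ) (κ : Fin (n + 1) → ℝ) (f : MvPolynomial (Fin n) ℝ)
    (h : (Fin n → ℝ) → ℝ) (k : ℝ) (j : Fin n) (x : Fin n → ℝ) : ℝ :=
  simplexCutoff n k x * (h x * (eval x (simplexField n f j) * simplexW n κ x))

section CutoffField

variable {n : ℕ} {κ : Fin (n + 1) → ℝ} {f : MvPolynomial (Fin n) ℝ} {h : (Fin n → ℝ) → ℝ}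

theorem cutoffField_eventuallyEq_zero {k : ℝ} (hk : 0 < k) (j : Fin n) {x : Fin n → ℝ}
    (hx : x ∉ simplexSet n) : cutoffField n κ f h k j =ᶠ[𝓝 x] fun _ => 0 :=
  (simplexCutoff_eventuallyEq_zero hk hx).mono fun y hy => by simp [cutoffField, hy]

theorem contDiff_cutoffField (hh : ∀ x ∈ simplexSet n, ContDiffAt ℝ 1 h x) {k : ℝ} (hk : 0 < k)
    (j : Fin n) : ContDiff ℝ 1 (cutoffField n κ f h k j) := by
  refine contDiff_iff_contDiffAt.2 fun x => ?_
  by_cases hx : x ∈ simplexSet n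
  · exact (contDiff_simplexCutoff n k).contDiffAt.mul ((hh x hx).mul
      ((contDiff_eval_mvPolynomial _).contDiffAt.mul (contDiffAt_simplexW κ hx)))
  · exact contDiffAt_const.congr_of_eventuallyEq (cutoffField_eventuallyEq_zero hk j hx)

theorem hasCompactSupport_cutoffField {k : ℝ} (hk : 0 < k) (j : Fin n) :
    HasCompactSupport (cutoffField n κ f h k j) :=
  HasCompactSupport.intro isCompact_Icc fun _ hx =>
    (cutoffField_eventuallyEq_zero hk j fun hx' => hx (simplexSet_subset_Icc n hx')).eq_of_nhds

theorem setIntegral_sum_fderiv_cutoffField (hh : ∀ x ∈ simplexSet n, ContDiffAt ℝ 1 h x) {k : ℝ}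
    (hk : 0 < k) :
    ∫ x in simplexSet n, ∑ j, fderiv ℝ (cutoffField n κ f h k j) x (Pi.single j 1) = 0 := by
  rw [setIntegral_eq_integral_of_forall_compl_eq_zero fun x hx => Finset.sum_eq_zero fun j _ => by
    rw [(cutoffField_eventuallyEq_zero hk j hx).fderiv_eq]; simp]
  have H := fun j => integral_fderiv_eq_zero_of_hasCompactSupport
    (contDiff_cutoffField (κ := κ) (f := f) hh hk j) (hasCompactSupport_cutoffField hk j)
    (Pi.single j 1)
  rw [integral_finsetSum _ fun j _ => (H j).1]
  exact Finset.sum_eq_zero fun j _ => (H j).2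

theorem sum_fderiv_cutoffField (hh : ∀ x ∈ simplexSet n, ContDiffAt ℝ 1 h x) (k : ℝ)
    {x : Fin n → ℝ} (hx : x ∈ simplexSet n) :
    ∑ j, fderiv ℝ (cutoffField n κ f h k j) x (Pi.single j 1) =
      simplexCutoff n k x * (h x * eval x (simplexOp n κ f) * simplexW n κ x +
        (∑ j, eval x (simplexField n f j) * fderiv ℝ h x (Pi.single j 1)) * simplexW n κ x) +
      h x * simplexW n κ x * ∑ j, eval x (simplexField n f j) *
        fderiv ℝ (simplexCutoff n k) x (Pi.single j 1) := by
  have dχ : DifferentiableAt ℝ (simplexCutoff n k) x :=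
    (contDiff_simplexCutoff n k).contDiffAt.differentiableAt one_ne_zero
  have dh : DifferentiableAt ℝ h x := (hh x hx).differentiableAt one_ne_zero
  have dp : ∀ j, DifferentiableAt ℝ (fun y => eval y (simplexField n f j)) x := fun j =>
    (contDiff_eval_mvPolynomial _ (m := 1)).contDiffAt.differentiableAt one_ne_zero
  have dW : DifferentiableAt ℝ (simplexW n κ) x :=
    (contDiffAt_simplexW κ hx).differentiableAt one_ne_zero
  have key : ∀ j, fderiv ℝ (cutoffField n κ f h k j) x (Pi.single j 1) =
      simplexCutoff n k x * h x *
        (eval x (simplexField n f j) * fderiv ℝ (simplexW n κ) x (Pi.single j 1) +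
          eval x (pderiv j (simplexField n f j)) * simplexW n κ x) +
      simplexCutoff n k x * simplexW n κ x *
        (eval x (simplexField n f j) * fderiv ℝ h x (Pi.single j 1)) +
      h x * simplexW n κ x *
        (eval x (simplexField n f j) * fderiv ℝ (simplexCutoff n k) x (Pi.single j 1)) := by
    intro j
    have e : cutoffField n κ f h k j = fun x =>
      simplexCutoff n k x * (h x * (eval x (simplexField n f j) * simplexW n κ x)) := rfl
    rw [e, fderiv_fun_mul dχ (dh.fun_mul ((dp j).fun_mul dW)),
      fderiv_fun_mul dh ((dp j).fun_mul dW), fderiv_fun_mul (dp j) dW]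
    simp only [_root_.add_apply, _root_.smul_apply, smul_eq_mul, fderiv_eval_mvPolynomial]
    ring
  simp only [key, Finset.sum_add_distrib, ← Finset.mul_sum]
  rw [← Finset.sum_mul, sum_fderiv_simplexField_mul_simplexW κ f hx]
  ring

end CutoffField

theorem integrableOn_eval_mul_simplexW {n : ℕ} {κ : Fin (n + 1) → ℝ}
    (hκ : ∀ i, -(1 / 2 : ℝ) < κ i) {h : (Fin n → ℝ) → ℝ} (hc : ContinuousOn h (simplexSet n))
    {M : ℝ} (hM : ∀ x ∈ simplexSet n, |h x| ≤ M) (p : MvPolynomial (Fin n) ℝ) :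
    IntegrableOn (fun x => h x * eval x p * simplexW n κ x) (simplexSet n) := by
  have hm := (isOpen_simplexSet n).measurableSet
  obtain ⟨C, -, hC⟩ := exists_abs_eval_le p
  refine Integrable.bdd_mul (c := M * C) (integrableOn_simplexW n κ hκ)
    ((hc.mul (contDiff_eval_mvPolynomial p (m := 0)).continuous.continuousOn).aestronglyMeasurable
      hm) ((ae_restrict_iff' hm).2 (ae_of_all _ fun x hx => ?_))
  rw [norm_mul]
  exact mul_le_mul (hM x hx) (hC x hx) (abs_nonneg _) ((abs_nonneg _).trans (hM x hx))

theorem integrableOn_sum_simplexField_mul_fderiv_mul_simplexW {n : ℕ} {κ : Fin (n + 1) → ℝ}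
    (hκ : ∀ i, -(1 / 2 : ℝ) < κ i) (f : MvPolynomial (Fin n) ℝ) (h : (Fin n → ℝ) → ℝ)
    (hint : ∫⁻ x in simplexSet n,
        ENNReal.ofReal ((4 * ((∑ i, x i * (fderiv ℝ h x (Pi.single i 1)) ^ 2)
            - (∑ i, x i * fderiv ℝ h x (Pi.single i 1)) ^ 2))
          * simplexW n κ x) < ⊤) :
    IntegrableOn (fun x => (∑ j, eval x (simplexField n f j) * fderiv ℝ h x (Pi.single j 1)) *
      simplexW n κ x) (simplexSet n) := by
  have hm := (isOpen_simplexSet n).measurableSet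
  have hW := integrableOn_simplexW n κ hκ
  have hD : ∀ j : Fin n, Measurable fun x => fderiv ℝ h x (Pi.single j 1) := fun j =>
    measurable_fderiv_apply_const ℝ h _
  have hE : IntegrableOn (fun x => (4 * ((∑ i, x i * (fderiv ℝ h x (Pi.single i 1)) ^ 2)
      - (∑ i, x i * fderiv ℝ h x (Pi.single i 1)) ^ 2)) * simplexW n κ x) (simplexSet n) := by
    refine ⟨AEStronglyMeasurable.mul (Measurable.aestronglyMeasurable (by fun_prop)) hW.1, ?_⟩
    rw [hasFiniteIntegral_iff_ofReal]
    · exact hint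
    · refine (ae_restrict_iff' hm).2 (ae_of_all _ fun x hx => mul_nonneg (mul_nonneg four_pos.le
        (sub_nonneg.2 (sq_sum_mul_le_of_mem_simplexSet hx _))) (simplexW_nonneg κ hx))
  obtain ⟨C, hC0, hC⟩ := exists_abs_eval_le (∑ i, X i * pderiv i f ^ 2)
  have hp : ∀ j, Measurable fun x : Fin n → ℝ => eval x (simplexField n f j) := fun j =>
    (contDiff_eval_mvPolynomial _ (m := 0)).continuous.measurable
  refine ((hW.const_mul C).add (hE.const_mul (1 / 4))).mono'
    (AEStronglyMeasurable.mul (Measurable.aestronglyMeasurable (by fun_prop)) hW.1)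
    ((ae_restrict_iff' hm).2 (ae_of_all _ fun x hx => ?_))
  have h1 := abs_dirichlet_form_le hx (fun j => eval x (pderiv j f))
    (fun j => fderiv ℝ h x (Pi.single j 1))
  have h2 := (le_abs_self _).trans (hC x hx)
  simp only [map_sum, eval_mul, eval_X, map_pow] at h2
  simp only [eval_simplexField, Pi.add_apply, norm_mul, Real.norm_eq_abs,
    abs_of_nonneg (simplexW_nonneg κ hx)]
  have h3 := mul_le_mul_of_nonneg_right (h1.trans (add_le_add_left h2 _)) (simplexW_nonneg κ hx)
  linarith

theorem integral_divergence_eq_zero {n : ℕ} {κ : Fin (n + 1) → ℝ}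
    (hκ : ∀ i, -(1 / 2 : ℝ) < κ i) (f : MvPolynomial (Fin n) ℝ) {h : (Fin n → ℝ) → ℝ}
    (hh : ∀ x ∈ simplexSet n, ContDiffAt ℝ 1 h x) {M : ℝ} (hM : ∀ x ∈ simplexSet n, |h x| ≤ M)
    (hi : IntegrableOn (fun x => h x * eval x (simplexOp n κ f) * simplexW n κ x +
      (∑ j, eval x (simplexField n f j) * fderiv ℝ h x (Pi.single j 1)) * simplexW n κ x)
      (simplexSet n)) :
    ∫ x in simplexSet n, (h x * eval x (simplexOp n κ f) * simplexW n κ x +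
      (∑ j, eval x (simplexField n f j) * fderiv ℝ h x (Pi.single j 1)) * simplexW n κ x) = 0 := by
  have hm := (isOpen_simplexSet n).measurableSet
  obtain ⟨C, hC0, hC⟩ := exists_abs_sum_simplexField_mul_fderiv_simplexCutoff_le f
  have hlim : Tendsto (fun k : ℝ => ∫ x in simplexSet n,
      ∑ j, fderiv ℝ (cutoffField n κ f h k j) x (Pi.single j 1)) atTop
      (𝓝 (∫ x in simplexSet n, (h x * eval x (simplexOp n κ f) * simplexW n κ x +
        (∑ j, eval x (simplexField n f j) * fderiv ℝ h x (Pi.single j 1)) *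
          simplexW n κ x))) := by
    refine tendsto_integral_filter_of_dominated_convergence _ (Eventually.of_forall fun k => ?_)
      (Eventually.of_forall fun k => (ae_restrict_iff' hm).2 (ae_of_all _ fun x hx => ?_))
      (hi.norm.add ((integrableOn_simplexW n κ hκ).const_mul (M * C)))
      ((ae_restrict_iff' hm).2 (ae_of_all _ fun x hx => ?_))
    · exact (Finset.measurable_fun_sum _ fun j _ =>
        measurable_fderiv_apply_const ℝ _ _).aestronglyMeasurable
    · have hw := simplexW_nonneg κ hx
      have hM0 := (abs_nonneg _).trans (hM x hx)
      rw [sum_fderiv_cutoffField hh k hx]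
      refine (norm_add_le _ _).trans (add_le_add ?_ ?_)
      · rw [norm_mul]
        exact mul_le_of_le_one_left (norm_nonneg _) (abs_simplexCutoff_le_one n k x)
      · rw [norm_mul, norm_mul, Real.norm_eq_abs, Real.norm_eq_abs, Real.norm_eq_abs,
          abs_of_nonneg hw, mul_right_comm]
        exact mul_le_mul_of_nonneg_right
          (mul_le_mul (hM x hx) (hC k x hx) (abs_nonneg _) hM0) hw
    · refine tendsto_const_nhds.congr' ?_
      filter_upwards [eventually_simplexCutoff_eq_one hx] with k hk
      rw [sum_fderiv_cutoffField hh k hx, sum_simplexField_mul_fderiv_simplexCutoff, hk.2.2]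
      simp [deriv_smoothStep_of_two_lt (hk.1 _), deriv_smoothStep_of_two_lt hk.2.1]
  refine tendsto_nhds_unique hlim (tendsto_const_nhds.congr' ?_)
  filter_upwards [eventually_gt_atTop 0] with k hk
  exact (setIntegral_sum_fderiv_cutoffField hh hk).symm

theorem sum_sum_eq_sum_simplexField {n : ℕ} (f : MvPolynomial (Fin n) ℝ) (x w : Fin n → ℝ) :
    ∑ i, ∑ j, (4 * ((if i = j then x i else 0) - x i * x j)) * eval x (pderiv i f) * w j =
      4 * ∑ j, eval x (simplexField n f j) * w j := by
  rw [Finset.sum_comm, Finset.mul_sum]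
  refine Finset.sum_congr rfl fun j _ => ?_
  have h1 : ∑ i, (if i = j then x i else 0) * eval x (pderiv i f) = x j * eval x (pderiv j f) := by
    simp
  have h2 : ∑ i, (4 * ((if i = j then x i else 0) - x i * x j)) * eval x (pderiv i f) * w j =
      4 * ((∑ i, (if i = j then x i else 0) * eval x (pderiv i f)) -
        x j * ∑ i, x i * eval x (pderiv i f)) * w j := by
    rw [Finset.mul_sum, ← Finset.sum_sub_distrib, Finset.mul_sum, Finset.sum_mul]
    exact Finset.sum_congr rfl fun i _ => by ring
  rw [h2, h1, eval_simplexField]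
  ring

/-- Green's theorem on the simplex: for a polynomial `f` and a bounded smooth function `h`
on `𝕋^n` whose weighted gradient is square integrable,
`∫ h · 4L_T f dμ = −∫ Σ_{i,j} 4(δ_{ij} x_i − x_i x_j) ∂_i f ∂_j h dμ`,
where `dμ = Π_i x_i^{κ_i−1/2} (1−|x|)^{κ_{n+1}−1/2} dx`. -/
theorem stmt4 (n : ℕ) (hn : 1 ≤ n) (κ : Fin (n + 1) → ℝ) (hκ : ∀ i, -(1 / 2 : ℝ) < κ i)
    (f : MvPolynomial (Fin n) ℝ) (h : (Fin n → ℝ) → ℝ)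
    (hsm : ContDiffOn ℝ (⊤ : ℕ∞) h (simplexSet n))
    (hbd : ∃ M : ℝ, ∀ x ∈ simplexSet n, |h x| ≤ M)
    (hint : ∫⁻ x in simplexSet n,
        ENNReal.ofReal ((4 * ((∑ i, x i * (fderiv ℝ h x (Pi.single i 1)) ^ 2)
            - (∑ i, x i * fderiv ℝ h x (Pi.single i 1)) ^ 2))
          * simplexW n κ x) < ⊤) :
    ∫ x in simplexSet n, h x * (4 * eval x (simplexOp n κ f)) * simplexW n κ x
      = -∫ x in simplexSet n,
          (∑ i, ∑ j, (4 * ((if i = j then x i else 0) - x i * x j))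
              * eval x (pderiv i f) * fderiv ℝ h x (Pi.single j 1))
            * simplexW n κ x := by
  obtain ⟨M, hM⟩ := hbd
  have hh : ∀ x ∈ simplexSet n, ContDiffAt ℝ 1 h x := fun x hx =>
    (hsm.contDiffAt ((isOpen_simplexSet n).mem_nhds hx)).of_le (by exact_mod_cast le_top)
  have i1 := integrableOn_eval_mul_simplexW hκ hsm.continuousOn hM (simplexOp n κ f)
  have i2 := integrableOn_sum_simplexField_mul_fderiv_mul_simplexW hκ f h hint
  have key := integral_divergence_eq_zero hκ f hh hM (i1.add i2)
  rw [integral_add i1 i2] at key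
  have e1 : ∀ x, h x * (4 * eval x (simplexOp n κ f)) * simplexW n κ x =
      4 * (h x * eval x (simplexOp n κ f) * simplexW n κ x) := fun x => by ring
  simp only [e1, sum_sum_eq_sum_simplexField f]
  simp only [mul_assoc (4 : ℝ), integral_const_mul]
  linarith

end
end

section
/- Let (M, d) be a metric space and let U ⊆ M be a nonempty open set such that Y := closure(U) is compact. Then for any R > 0 there exists r > 0 such that for every a ∈ Y there exists a point x_a with the open ball B(x_a, r) contained in U ∩ B(a, R). -/
/-- Let `(M,d)` be a metric space and `U ⊆ M` a nonempty open set with compact closure.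
Then for any `R > 0` there is `r > 0` such that for every `a` in the closure of `U` there is
a point `x_a` with the open ball `B(x_a, r)` contained in `U ∩ B(a, R)`. -/
theorem stmt7 {M : Type*} [MetricSpace M] (U : Set M) (hUopen : IsOpen U)
    (hUne : U.Nonempty) (hYcomp : IsCompact (closure U)) (R : ℝ) (hR : 0 < R) :
    ∃ r > (0 : ℝ), ∀ a ∈ closure U, ∃ x : M,
      Metric.ball x r ⊆ U ∩ Metric.ball a R := by
  refine hYcomp.induction_on
    (p := fun s => ∃ r > (0 : ℝ), ∀ a ∈ s, ∃ x : M, Metric.ball x r ⊆ U ∩ Metric.ball a R)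
    ⟨1, one_pos, by simp⟩ ?_ ?_ ?_
  · rintro s t hst ⟨r, hr, h⟩
    exact ⟨r, hr, fun a ha => h a (hst ha)⟩
  · rintro s t ⟨r₁, hr₁, h₁⟩ ⟨r₂, hr₂, h₂⟩
    refine ⟨min r₁ r₂, lt_min hr₁ hr₂, ?_⟩
    rintro a (ha | ha)
    · obtain ⟨x, hx⟩ := h₁ a ha
      exact ⟨x, (Metric.ball_subset_ball (min_le_left _ _)).trans hx⟩
    · obtain ⟨x, hx⟩ := h₂ a ha
      exact ⟨x, (Metric.ball_subset_ball (min_le_right _ _)).trans hx⟩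
  · intro a ha
    obtain ⟨x, hxU, hax⟩ := Metric.mem_closure_iff.1 ha (R / 2) (half_pos hR)
    obtain ⟨ε, hε, hball⟩ := Metric.isOpen_iff.1 hUopen x hxU
    have hR4 : 0 < R / 4 := by positivity
    refine ⟨Metric.ball a (R / 4), mem_nhdsWithin_of_mem_nhds (Metric.ball_mem_nhds a hR4),
      min ε (R / 4), lt_min hε hR4, fun b hb => ⟨x, fun y hy => ?_⟩⟩
    refine ⟨hball (Metric.ball_subset_ball (min_le_left _ _) hy), ?_⟩
    have hyx : dist y x < R / 4 := Metric.ball_subset_ball (min_le_right _ _) hy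
    have hba : dist b a < R / 4 := hb
    rw [Metric.mem_ball]
    have htri := dist_triangle4 y x a b
    rw [dist_comm x a, dist_comm a b] at htri
    linarith
end

section
/- Let n ≥ 1, γ > −1/2, and suppose (P_{k,j})_{k≥0, 1≤j≤N_k} is a family of real algebraic polynomials on 𝔹^n such that deg P_{k,j} ≤ k, the family is orthonormal in L²(𝔹^n, μ), the polynomials {P_{k,j} : k ≤ m, 1 ≤ j ≤ N_k} span all polynomials of degree ≤ m for every m, and L P_{k,j} = −λ_k P_{k,j} on 𝔹^n for all k, j; set P_k(x,y) = Σ_{j=1}^{N_k} P_{k,j}(x) P_{k,j}(y). Then there exists a constant c > 0 such that for every bounded function Φ on [0,∞) with supp Φ ⊆ [0, τ] for some τ > 0, and for all x, y in the closed unit ball: |Σ_{k≥0} Φ(√λ_k) P_k(x,y)| ≤ c ‖Φ‖_∞ / √(V(x, τ^{−1}) V(y, τ^{−1})). -/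
open MeasureTheory MvPolynomial Real

noncomputable section

/-- The weighted measure `μ` on the open unit ball `𝔹^n ⊂ ℝ^n` with density
`(1 - ‖x‖²)^(γ - 1/2)` with respect to Lebesgue measure. -/
def ballMeasure (n : ℕ) (γ : ℝ) : Measure (Fin n → ℝ) :=
  (volume.restrict {x : Fin n → ℝ | (∑ i, (x i) ^ 2) < 1}).withDensity
    fun x => ENNReal.ofReal ((1 - ∑ i, (x i) ^ 2) ^ (γ - 1 / 2))

/-- The distance `ρ(x,y) = arccos(x·y + √(1-‖x‖²)√(1-‖y‖²))` on the closed unit ball. -/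
def ballDist (n : ℕ) (x y : Fin n → ℝ) : ℝ :=
  Real.arccos ((∑ i, x i * y i) +
    Real.sqrt (1 - ∑ i, (x i) ^ 2) * Real.sqrt (1 - ∑ i, (y i) ^ 2))

/-- `V(x,r) = μ(B(x,r))`, the weighted volume of the ball `B(x,r) = {y : ρ(x,y) < r}`. -/
def ballVol (n : ℕ) (γ : ℝ) (x : Fin n → ℝ) (r : ℝ) : ℝ :=
  (ballMeasure n γ {y | ballDist n x y < r}).toReal

/-- The eigenvalues `λ_k = k(k + n + 2γ − 1)`. -/
def ballEig (n : ℕ) (γ : ℝ) (k : ℕ) : ℝ := k * (k + n + 2 * γ - 1)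

/-- `N_k = C(k+n-1, k)` (equal to `1` when `k = 0`). -/
def ballNk (n k : ℕ) : ℕ := (k + n - 1).choose k

/-- A multiplicative filtration of an algebra receives the total-degree filtration of
polynomials as soon as the images of the variables have degree one. -/
theorem aeval_mem_of_totalDegree_le {σ A : Type*} [CommRing A] [Algebra ℝ A]
    (F : ℕ → Submodule ℝ A) (h_one : 1 ∈ F 0) (h_mono : Monotone F)
    (h_mul : ∀ {a b : ℕ} {f g : A}, f ∈ F a → g ∈ F b → f * g ∈ F (a + b))
    {g : σ → A} (hg : ∀ i, g i ∈ F 1) {Q : MvPolynomial σ ℝ} {m : ℕ}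
    (hQ : Q.totalDegree ≤ m) : aeval g Q ∈ F m := by
  have h_pow : ∀ (i : σ) (e : ℕ), g i ^ e ∈ F e := by
    intro i e
    induction e with
    | zero => simpa using h_one
    | succ e ih => rw [pow_succ]; exact h_mul ih (hg i)
  have h_prod : ∀ (s : Finset σ) (e : σ → ℕ), ∏ i ∈ s, g i ^ e i ∈ F (∑ i ∈ s, e i) := by
    classical
    intro s e
    induction s using Finset.induction_on with
    | empty => simpa using h_one
    | insert i s hi ih =>
      rw [Finset.prod_insert hi, Finset.sum_insert hi]
      exact h_mul (h_pow i _) ih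
  rw [aeval_def, eval₂_eq]
  refine Submodule.sum_mem _ fun d hd => ?_
  rw [← Algebra.smul_def]
  refine Submodule.smul_mem _ _ (h_mono ?_ (h_prod d.support d))
  exact (le_totalDegree hd).trans hQ

/-- Real trigonometric polynomials of degree at most `m`. -/
def trigPoly (m : ℕ) : Submodule ℝ (ℝ → ℝ) where
  carrier := {f | ∃ p : Polynomial ℂ, p.natDegree ≤ 2 * m ∧
    ∀ φ : ℝ, (f φ : ℂ) * Complex.exp (φ * Complex.I) ^ m = p.eval (Complex.exp (φ * Complex.I))}
  add_mem' := by
    rintro f g ⟨p, hp, hfp⟩ ⟨q, hq, hgq⟩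
    refine ⟨p + q, (Polynomial.natDegree_add_le p q).trans (max_le hp hq), fun φ => ?_⟩
    simp [add_mul, hfp, hgq]
  zero_mem' := ⟨0, by simp, by simp⟩
  smul_mem' := by
    rintro c f ⟨p, hp, hfp⟩
    refine ⟨Polynomial.C (c : ℂ) * p, (Polynomial.natDegree_C_mul_le _ _).trans hp, fun φ => ?_⟩
    simp [mul_assoc, hfp]

theorem trigPoly_one_mem : (1 : ℝ → ℝ) ∈ trigPoly 0 := ⟨1, by simp, by simp⟩

theorem trigPoly_mul_mem {a b : ℕ} {f g : ℝ → ℝ} (hf : f ∈ trigPoly a) (hg : g ∈ trigPoly b) :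
    f * g ∈ trigPoly (a + b) := by
  obtain ⟨p, hp, hfp⟩ := hf
  obtain ⟨q, hq, hgq⟩ := hg
  refine ⟨p * q, Polynomial.natDegree_mul_le.trans (by omega), fun φ => ?_⟩
  rw [Polynomial.eval_mul, ← hfp, ← hgq]
  simp only [Pi.mul_apply, Complex.ofReal_mul]
  ring

theorem trigPoly_mono : Monotone trigPoly := by
  intro a b hab
  rintro f ⟨p, hp, hfp⟩
  refine ⟨p * Polynomial.X ^ (b - a), Polynomial.natDegree_mul_le.trans ?_, fun φ => ?_⟩
  · rw [Polynomial.natDegree_X_pow]; omega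
  · rw [Polynomial.eval_mul, ← hfp, Polynomial.eval_pow, Polynomial.eval_X, mul_assoc, ← pow_add,
      Nat.add_sub_cancel' hab]

theorem cos_sub_mem_trigPoly (k : ℕ) (θ : ℝ) :
    (fun φ => cos (k * φ - θ)) ∈ trigPoly k := by
  refine ⟨Polynomial.C (Complex.exp (-θ * Complex.I) / 2) * Polynomial.X ^ (2 * k) +
    Polynomial.C (Complex.exp (θ * Complex.I) / 2), ?_, fun φ => ?_⟩
  · refine (Polynomial.natDegree_add_le _ _).trans (max_le ?_ (by simp))
    exact Polynomial.natDegree_C_mul_X_pow_le _ _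
  · simp only [Complex.ofReal_cos, Complex.ofReal_sub, Complex.ofReal_mul, Complex.ofReal_natCast,
      Complex.cos, Polynomial.eval_add, Polynomial.eval_mul, Polynomial.eval_C,
      Polynomial.eval_pow, Polynomial.eval_X, ← Complex.exp_nat_mul]
    rw [add_div, add_mul, div_mul_eq_mul_div, div_mul_eq_mul_div, div_mul_eq_mul_div,
      ← Complex.exp_add, ← Complex.exp_add, ← Complex.exp_add]
    congr 3 <;> push_cast <;> ring

theorem cos_mem_trigPoly : cos ∈ trigPoly 1 := by simpa using cos_sub_mem_trigPoly 1 0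

theorem sin_mem_trigPoly : sin ∈ trigPoly 1 := by
  simpa [cos_sub_pi_div_two] using cos_sub_mem_trigPoly 1 (π / 2)

theorem continuous_of_mem_trigPoly {m : ℕ} {f : ℝ → ℝ} (hf : f ∈ trigPoly m) :
    Continuous f := by
  obtain ⟨p, -, hfp⟩ := hf
  have h : f = fun φ : ℝ => (p.eval (Complex.exp (φ * Complex.I)) *
      Complex.exp (-(φ * Complex.I)) ^ m).re := by
    ext φ
    rw [← hfp, mul_assoc, ← mul_pow, ← Complex.exp_add]
    simp
  rw [h]
  fun_prop

theorem sq_le_integral_sq_of_mem_trigPoly {m : ℕ} {f : ℝ → ℝ} (hf : f ∈ trigPoly m) (θ : ℝ) :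
    f θ ^ 2 ≤ (2 * m + 1) / (2 * π) * ∫ φ in (-(π / 2))..(3 * π / 2), f φ ^ 2 := by
  obtain ⟨p, hp, hfp⟩ := hf
  have h_sq : ∀ φ : ℝ, ‖p.eval (Complex.exp (φ * Complex.I))‖ ^ 2 = f φ ^ 2 := by
    intro φ
    rw [← hfp, norm_mul, norm_pow, Complex.norm_exp_ofReal_mul_I]
    simp
  have h_per : Function.Periodic (fun φ => f φ ^ 2) (2 * π) := by
    intro φ
    simp only [← h_sq]
    congr 3
    push_cast
    rw [add_mul, Complex.exp_periodic]
  have h_int : ∫ φ in (-(π / 2))..(3 * π / 2), f φ ^ 2 =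
      2 * π * ∑ i ∈ p.support, ‖p.coeff i‖ ^ 2 := by
    have := h_per.intervalIntegral_add_eq (-(π / 2)) 0
    rw [show -(π / 2) + 2 * π = 3 * π / 2 by ring, zero_add] at this
    rw [this, p.sum_sq_norm_coeff_eq_circleAverage, circleAverage]
    simp only [circleMap, zero_add, Complex.ofReal_one, one_mul, h_sq, smul_eq_mul]
    field_simp
  have h_sum : ∑ i ∈ p.support, ‖p.coeff i‖ ^ 2 =
      ∑ i ∈ Finset.range (2 * m + 1), ‖p.coeff i‖ ^ 2 := by
    refine Finset.sum_subset (fun i hi => ?_) (fun i _ hi => ?_)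
    · have := Polynomial.le_natDegree_of_mem_supp i hi
      simp; omega
    · simp [Polynomial.notMem_support_iff.1 hi]
  rw [h_int, h_sum, ← h_sq, Polynomial.eval_eq_sum_range' (n := 2 * m + 1) (by omega)]
  calc _ ≤ (∑ i ∈ Finset.range (2 * m + 1), ‖p.coeff i‖) ^ 2 := by
        gcongr
        refine (norm_sum_le _ _).trans (Finset.sum_le_sum fun i _ => ?_)
        rw [norm_mul, norm_pow, Complex.norm_exp_ofReal_mul_I]; simp
    _ ≤ _ := sq_sum_le_card_mul_sum_sq
    _ = _ := by
      rw [Finset.card_range]; push_cast; field_simp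

theorem rpow_le_of_le_mul {a b L : ℝ} (ha : 0 < a) (hb : 0 < b) (hab : a ≤ L * b)
    (hba : b ≤ L * a) (β : ℝ) : a ^ β ≤ L ^ |β| * b ^ β := by
  have hL : 0 < L := pos_of_mul_pos_left (ha.trans_le hab) hb.le
  rcases le_or_gt 0 β with h | h
  · rw [abs_of_nonneg h, ← mul_rpow hL.le hb.le]
    exact rpow_le_rpow ha.le hab h
  · have := rpow_le_rpow_of_nonpos hb hba h.le
    rw [mul_rpow hL.le ha.le] at this
    rw [abs_of_neg h, rpow_neg hL.le, ← div_eq_inv_mul, le_div_iff₀ (rpow_pos_of_pos hL _),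
      mul_comm]
    exact this

/-- The squared Dirichlet kernel centred at `θ`, normalised to be `1` there. -/
def fejer (m : ℕ) (θ φ : ℝ) : ℝ :=
  ‖∑ k ∈ Finset.range m, Complex.exp ((φ - θ : ℝ) * Complex.I) ^ k‖ ^ 2 / m ^ 2

theorem fejer_self {m : ℕ} (hm : 1 ≤ m) (θ : ℝ) : fejer m θ θ = 1 := by
  have : (m : ℝ) ≠ 0 := by positivity
  simp [fejer, this]

theorem fejer_nonneg (m : ℕ) (θ φ : ℝ) : 0 ≤ fejer m θ φ := by unfold fejer; positivity

theorem fejer_le_one (m : ℕ) (θ φ : ℝ) : fejer m θ φ ≤ 1 := by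
  unfold fejer
  refine div_le_one_of_le₀ ?_ (by positivity)
  gcongr
  refine (norm_sum_le _ _).trans ?_
  simp only [norm_pow, Complex.norm_exp_ofReal_mul_I]
  simp

theorem fejer_mul_chord_sq_le {m : ℕ} (hm : 1 ≤ m) (θ φ : ℝ) :
    fejer m θ φ * (m * ‖Complex.exp ((φ - θ : ℝ) * Complex.I) - 1‖) ^ 2 ≤ 4 := by
  have hm' : (m : ℝ) ≠ 0 := by positivity
  have h := geom_sum_mul (Complex.exp ((φ - θ : ℝ) * Complex.I)) m
  have h2 : ‖Complex.exp ((φ - θ : ℝ) * Complex.I) ^ m - 1‖ ≤ 2 := by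
    refine (norm_sub_le _ _).trans ?_
    rw [norm_pow, Complex.norm_exp_ofReal_mul_I]; norm_num
  rw [← h, norm_mul] at h2
  unfold fejer
  rw [mul_pow, div_mul_eq_mul_div, mul_left_comm, mul_div_cancel_left₀ _ (by positivity),
    ← mul_pow]
  exact (pow_le_pow_left₀ (by positivity) h2 2).trans (by norm_num)

theorem fejer_mul_one_add_sq_le {m : ℕ} (hm : 1 ≤ m) (θ φ : ℝ) :
    fejer m θ φ * (1 + m * ‖Complex.exp ((φ - θ : ℝ) * Complex.I) - 1‖) ^ 2 ≤ 10 := by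
  have h1 := fejer_mul_chord_sq_le hm θ φ
  have h2 := fejer_le_one m θ φ
  have h3 := fejer_nonneg m θ φ
  set v := m * ‖Complex.exp ((φ - θ : ℝ) * Complex.I) - 1‖
  nlinarith [mul_nonneg h3 (sq_nonneg (1 - v))]

theorem fejer_mem_trigPoly (m : ℕ) (θ : ℝ) : fejer m θ ∈ trigPoly (2 * m) := by
  have hc : (fun φ => ∑ k ∈ Finset.range m, cos (k * φ - k * θ)) ∈ trigPoly m := by
    have := Submodule.sum_mem (trigPoly m) (t := Finset.range m)
      (f := fun (k : ℕ) φ => cos (k * φ - k * θ))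
      fun k hk => trigPoly_mono (Finset.mem_range.1 hk).le (cos_sub_mem_trigPoly k (k * θ))
    convert this using 1
    ext φ; simp
  have hs : (fun φ => ∑ k ∈ Finset.range m, cos (k * φ - (k * θ + π / 2))) ∈ trigPoly m := by
    have := Submodule.sum_mem (trigPoly m) (t := Finset.range m)
      (f := fun (k : ℕ) φ => cos (k * φ - (k * θ + π / 2)))
      fun k hk => trigPoly_mono (Finset.mem_range.1 hk).le (cos_sub_mem_trigPoly k _)
    convert this using 1
    ext φ; simp
  have := Submodule.smul_mem _ ((m : ℝ) ^ 2)⁻¹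
    (Submodule.add_mem _ (trigPoly_mul_mem hc hc) (trigPoly_mul_mem hs hs))
  rw [two_mul]
  convert this using 1
  ext φ
  have h_exp : ∀ k : ℕ, Complex.exp ((φ - θ : ℝ) * Complex.I) ^ k =
      Complex.exp ((k * φ - k * θ : ℝ) * Complex.I) := by
    intro k
    rw [← Complex.exp_nat_mul]
    congr 1
    push_cast
    ring
  simp only [fejer, h_exp, ← Complex.normSq_eq_norm_sq, Complex.normSq_apply, Complex.re_sum,
    Complex.im_sum, Complex.exp_ofReal_mul_I_re, Complex.exp_ofReal_mul_I_im, Pi.smul_apply,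
    Pi.add_apply, Pi.mul_apply, smul_eq_mul, ← sub_sub, cos_sub_pi_div_two]
  ring

theorem abs_cos_sub_cos_le_chord (θ φ : ℝ) :
    |cos φ - cos θ| ≤ ‖Complex.exp ((φ - θ : ℝ) * Complex.I) - 1‖ := by
  have h : Complex.exp (φ * Complex.I) - Complex.exp (θ * Complex.I) =
      Complex.exp (θ * Complex.I) * (Complex.exp ((φ - θ : ℝ) * Complex.I) - 1) := by
    rw [mul_sub, ← Complex.exp_add]
    congr 2
    · push_cast; ring
    · simp
  have h2 := Complex.abs_re_le_norm (Complex.exp (φ * Complex.I) - Complex.exp (θ * Complex.I))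
  rw [Complex.sub_re, Complex.exp_ofReal_mul_I_re, Complex.exp_ofReal_mul_I_re] at h2
  rwa [h, norm_mul, Complex.norm_exp_ofReal_mul_I, one_mul] at h2

theorem one_sub_le_cos {φ : ℝ} (h1 : -(π / 2) ≤ φ) (h2 : φ ≤ π / 2) :
    1 - 2 / π * |φ| ≤ cos φ := by
  rw [← cos_abs]
  exact one_sub_mul_le_cos (abs_nonneg _) (abs_le.2 ⟨h1, h2⟩)

theorem volume_abs_cos_lt_le {δ : ℝ} (hδ : 0 ≤ δ) :
    volume {φ | φ ∈ Set.Ioc (-(π / 2)) (3 * π / 2) ∧ |cos φ| < δ} ≤ ENNReal.ofReal (2 * π * δ) := by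
  have hπ := pi_pos
  have key : ∀ φ, -(π / 2) ≤ φ → φ ≤ π / 2 → |cos φ| < δ → π / 2 - π * δ / 2 < |φ| := by
    intro φ h1 h2 h3
    have h4 := (one_sub_le_cos h1 h2).trans_lt ((le_abs_self _).trans_lt h3)
    have h5 : (1 - 2 / π * |φ|) * (π / 2) < δ * (π / 2) := by gcongr
    have h6 : (1 - 2 / π * |φ|) * (π / 2) = π / 2 - |φ| := by field_simp
    linarith
  have hsub : {φ | φ ∈ Set.Ioc (-(π / 2)) (3 * π / 2) ∧ |cos φ| < δ} ⊆
      (Set.Icc (-(π / 2)) (-(π / 2) + π * δ / 2) ∪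
        Set.Icc (π / 2 - π * δ / 2) (π / 2 + π * δ / 2)) ∪
        Set.Icc (3 * π / 2 - π * δ / 2) (3 * π / 2) := by
    rintro φ ⟨⟨h1, h2⟩, h3⟩
    rcases le_total φ (π / 2) with h | h
    · have := key φ h1.le h h3
      rcases lt_abs.1 this with h4 | h4
      · exact Or.inl (Or.inr ⟨by linarith, by nlinarith⟩)
      · exact Or.inl (Or.inl ⟨by linarith, by linarith⟩)
    · have := key (φ - π) (by linarith) (by linarith) (by rwa [cos_sub_pi, abs_neg])
      rcases lt_abs.1 this with h4 | h4
      · exact Or.inr ⟨by linarith, by linarith⟩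
      · exact Or.inl (Or.inr ⟨by nlinarith, by linarith⟩)
  refine (measure_mono hsub).trans ((measure_union_le _ _).trans ?_)
  refine (add_le_add_left (measure_union_le _ _) _).trans ?_
  rw [Real.volume_Icc, Real.volume_Icc, Real.volume_Icc, ← ENNReal.ofReal_add, ← ENNReal.ofReal_add]
  · apply ENNReal.ofReal_le_ofReal; linarith
  all_goals nlinarith

theorem integral_sq_le_two_mul_of_mem_trigPoly {M : ℕ} (hM : 1 ≤ M) {g : ℝ → ℝ}
    (hg : g ∈ trigPoly M) {δ : ℝ} (hδ : 0 ≤ δ) (hδM : 6 * M * δ ≤ 1) :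
    ∫ φ in Set.Ioc (-(π / 2)) (3 * π / 2), g φ ^ 2 ≤
      2 * ∫ φ in {φ | φ ∈ Set.Ioc (-(π / 2)) (3 * π / 2) ∧ δ ≤ |cos φ|}, g φ ^ 2 := by
  have hπ := pi_pos
  set J := Set.Ioc (-(π / 2)) (3 * π / 2)
  have hcont := continuous_of_mem_trigPoly hg
  have h_int : IntegrableOn (fun φ => g φ ^ 2) J :=
    ((hcont.pow 2).integrableOn_Icc).mono_set Set.Ioc_subset_Icc_self
  have hE : MeasurableSet {φ | |cos φ| < δ} :=
    (isOpen_lt (by fun_prop) continuous_const).measurableSet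
  have hF : {φ | φ ∈ J ∧ δ ≤ |cos φ|} = J ∩ {φ | |cos φ| < δ}ᶜ := by
    ext φ; simp
  have hsplit := integral_inter_add_sdiff hE h_int
  set S := ∫ φ in J, g φ ^ 2
  have hS : 0 ≤ S := setIntegral_nonneg measurableSet_Ioc fun φ _ => sq_nonneg _
  have hsup : ∀ φ, g φ ^ 2 ≤ (2 * M + 1) / (2 * π) * S := by
    intro φ
    have := sq_le_integral_sq_of_mem_trigPoly hg φ
    rwa [intervalIntegral.integral_of_le (by linarith)] at this
  have hvol : volume (J ∩ {φ | |cos φ| < δ}) ≤ ENNReal.ofReal (2 * π * δ) :=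
    volume_abs_cos_lt_le hδ
  have hsmall : ∫ φ in J ∩ {φ | |cos φ| < δ}, g φ ^ 2 ≤
      (2 * M + 1) / (2 * π) * S * (2 * π * δ) := by
    have h1 : ‖∫ φ in J ∩ {φ | |cos φ| < δ}, g φ ^ 2‖ ≤
        (2 * M + 1) / (2 * π) * S * volume.real (J ∩ {φ | |cos φ| < δ}) := by
      refine norm_setIntegral_le_of_norm_le_const (hvol.trans_lt ENNReal.ofReal_lt_top) ?_
      intro φ _
      rw [norm_of_nonneg (sq_nonneg _)]
      exact hsup φ
    refine (le_norm_self _).trans (h1.trans ?_)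
    gcongr
    exact ENNReal.toReal_le_of_le_ofReal (by positivity) hvol
  have hM' : (1 : ℝ) ≤ M := by exact_mod_cast hM
  have h2 : (2 * M + 1) / (2 * π) * S * (2 * π * δ) ≤ S / 2 := by
    have : (2 * M + 1) / (2 * π) * S * (2 * π * δ) = ((2 * M + 1) * δ) * S := by field_simp
    rw [this]
    have h3 : (2 * M + 1) * δ ≤ 1 / 2 := by nlinarith
    nlinarith
  rw [hF, ← Set.sdiff_eq]
  linarith

/-- A lower bound for the Christoffel function of trigonometric polynomials with respect to
the doubling weight `|cos|^β`. -/
theorem trigPoly_christoffel (β : ℝ) : ∃ C : ℝ, 0 < C ∧ ∀ m : ℕ, 1 ≤ m → ∀ f ∈ trigPoly m, ∀ θ : ℝ,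
    ENNReal.ofReal (f θ ^ 2 * (1 / m * (|cos θ| + 1 / m) ^ β)) ≤ ENNReal.ofReal C *
      ∫⁻ φ in Set.Ioc (-(π / 2)) (3 * π / 2), ENNReal.ofReal (|cos φ| ^ β) *
        ENNReal.ofReal (f φ ^ 2) := by
  have hπ := pi_pos
  obtain ⟨p, hp⟩ := exists_nat_ge |β|
  set D : ℝ := 1 + 6 * (2 * p + 1) with hD
  set L : ℝ := 10 ^ (2 * p) * D ^ |β| with hL
  have hLpos : 0 < L := by positivity
  refine ⟨3 * (2 * p + 1) / π * L, by positivity, fun m hm f hf θ => ?_⟩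
  have hm' : (1 : ℝ) ≤ m := by exact_mod_cast hm
  set g : ℝ → ℝ := f * fejer m θ ^ p with hg_def
  have hR : fejer m θ ^ p ∈ trigPoly (2 * m * p) := by
    clear_value g
    clear hp hL hg_def hLpos g hD L D
    induction p with
    | zero => simpa using trigPoly_one_mem
    | succ p ih => rw [pow_succ, mul_add, mul_one]; exact trigPoly_mul_mem ih (fejer_mem_trigPoly m θ)
  have hg : g ∈ trigPoly (m * (2 * p + 1)) := by
    have := trigPoly_mul_mem hf hR
    rwa [show m + 2 * m * p = m * (2 * p + 1) by ring] at this
  have hM : 1 ≤ m * (2 * p + 1) := Nat.mul_pos hm (by omega)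
  set δ : ℝ := 1 / (6 * (2 * p + 1) * m) with hδ
  have hδpos : 0 < δ := by positivity
  have h1 := integral_sq_le_two_mul_of_mem_trigPoly hM hg hδpos.le (by
    rw [hδ]; push_cast; apply le_of_eq; field_simp)
  have h2 := sq_le_integral_sq_of_mem_trigPoly hg θ
  rw [intervalIntegral.integral_of_le (by linarith)] at h2
  set J := Set.Ioc (-(π / 2)) (3 * π / 2)
  set F := {φ | φ ∈ J ∧ δ ≤ |cos φ|} with hF
  have hFm : MeasurableSet F :=
    measurableSet_Ioc.inter (isClosed_le continuous_const continuous_cos.abs).measurableSet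
  have hgθ : g θ = f θ := by simp [hg_def, fejer_self hm]
  have hcont := continuous_of_mem_trigPoly hg
  have h_int : IntegrableOn (fun φ => g φ ^ 2) F :=
    ((hcont.pow 2).integrableOn_Icc (a := -(π / 2)) (b := 3 * π / 2)).mono_set
      fun φ hφ => Set.Ioc_subset_Icc_self hφ.1
  have hSF : 0 ≤ ∫ φ in F, g φ ^ 2 := setIntegral_nonneg hFm fun φ _ => sq_nonneg _
  have h3 : f θ ^ 2 * (1 / m) ≤ 3 * (2 * p + 1) / π * ∫ φ in F, g φ ^ 2 := by
    rw [hgθ] at h2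
    have h4 : f θ ^ 2 ≤ (2 * (m * (2 * p + 1) : ℕ) + 1) / (2 * π) * (2 * ∫ φ in F, g φ ^ 2) :=
      h2.trans (by gcongr)
    have h5 : (2 * ((m * (2 * p + 1) : ℕ) : ℝ) + 1) / (2 * π) * 2 ≤
        m * (3 * (2 * p + 1) / π) := by
      push_cast
      rw [← mul_div_assoc, div_mul_eq_mul_div, div_le_div_iff₀ (by positivity) (by positivity)]
      have : (0 : ℝ) ≤ p := by positivity
      nlinarith [mul_nonneg (mul_nonneg this (by linarith : (0:ℝ) ≤ m)) hπ.le, mul_nonneg (by linarith : (0:ℝ) ≤ m - 1) hπ.le]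
    rw [mul_one_div, div_le_iff₀ (by positivity)]
    nlinarith [mul_le_mul_of_nonneg_right h5 hSF]
  have hpt : ∀ φ ∈ F, g φ ^ 2 * (|cos θ| + 1 / m) ^ β ≤ L * (|cos φ| ^ β * f φ ^ 2) := by
    rintro φ ⟨-, hφ⟩
    set v := m * ‖Complex.exp ((φ - θ : ℝ) * Complex.I) - 1‖ with hv
    have hv0 : 0 ≤ v := by positivity
    have hχ : |cos φ - cos θ| ≤ v / m := by
      rw [hv, mul_div_cancel_left₀ _ (by positivity)]
      exact abs_cos_sub_cos_le_chord θ φ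
    have hbpos : 0 < |cos φ| := hδpos.trans_le hφ
    have ha : |cos θ| + 1 / m ≤ ((1 + v) * D) * |cos φ| := by
      have e1 : |cos θ| ≤ |cos φ| + v / m := by
        have := abs_sub_abs_le_abs_sub (cos θ) (cos φ)
        rw [abs_sub_comm] at this
        linarith
      have e2 : (1 : ℝ) / m ≤ (6 * (2 * p + 1)) * |cos φ| := by
        have : (1 : ℝ) / m = (6 * (2 * p + 1)) * δ := by rw [hδ]; field_simp
        rw [this]; gcongr
      calc |cos θ| + 1 / m ≤ |cos φ| + (1 + v) * (1 / m) := by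
            rw [add_mul, one_mul, mul_one_div v]; linarith
        _ ≤ (1 + v) * |cos φ| + (1 + v) * ((6 * (2 * p + 1)) * |cos φ|) := by
            gcongr; nlinarith
        _ = _ := by rw [hD]; ring
    have hb : |cos φ| ≤ ((1 + v) * D) * (|cos θ| + 1 / m) := by
      have e1 : |cos φ| ≤ |cos θ| + v / m := by
        have := abs_sub_abs_le_abs_sub (cos φ) (cos θ)
        linarith
      have hD1 : 1 ≤ D := by rw [hD]; linarith [show (0 : ℝ) ≤ 6 * (2 * p + 1) by positivity]
      calc |cos φ| ≤ (1 + v) * |cos θ| + (1 + v) * (1 / m) := by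
            rw [add_mul 1 v (1 / (m : ℝ)), mul_one_div v]
            nlinarith [abs_nonneg (cos θ), show (0 : ℝ) < 1 / m by positivity]
        _ = (1 + v) * 1 * (|cos θ| + 1 / m) := by ring
        _ ≤ _ := by gcongr
    have hab := rpow_le_of_le_mul (by positivity) hbpos ha hb β
    rw [mul_rpow (by positivity) (by positivity)] at hab
    have hfe : (fejer m θ φ ^ p) ^ 2 * (1 + v) ^ |β| ≤ 10 ^ (2 * p) := by
      have e1 : (1 + v) ^ |β| ≤ ((1 + v) ^ 2) ^ (2 * p) := by
        rw [← pow_mul, ← rpow_natCast]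
        refine rpow_le_rpow_of_exponent_le (by linarith) (hp.trans ?_)
        push_cast
        linarith [show (0 : ℝ) ≤ p by positivity]
      calc _ ≤ (fejer m θ φ ^ p) ^ 2 * ((1 + v) ^ 2) ^ (2 * p) := by gcongr
        _ = (fejer m θ φ * (1 + v) ^ 2) ^ (2 * p) := by rw [mul_pow, ← pow_mul, mul_comm p 2]
        _ ≤ _ := pow_le_pow_left₀ (mul_nonneg (fejer_nonneg _ _ _) (by positivity))
          (fejer_mul_one_add_sq_le hm θ φ) _
    calc g φ ^ 2 * (|cos θ| + 1 / m) ^ β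
        ≤ g φ ^ 2 * ((1 + v) ^ |β| * D ^ |β| * |cos φ| ^ β) := by gcongr
      _ = ((fejer m θ φ ^ p) ^ 2 * (1 + v) ^ |β|) * (D ^ |β| * (|cos φ| ^ β * f φ ^ 2)) := by
          rw [hg_def, Pi.mul_apply, Pi.pow_apply]; ring
      _ ≤ 10 ^ (2 * p) * (D ^ |β| * (|cos φ| ^ β * f φ ^ 2)) := by gcongr
      _ = _ := by rw [hL]; ring
  set a := (|cos θ| + 1 / m) ^ β with ha
  have ha0 : 0 ≤ a := by positivity
  calc ENNReal.ofReal (f θ ^ 2 * (1 / m * a))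
      ≤ ENNReal.ofReal (3 * (2 * p + 1) / π * ∫ φ in F, g φ ^ 2 * a) := by
        apply ENNReal.ofReal_le_ofReal
        rw [integral_mul_const, ← mul_assoc, ← mul_assoc]
        gcongr
    _ = ENNReal.ofReal (3 * (2 * p + 1) / π) * ∫⁻ φ in F, ENNReal.ofReal (g φ ^ 2 * a) := by
        rw [ENNReal.ofReal_mul (by positivity), ofReal_integral_eq_lintegral_ofReal (h_int.mul_const a)
          (Filter.Eventually.of_forall fun φ => mul_nonneg (sq_nonneg _) ha0)]
    _ ≤ ENNReal.ofReal (3 * (2 * p + 1) / π) * ∫⁻ φ in F, ENNReal.ofReal L *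
          (ENNReal.ofReal (|cos φ| ^ β) * ENNReal.ofReal (f φ ^ 2)) := by
        refine mul_le_mul_right (setLIntegral_mono' hFm fun φ hφ => ?_) _
        rw [← ENNReal.ofReal_mul (by positivity), ← ENNReal.ofReal_mul (by positivity)]
        exact ENNReal.ofReal_le_ofReal (hpt φ hφ)
    _ ≤ ENNReal.ofReal (3 * (2 * p + 1) / π) * (ENNReal.ofReal L * ∫⁻ φ in J,
          (ENNReal.ofReal (|cos φ| ^ β) * ENNReal.ofReal (f φ ^ 2))) := by
        rw [lintegral_const_mul' _ _ ENNReal.ofReal_ne_top]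
        gcongr
        exact fun φ hφ => hφ.1
    _ = _ := by rw [← mul_assoc, ← ENNReal.ofReal_mul (by positivity)]

theorem measurable_ballDensity (n : ℕ) (γ : ℝ) : Measurable fun x : Fin n → ℝ =>
    ENNReal.ofReal ((1 - ∑ i, x i ^ 2) ^ (γ - 1 / 2)) := by fun_prop

theorem measurableSet_openBall (n : ℕ) : MeasurableSet {x : Fin n → ℝ | ∑ i, x i ^ 2 < 1} :=
  (isOpen_lt (by fun_prop) continuous_const).measurableSet

theorem lintegral_ballMeasure {n : ℕ} {γ : ℝ} {f : (Fin n → ℝ) → ENNReal} (hf : Measurable f) :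
    ∫⁻ x, f x ∂ballMeasure n γ = ∫⁻ x in {x : Fin n → ℝ | ∑ i, x i ^ 2 < 1},
      ENNReal.ofReal ((1 - ∑ i, x i ^ 2) ^ (γ - 1 / 2)) * f x := by
  rw [ballMeasure, lintegral_withDensity_eq_lintegral_mul _ (measurable_ballDensity n γ) hf]
  rfl

theorem lintegral_ballMeasure_zero (γ : ℝ) {f : (Fin 0 → ℝ) → ENNReal} (hf : Measurable f) :
    ∫⁻ x, f x ∂ballMeasure 0 γ = f default := by
  rw [lintegral_ballMeasure hf, volume_pi, Measure.pi_of_empty _ default]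
  simp

theorem lintegral_comp_mul_left_pi {k : ℕ} {c : ℝ} (hc : c ≠ 0) {g : (Fin k → ℝ) → ENNReal}
    (hg : Measurable g) :
    ∫⁻ x, g x = ENNReal.ofReal (|c| ^ k) * ∫⁻ w : Fin k → ℝ, g (fun j => c * w j) := by
  have h := Measure.map_addHaar_smul (volume : Measure (Fin k → ℝ)) hc
  have h2 : ∫⁻ w : Fin k → ℝ, g (c • w) = ENNReal.ofReal |(c ^ k)⁻¹| * ∫⁻ x, g x := by
    rw [← lintegral_map hg (measurable_const_smul c), h, lintegral_smul_measure]
    simp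
  have h3 : (fun w : Fin k → ℝ => g (fun j => c * w j)) = fun w => g (c • w) := rfl
  rw [h3, h2, ← mul_assoc, ← ENNReal.ofReal_mul (by positivity), abs_inv, abs_pow,
    mul_inv_cancel₀ (by positivity), ENNReal.ofReal_one, one_mul]

theorem sum_sq_insertNth {k : ℕ} (i : Fin (k + 1)) (t : ℝ) (v : Fin k → ℝ) :
    ∑ j, (i.insertNth t v : Fin (k + 1) → ℝ) j ^ 2 = t ^ 2 + ∑ j, v j ^ 2 := by
  simp [Fin.sum_univ_succAbove _ i]

theorem gap_insertNth {k : ℕ} (i : Fin (k + 1)) (φ : ℝ) (w : Fin k → ℝ) :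
    1 - ∑ j, (i.insertNth (sin φ) (fun j => cos φ * w j) : Fin (k + 1) → ℝ) j ^ 2 =
      cos φ ^ 2 * (1 - ∑ j, w j ^ 2) := by
  rw [sum_sq_insertNth, sin_sq]
  simp only [mul_pow, ← Finset.mul_sum]
  ring

theorem continuous_insertNth {k : ℕ} (i : Fin (k + 1)) :
    Continuous fun p : ℝ × (Fin k → ℝ) => (i.insertNth p.1 p.2 : Fin (k + 1) → ℝ) :=
  Continuous.finInsertNth (A := fun _ : Fin (k + 1) => ℝ) i continuous_fst continuous_snd

/-- Slicing the weighted ball by the hyperplanes orthogonal to a coordinate axis. -/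
theorem lintegral_ballMeasure_succ {k : ℕ} {γ : ℝ} (i : Fin (k + 1)) {I : Set ℝ}
    (hI : MeasurableSet I) (h_inj : Set.InjOn sin I) (h_img : sin '' I = Set.Ioo (-1) 1)
    {f : (Fin (k + 1) → ℝ) → ENNReal} (hf : Measurable f) :
    ∫⁻ y, f y ∂ballMeasure (k + 1) γ = ∫⁻ φ in I, ENNReal.ofReal (|cos φ| ^ (k + 2 * γ)) *
      ∫⁻ w, f (i.insertNth (sin φ) fun j => cos φ * w j) ∂ballMeasure k γ := by
  set S := {x : Fin (k + 1) → ℝ | ∑ i, x i ^ 2 < 1}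
  set F : (Fin (k + 1) → ℝ) → ENNReal := S.indicator fun x =>
    ENNReal.ofReal ((1 - ∑ i, x i ^ 2) ^ (γ - 1 / 2)) * f x with hF
  have hFm : Measurable F :=
    ((measurable_ballDensity _ γ).mul hf).indicator (measurableSet_openBall _)
  have hins := (continuous_insertNth i).measurable
  have h1 : ∫⁻ y, f y ∂ballMeasure (k + 1) γ =
      ∫⁻ t, ∫⁻ v : Fin k → ℝ, F (i.insertNth t v) := by
    rw [lintegral_ballMeasure hf, ← lintegral_indicator (measurableSet_openBall _)]
    have hmp := (volume_preserving_piFinSuccAbove (fun _ : Fin (k + 1) => ℝ) i).symm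
    rw [← hmp.lintegral_comp hFm]
    exact lintegral_prod _ (hFm.comp hins).aemeasurable
  have h2 : ∫⁻ t, ∫⁻ v : Fin k → ℝ, F (i.insertNth t v) =
      ∫⁻ t in Set.Ioo (-1) 1, ∫⁻ v : Fin k → ℝ, F (i.insertNth t v) := by
    symm
    apply setLIntegral_eq_of_support_subset
    intro t ht
    contrapose! ht
    simp only [Function.mem_support, not_not]
    refine (lintegral_congr fun v => ?_).trans lintegral_zero
    refine Set.indicator_of_notMem (fun hv => ht ?_) _
    have hv' : ∑ j, (i.insertNth t v : Fin (k + 1) → ℝ) j ^ 2 < 1 := hv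
    rw [sum_sq_insertNth] at hv'
    have : 0 ≤ ∑ j, v j ^ 2 := Finset.sum_nonneg fun j _ => sq_nonneg _
    exact abs_lt.1 (by rw [← sq_lt_one_iff_abs_lt_one]; linarith)
  rw [h1, h2, ← h_img, lintegral_image_eq_lintegral_abs_deriv_mul hI
    (fun φ _ => (hasDerivAt_sin φ).hasDerivWithinAt) h_inj]
  refine setLIntegral_congr_fun hI fun φ hφ => ?_
  have hs : sin φ ∈ Set.Ioo (-1 : ℝ) 1 := h_img ▸ Set.mem_image_of_mem _ hφ
  have hc : cos φ ≠ 0 := by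
    intro h
    have := sin_sq_add_cos_sq φ
    rw [h] at this
    nlinarith [hs.1, hs.2]
  have hcp : 0 < |cos φ| := abs_pos.2 hc
  have hins' : Measurable fun v : Fin k → ℝ => (i.insertNth (sin φ) v : Fin (k + 1) → ℝ) :=
    hins.comp (measurable_const.prodMk measurable_id)
  have hscale : Measurable fun w : Fin k → ℝ =>
      (i.insertNth (sin φ) (fun j => cos φ * w j) : Fin (k + 1) → ℝ) :=
    hins'.comp (by fun_prop)
  rw [lintegral_comp_mul_left_pi hc (g := fun v => F (i.insertNth (sin φ) v)) (hFm.comp hins'),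
    lintegral_ballMeasure (f := fun w => f (i.insertNth (sin φ) fun j => cos φ * w j))
      (hf.comp hscale),
    ← lintegral_indicator (measurableSet_openBall _), ← mul_assoc,
    ← ENNReal.ofReal_mul (abs_nonneg _), ← lintegral_const_mul' _ _ ENNReal.ofReal_ne_top,
    ← lintegral_const_mul' _ _ ENNReal.ofReal_ne_top]
  refine lintegral_congr fun w => ?_
  have hmem : (i.insertNth (sin φ) (fun j => cos φ * w j) : Fin (k + 1) → ℝ) ∈ S ↔
      ∑ j, w j ^ 2 < 1 := by
    have := gap_insertNth i φ w
    have hc2 : 0 < cos φ ^ 2 := by positivity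
    constructor
    · intro h
      have h' : 0 < cos φ ^ 2 * (1 - ∑ j, w j ^ 2) := this ▸ sub_pos.2 h
      linarith [(mul_pos_iff_of_pos_left hc2).1 h']
    · intro h
      exact sub_pos.1 (this ▸ mul_pos hc2 (sub_pos.2 h))
  by_cases hw : ∑ j, w j ^ 2 < 1
  · rw [hF, Set.indicator_of_mem (hmem.2 hw), Set.indicator_of_mem (show w ∈ {x : Fin k → ℝ |
      ∑ i, x i ^ 2 < 1} from hw), gap_insertNth, ← mul_assoc, ← mul_assoc,
      ← ENNReal.ofReal_mul (by positivity), ← ENNReal.ofReal_mul (by positivity)]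
    congr 2
    rw [mul_rpow (sq_nonneg _) (by linarith), ← mul_assoc, ← sq_abs, ← rpow_natCast,
      ← rpow_natCast, ← rpow_mul (abs_nonneg _), ← rpow_one_add' hcp.le (by positivity),
      ← rpow_add hcp]
    congr 2
    push_cast
    ring
  · rw [hF, Set.indicator_of_notMem (fun h => hw (hmem.1 h)), Set.indicator_of_notMem
      (show w ∉ {x : Fin k → ℝ | ∑ i, x i ^ 2 < 1} from hw)]
    simp

theorem injOn_sin_Ioo : Set.InjOn sin (Set.Ioo (-(π / 2)) (π / 2)) :=
  injOn_sin.mono Set.Ioo_subset_Icc_self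

theorem image_sin_Ioo : sin '' Set.Ioo (-(π / 2)) (π / 2) = Set.Ioo (-1) 1 := by
  ext t
  constructor
  · rintro ⟨φ, ⟨h1, h2⟩, rfl⟩
    have hc := cos_pos_of_mem_Ioo ⟨h1, h2⟩
    have := sin_sq_add_cos_sq φ
    exact abs_lt.1 (by rw [← sq_lt_one_iff_abs_lt_one]; nlinarith)
  · rintro ⟨h1, h2⟩
    exact ⟨arcsin t, ⟨neg_pi_div_two_lt_arcsin.2 h1, arcsin_lt_pi_div_two.2 h2⟩,
      sin_arcsin h1.le h2.le⟩

theorem injOn_sin_Ioo' : Set.InjOn sin (Set.Ioo (π / 2) (3 * π / 2)) := by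
  rintro a ⟨ha1, ha2⟩ b ⟨hb1, hb2⟩ h
  have := injOn_sin_Ioo (x₁ := a - π) (x₂ := b - π) ⟨by linarith, by linarith⟩
    ⟨by linarith, by linarith⟩ (by simp [sin_sub_pi, h])
  linarith

theorem image_sin_Ioo' : sin '' Set.Ioo (π / 2) (3 * π / 2) = Set.Ioo (-1) 1 := by
  rw [← image_sin_Ioo]
  ext t
  constructor
  · rintro ⟨φ, ⟨h1, h2⟩, rfl⟩
    exact ⟨π - φ, ⟨by linarith, by linarith⟩, sin_pi_sub φ⟩
  · rintro ⟨φ, ⟨h1, h2⟩, rfl⟩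
    exact ⟨π - φ, ⟨by linarith, by linarith⟩, sin_pi_sub φ⟩

theorem lintegral_slices_le {k : ℕ} {γ : ℝ} (i : Fin (k + 1))
    {f : (Fin (k + 1) → ℝ) → ENNReal} (hf : Measurable f) :
    ∫⁻ φ in Set.Ioc (-(π / 2)) (3 * π / 2), ENNReal.ofReal (|cos φ| ^ (k + 2 * γ)) *
      ∫⁻ w, f (i.insertNth (sin φ) fun j => cos φ * w j) ∂ballMeasure k γ ≤
      2 * ∫⁻ y, f y ∂ballMeasure (k + 1) γ := by
  have hπ := pi_pos
  rw [← Set.Ioc_union_Ioc_eq_Ioc (show -(π / 2) ≤ π / 2 by linarith)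
    (show π / 2 ≤ 3 * π / 2 by linarith)]
  refine (lintegral_union_le _ _ _).trans ?_
  rw [← setLIntegral_congr Ioo_ae_eq_Ioc, ← setLIntegral_congr Ioo_ae_eq_Ioc,
    two_mul (∫⁻ y, f y ∂ballMeasure (k + 1) γ)]
  rw [← lintegral_ballMeasure_succ i measurableSet_Ioo injOn_sin_Ioo image_sin_Ioo hf,
    ← lintegral_ballMeasure_succ i measurableSet_Ioo injOn_sin_Ioo' image_sin_Ioo' hf]

/-- Every point of the closed ball lies on a slice; in dimension at least two the slice can be
chosen away from the poles. -/
theorem exists_eq_insertNth {k : ℕ} {x : Fin (k + 1) → ℝ} (hx : ∑ i, x i ^ 2 ≤ 1) :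
    ∃ (i : Fin (k + 1)) (θ : ℝ) (w : Fin k → ℝ), θ ∈ Set.Icc (-(π / 2)) (π / 2) ∧
      (k = 0 ∨ 1 / 2 ≤ cos θ) ∧ ∑ j, w j ^ 2 ≤ 1 ∧
      x = i.insertNth (sin θ) (fun j => cos θ * w j) := by
  obtain ⟨i, hi⟩ : ∃ i : Fin (k + 1), k = 0 ∨ x i ^ 2 ≤ 1 / 2 := by
    rcases k with _ | k
    · exact ⟨0, Or.inl rfl⟩
    · rw [Fin.sum_univ_succ, Fin.sum_univ_succ] at hx
      have : 0 ≤ ∑ j : Fin k, x j.succ.succ ^ 2 := Finset.sum_nonneg fun j _ => sq_nonneg _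
      rcases le_total (x 0 ^ 2) (1 / 2) with h | h
      · exact ⟨0, Or.inr h⟩
      · exact ⟨Fin.succ 0, Or.inr (by linarith)⟩
  rw [Fin.sum_univ_succAbove _ i] at hx
  have hnn : 0 ≤ ∑ j, x (i.succAbove j) ^ 2 := Finset.sum_nonneg fun j _ => sq_nonneg _
  have hxi : |x i| ≤ 1 := by rw [← sq_le_one_iff_abs_le_one]; linarith
  have hsin := sin_arcsin (abs_le.1 hxi).1 (abs_le.1 hxi).2
  have hcos : cos (arcsin (x i)) ^ 2 = 1 - x i ^ 2 := by rw [cos_sq', hsin]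
  refine ⟨i, arcsin (x i), fun j => x (i.succAbove j) / cos (arcsin (x i)),
    arcsin_mem_Icc _, hi.imp_right fun h => ?_, ?_, ?_⟩
  · nlinarith [cos_arcsin_nonneg (x i)]
  · simp only [div_pow, ← Finset.sum_div, hcos]
    exact div_le_one_of_le₀ (by linarith) (by linarith)
  · refine Fin.eq_insertNth_iff.2 ⟨hsin.symm, ?_⟩
    ext j
    rcases eq_or_ne (cos (arcsin (x i))) 0 with h | h
    · have h0 : x (i.succAbove j) ^ 2 ≤ 0 := by
        refine (Finset.single_le_sum (f := fun j => x (i.succAbove j) ^ 2)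
          (fun j _ => sq_nonneg _) (Finset.mem_univ j)).trans ?_
        rw [h] at hcos
        linarith
      simpa [h, Fin.removeNth] using h0
    · rw [mul_div_cancel₀ _ h]; rfl

theorem gap_rpow_comparison (γ : ℝ) (k : ℕ) {A : ℝ} (hA : 0 ≤ A) : ∃ C : ℝ, 0 < C ∧
    ∀ c g h : ℝ, 0 ≤ c → c ≤ 1 → 0 ≤ g → g ≤ 1 → 0 < h → h ≤ A → (k = 0 ∧ g = 1 ∨ 1 / 2 ≤ c) →
      (c ^ 2 * g + h ^ 2) ^ γ ≤ C * ((c + h) ^ (k + 2 * γ) * (g + h ^ 2) ^ γ) ∧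
      (c + h) ^ (k + 2 * γ) * (g + h ^ 2) ^ γ ≤ C * (c ^ 2 * g + h ^ 2) ^ γ := by
  set L : ℝ := 4 * (1 + A) ^ 2 with hL
  have hL1 : 4 ≤ L := by nlinarith
  set K : ℝ := 2 ^ k * (1 + A) ^ k with hK
  refine ⟨K * L ^ |γ|, by positivity, fun c g h hc hc1 hg hg1 hh hhA hcase => ?_⟩
  have hsplit : (c + h) ^ (k + 2 * γ) * (g + h ^ 2) ^ γ =
      (c + h) ^ k * ((c + h) ^ 2 * (g + h ^ 2)) ^ γ := by
    rw [rpow_add (by positivity), rpow_natCast, mul_rpow (by positivity) (by positivity),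
      rpow_mul (by positivity), rpow_two, mul_assoc]
  have h1 : c ^ 2 * g + h ^ 2 ≤ L * ((c + h) ^ 2 * (g + h ^ 2)) := by
    have : c ^ 2 * g + h ^ 2 ≤ 4 * ((c + h) ^ 2 * (g + h ^ 2)) := by
      rcases hcase with ⟨-, rfl⟩ | hc2
      · nlinarith [mul_nonneg hc hh.le, sq_nonneg (h * (c + h)), sq_nonneg (c + h)]
      · have e1 : 1 / 4 ≤ (c + h) ^ 2 := by nlinarith
        have e3 : c ^ 2 ≤ 1 := by nlinarith
        have e2 : c ^ 2 * g ≤ g := mul_le_of_le_one_left hg e3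
        nlinarith [sq_nonneg h]
    exact this.trans (by gcongr)
  have h2 : (c + h) ^ 2 * (g + h ^ 2) ≤ L * (c ^ 2 * g + h ^ 2) := by
    rcases hcase with ⟨-, rfl⟩ | hc2
    · have e1 : (c + h) ^ 2 ≤ 2 * (c ^ 2 * 1 + h ^ 2) := by nlinarith [sq_nonneg (c - h)]
      have e2 : 1 + h ^ 2 ≤ 2 * (1 + A) ^ 2 := by nlinarith
      calc _ ≤ (2 * (c ^ 2 * 1 + h ^ 2)) * (2 * (1 + A) ^ 2) := by gcongr
        _ = _ := by rw [hL]; ring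
    · have e1 : (c + h) ^ 2 ≤ (1 + A) ^ 2 := by gcongr
      have e2 : g + h ^ 2 ≤ 4 * (c ^ 2 * g + h ^ 2) := by
        have : 1 / 4 ≤ c ^ 2 := by nlinarith
        nlinarith [sq_nonneg h]
      calc _ ≤ (1 + A) ^ 2 * (4 * (c ^ 2 * g + h ^ 2)) := by gcongr
        _ = _ := by rw [hL]; ring
  have hp1 : 0 < c ^ 2 * g + h ^ 2 := by positivity
  have hp2 : 0 < (c + h) ^ 2 * (g + h ^ 2) := by positivity
  have h3 := rpow_le_of_le_mul hp1 hp2 h1 h2 γ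
  have h4 := rpow_le_of_le_mul hp2 hp1 h2 h1 γ
  have hk1 : 1 ≤ 2 ^ k * (c + h) ^ k := by
    rcases hcase with ⟨rfl, -⟩ | hc2
    · simp
    · rw [← mul_pow]; exact one_le_pow₀ (by linarith)
  have hk2 : (c + h) ^ k ≤ (1 + A) ^ k := by gcongr
  rw [hsplit]
  set a := (c ^ 2 * g + h ^ 2) ^ γ
  set b := ((c + h) ^ 2 * (g + h ^ 2)) ^ γ
  have ha : 0 ≤ a := by positivity
  have hb : 0 ≤ b := by positivity
  have hA1 : (1 : ℝ) ≤ (1 + A) ^ k := one_le_pow₀ (by linarith)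
  have h21 : (1 : ℝ) ≤ 2 ^ k := one_le_pow₀ (by norm_num)
  constructor
  · calc a ≤ 1 * (1 * (L ^ |γ| * b)) := by linarith
      _ ≤ (1 + A) ^ k * ((2 ^ k * (c + h) ^ k) * (L ^ |γ| * b)) := by gcongr
      _ = _ := by rw [hK]; ring
  · calc (c + h) ^ k * b ≤ (1 + A) ^ k * (L ^ |γ| * a) := by gcongr
      _ ≤ 2 ^ k * ((1 + A) ^ k * (L ^ |γ| * a)) := le_mul_of_one_le_left (by positivity) h21
      _ = _ := by rw [hK]; ring

theorem eval_eq_aeval {σ : Type*} (v : σ → ℝ) (Q : MvPolynomial σ ℝ) : eval v Q = aeval v Q := by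
  rw [← coe_aeval_eq_eval, RingHom.coe_coe]

theorem exists_slice_polynomial {k m : ℕ} {Q : MvPolynomial (Fin (k + 1)) ℝ}
    (hQ : Q.totalDegree ≤ m) (i : Fin (k + 1)) (t c : ℝ) :
    ∃ q : MvPolynomial (Fin k) ℝ, q.totalDegree ≤ m ∧
      ∀ w, eval w q = eval (i.insertNth t (fun j => c * w j) : Fin (k + 1) → ℝ) Q := by
  set g : Fin (k + 1) → MvPolynomial (Fin k) ℝ := i.insertNth (C t) (fun j => C c * X j) with hg
  refine ⟨aeval g Q, ?_, fun w => ?_⟩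
  · rw [← mem_restrictTotalDegree]
    refine aeval_mem_of_totalDegree_le (fun m => restrictTotalDegree (Fin k) ℝ m) ?_ ?_ ?_
      (fun j => ?_) hQ
    · rw [mem_restrictTotalDegree]; simp
    · intro a b hab f hf
      rw [mem_restrictTotalDegree] at hf ⊢
      exact hf.trans hab
    · intro a b f g hf hg
      rw [mem_restrictTotalDegree] at hf hg ⊢
      exact (totalDegree_mul f g).trans (add_le_add hf hg)
    · rw [mem_restrictTotalDegree]
      refine i.succAboveCases ?_ (fun j => ?_) j
      · simp [hg]
      · simp only [hg, Fin.insertNth_apply_succAbove]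
        refine (totalDegree_mul _ _).trans ?_
        simp
  · rw [eval_eq_aeval, eval_eq_aeval, ← AlgHom.comp_apply, comp_aeval]
    congr 2
    ext j
    refine i.succAboveCases ?_ (fun j => ?_) j <;> simp [hg]

theorem slice_mem_trigPoly {k m : ℕ} {Q : MvPolynomial (Fin (k + 1)) ℝ}
    (hQ : Q.totalDegree ≤ m) (i : Fin (k + 1)) (w : Fin k → ℝ) :
    (fun φ => eval (i.insertNth (sin φ) (fun j => cos φ * w j) : Fin (k + 1) → ℝ) Q) ∈
      trigPoly m := by
  set g : Fin (k + 1) → (ℝ → ℝ) := i.insertNth sin (fun j => w j • cos) with hg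
  have h := aeval_mem_of_totalDegree_le trigPoly trigPoly_one_mem trigPoly_mono
    trigPoly_mul_mem (g := g) (fun j => ?_) hQ
  · convert h using 1
    ext φ
    have : aeval g Q φ = (Pi.evalAlgHom ℝ (fun _ : ℝ => ℝ) φ) (aeval g Q) := rfl
    rw [this, ← AlgHom.comp_apply, comp_aeval, eval_eq_aeval]
    congr 2
    ext j
    refine i.succAboveCases ?_ (fun j => ?_) j <;> simp [hg, mul_comm]
  · refine i.succAboveCases ?_ (fun j => ?_) j
    · simpa [hg] using sin_mem_trigPoly
    · simpa [hg] using Submodule.smul_mem _ (w j) cos_mem_trigPoly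

/-- A lower bound for the Christoffel function of the weighted ball. -/
theorem ball_christoffel (γ : ℝ) (n : ℕ) : ∃ C : ℝ, 0 < C ∧ ∀ m : ℕ, 1 ≤ m →
    ∀ Q : MvPolynomial (Fin n) ℝ, Q.totalDegree ≤ m → ∀ x : Fin n → ℝ, ∑ i, x i ^ 2 ≤ 1 →
    ENNReal.ofReal (eval x Q ^ 2 * ((1 / m) ^ n * (1 - ∑ i, x i ^ 2 + (1 / m) ^ 2) ^ γ)) ≤
      ENNReal.ofReal C * ∫⁻ y, ENNReal.ofReal (eval y Q ^ 2) ∂ballMeasure n γ := by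
  induction n with
  | zero =>
    refine ⟨2 ^ |γ|, by positivity, fun m hm Q _ x _ => ?_⟩
    have hm' : (1 : ℝ) / m ≤ 1 := div_le_one_of_le₀ (by exact_mod_cast hm) (by positivity)
    have h0 : (0 : ℝ) ≤ 1 / m := by positivity
    rw [lintegral_ballMeasure_zero γ (by fun_prop), Subsingleton.elim x default,
      ← ENNReal.ofReal_mul (by positivity)]
    apply ENNReal.ofReal_le_ofReal
    have := rpow_le_of_le_mul (a := 1 + (1 / (m : ℝ)) ^ 2) (b := 1) (L := 2) (by positivity)
      one_pos (by nlinarith) (by nlinarith) γ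
    rw [one_rpow, mul_one] at this
    simp only [Finset.univ_eq_empty, Finset.sum_empty, sub_zero, pow_zero, one_mul]
    rw [mul_comm]
    gcongr
  | succ k ih =>
    obtain ⟨C₁, hC₁, h₁⟩ := ih
    obtain ⟨C₂, hC₂, h₂⟩ := trigPoly_christoffel (k + 2 * γ)
    obtain ⟨C₃, hC₃, h₃⟩ := gap_rpow_comparison γ k zero_le_one
    refine ⟨C₃ * (C₂ * (C₁ * 2)), by positivity, fun m hm Q hQ x hx => ?_⟩
    obtain ⟨i, θ, w, hθ, hcase, hw, rfl⟩ := exists_eq_insertNth hx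
    have hm' : (1 : ℝ) / m ≤ 1 := div_le_one_of_le₀ (by exact_mod_cast hm) (by positivity)
    have h0 : (0 : ℝ) < 1 / m := by positivity
    have hc := cos_nonneg_of_mem_Icc hθ
    set f : ℝ → ℝ := fun φ =>
      eval (i.insertNth (sin φ) (fun j => cos φ * w j) : Fin (k + 1) → ℝ) Q
    have hT := h₂ m hm f (slice_mem_trigPoly hQ i w) θ
    rw [abs_of_nonneg hc] at hT
    set g := 1 - ∑ j, w j ^ 2 with hg
    have hg0 : 0 ≤ g := by linarith
    have hg1 : g ≤ 1 := by
      have : 0 ≤ ∑ j, w j ^ 2 := Finset.sum_nonneg fun j _ => sq_nonneg _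
      linarith
    have hcmp := (h₃ (cos θ) g (1 / m) hc (cos_le_one θ) hg0 hg1 h0 hm'
      (hcase.imp_left fun h => ⟨h, by subst h; simp [hg]⟩)).1
    set D : ℝ := (1 / m) ^ k * (g + (1 / m) ^ 2) ^ γ with hD
    have hD0 : 0 ≤ D := by positivity
    rw [gap_insertNth]
    calc ENNReal.ofReal (f θ ^ 2 * ((1 / m) ^ (k + 1) * (cos θ ^ 2 * g + (1 / m) ^ 2) ^ γ))
        ≤ ENNReal.ofReal (C₃ * (f θ ^ 2 * (1 / m * (cos θ + 1 / m) ^ (k + 2 * γ)) * D)) := by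
          apply ENNReal.ofReal_le_ofReal
          calc _ ≤ f θ ^ 2 * ((1 / m) ^ (k + 1) * (C₃ * ((cos θ + 1 / m) ^ (k + 2 * γ) *
                (g + (1 / m) ^ 2) ^ γ))) := by gcongr
            _ = _ := by rw [hD]; ring
      _ = ENNReal.ofReal C₃ * (ENNReal.ofReal
            (f θ ^ 2 * (1 / m * (cos θ + 1 / m) ^ (k + 2 * γ))) * ENNReal.ofReal D) := by
          rw [← ENNReal.ofReal_mul (by positivity), ← ENNReal.ofReal_mul hC₃.le]
      _ ≤ ENNReal.ofReal C₃ * ((ENNReal.ofReal C₂ * ∫⁻ φ in Set.Ioc (-(π / 2)) (3 * π / 2),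
            ENNReal.ofReal (|cos φ| ^ (k + 2 * γ)) * ENNReal.ofReal (f φ ^ 2)) *
              ENNReal.ofReal D) := by gcongr
      _ = ENNReal.ofReal C₃ * (ENNReal.ofReal C₂ * ∫⁻ φ in Set.Ioc (-(π / 2)) (3 * π / 2),
            ENNReal.ofReal (|cos φ| ^ (k + 2 * γ)) * ENNReal.ofReal (f φ ^ 2 * D)) := by
          rw [mul_assoc (ENNReal.ofReal C₂), ← lintegral_mul_const' _ _ ENNReal.ofReal_ne_top]
          simp only [mul_assoc, ENNReal.ofReal_mul (sq_nonneg (f _))]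
      _ ≤ ENNReal.ofReal C₃ * (ENNReal.ofReal C₂ * ∫⁻ φ in Set.Ioc (-(π / 2)) (3 * π / 2),
            ENNReal.ofReal C₁ * (ENNReal.ofReal (|cos φ| ^ (k + 2 * γ)) *
            ∫⁻ w, ENNReal.ofReal (eval (i.insertNth (sin φ) (fun j => cos φ * w j) :
              Fin (k + 1) → ℝ) Q ^ 2) ∂ballMeasure k γ)) := by
          refine mul_le_mul_right (mul_le_mul_right (lintegral_mono fun φ => ?_) _) _
          obtain ⟨q, hq, hqe⟩ := exists_slice_polynomial hQ i (sin φ) (cos φ)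
          have := h₁ m hm q hq w hw
          simp only [hqe] at this
          rw [mul_left_comm (ENNReal.ofReal C₁)]
          exact mul_le_mul_right this _
      _ ≤ ENNReal.ofReal C₃ * (ENNReal.ofReal C₂ * (ENNReal.ofReal C₁ * (2 *
            ∫⁻ y, ENNReal.ofReal (eval y Q ^ 2) ∂ballMeasure (k + 1) γ))) := by
          rw [lintegral_const_mul' _ _ ENNReal.ofReal_ne_top]
          gcongr
          exact lintegral_slices_le i (f := fun y => ENNReal.ofReal (eval y Q ^ 2))
            ((MvPolynomial.continuous_eval Q).measurable.pow_const 2).ennreal_ofReal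
      _ = _ := by
          rw [ENNReal.ofReal_mul hC₃.le, ENNReal.ofReal_mul hC₂.le, ENNReal.ofReal_mul hC₁.le,
            ENNReal.ofReal_ofNat]
          simp only [mul_assoc]

theorem lintegral_rpow_le {β : ℝ} (hβ : -1 < β) (hβ0 : β ≤ 0) (ψ₀ r : ℝ) :
    ∫⁻ ψ in {ψ : ℝ | 0 < ψ ∧ |ψ - ψ₀| ≤ r}, ENNReal.ofReal (ψ ^ β) ≤
      ENNReal.ofReal ((2 * r) ^ (β + 1) / (β + 1)) := by
  set a := max 0 (ψ₀ - r) with ha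
  set b := ψ₀ + r with hb
  have ha0 : 0 ≤ a := le_max_left _ _
  have hsub : {ψ : ℝ | 0 < ψ ∧ |ψ - ψ₀| ≤ r} ⊆ Set.Icc a b := by
    rintro ψ ⟨h0, h1⟩
    rw [abs_le] at h1
    exact ⟨max_le h0.le (by linarith), by rw [hb]; linarith⟩
  refine (lintegral_mono_set hsub).trans ?_
  rcases lt_or_ge b a with hab | hab
  · simp [Set.Icc_eq_empty_of_lt hab]
  have h_int : IntegrableOn (fun ψ : ℝ => ψ ^ β) (Set.Ioc a b) :=
    (intervalIntegrable_iff_integrableOn_Ioc_of_le hab).1 (intervalIntegral.intervalIntegrable_rpow' hβ)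
  rw [← setLIntegral_congr Ioc_ae_eq_Icc, ← ofReal_integral_eq_lintegral_ofReal h_int
    ((ae_restrict_iff' measurableSet_Ioc).2 (ae_of_all _ fun ψ hψ =>
      rpow_nonneg (ha0.trans hψ.1.le) _)), ← intervalIntegral.integral_of_le hab,
    integral_rpow (Or.inl hβ)]
  have hβ1 : 0 < β + 1 := by linarith
  apply ENNReal.ofReal_le_ofReal
  gcongr
  have h1 : b ^ (β + 1) ≤ a ^ (β + 1) + (b - a) ^ (β + 1) := by
    have := Real.rpow_add_le_add_rpow ha0 (sub_nonneg.2 hab) hβ1.le (by linarith)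
    rwa [add_sub_cancel] at this
  have h2 : (b - a) ^ (β + 1) ≤ (2 * r) ^ (β + 1) := by
    refine rpow_le_rpow (sub_nonneg.2 hab) ?_ hβ1.le
    have := le_max_right 0 (ψ₀ - r)
    rw [hb]; linarith
  linarith

theorem volume_Icc_window_le (θ r : ℝ) :
    volume {φ : ℝ | φ ∈ Set.Ioo (-(π / 2)) (π / 2) ∧ |φ - θ| ≤ 2 * r} ≤ ENNReal.ofReal (4 * r) := by
  refine (measure_mono (t := Set.Icc (θ - 2 * r) (θ + 2 * r)) ?_).trans ?_
  · rintro φ ⟨-, h⟩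
    rw [abs_le] at h
    exact ⟨by linarith, by linarith⟩
  · rw [Real.volume_Icc]
    exact ENNReal.ofReal_le_ofReal (by linarith)

/-- Local mass of the weight `|cos|^β`. -/
theorem lintegral_cos_rpow_le {β : ℝ} (hβ : -1 < β) : ∃ C : ℝ, 0 < C ∧
    ∀ θ ∈ Set.Icc (-(π / 2)) (π / 2), ∀ r : ℝ, 0 < r →
    ∫⁻ φ in {φ : ℝ | φ ∈ Set.Ioo (-(π / 2)) (π / 2) ∧ |φ - θ| ≤ 2 * r},
      ENNReal.ofReal (|cos φ| ^ β) ≤ ENNReal.ofReal (C * (r * (cos θ + r) ^ β)) := by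
  have hβ1 : 0 < β + 1 := by linarith
  have hπ := pi_pos
  set C₀ := (2 / π) ^ β * (2 * (4 ^ (β + 1) / (β + 1)) * 5 ^ |β|) with hC₀
  have hC₀' : 0 < C₀ := by positivity
  refine ⟨4 * 5 ^ |β| + C₀, by positivity, fun θ hθ r hr => ?_⟩
  have hc := cos_nonneg_of_mem_Icc hθ
  have hw := volume_Icc_window_le θ r
  set S := {φ : ℝ | φ ∈ Set.Ioo (-(π / 2)) (π / 2) ∧ |φ - θ| ≤ 2 * r} with hS
  have hSm : MeasurableSet S :=
    measurableSet_Ioo.inter (measurableSet_le (measurable_id.sub_const θ).abs measurable_const)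
  have hp : 0 < cos θ + r := by linarith
  have hbound : (∀ φ ∈ S, |cos φ| ^ β ≤ 5 ^ |β| * (cos θ + r) ^ β) →
      ∫⁻ φ in S, ENNReal.ofReal (|cos φ| ^ β) ≤
        ENNReal.ofReal ((4 * 5 ^ |β| + C₀) * (r * (cos θ + r) ^ β)) := fun h => by
    calc ∫⁻ φ in S, ENNReal.ofReal (|cos φ| ^ β)
        ≤ ∫⁻ φ in S, ENNReal.ofReal (5 ^ |β| * (cos θ + r) ^ β) :=
          setLIntegral_mono measurable_const fun φ hφ => ENNReal.ofReal_le_ofReal (h φ hφ)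
      _ = ENNReal.ofReal (5 ^ |β| * (cos θ + r) ^ β) * volume S := setLIntegral_const _ _
      _ ≤ ENNReal.ofReal (5 ^ |β| * (cos θ + r) ^ β) * ENNReal.ofReal (4 * r) := by gcongr
      _ = ENNReal.ofReal ((4 * 5 ^ |β|) * (r * (cos θ + r) ^ β)) := by
          rw [← ENNReal.ofReal_mul (by positivity)]; congr 1; ring
      _ ≤ _ := by gcongr; linarith
  have hlip : ∀ φ ∈ S, |cos φ - cos θ| ≤ 2 * r := fun φ hφ =>
    (abs_cos_sub_cos_le φ θ).trans hφ.2
  rcases le_or_gt (4 * r) (cos θ) with h4 | h4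
  · refine hbound fun φ hφ => ?_
    have h := abs_le.1 (hlip φ hφ)
    have hcφ : 0 < cos φ := by linarith
    rw [abs_of_pos hcφ]
    exact rpow_le_of_le_mul hcφ hp (by linarith) (by linarith) β
  rcases le_or_gt 0 β with hb | hb
  · refine hbound fun φ hφ => ?_
    have h := abs_le.1 (hlip φ hφ)
    have hcφ : 0 < cos φ := cos_pos_of_mem_Ioo hφ.1
    rw [abs_of_pos hcφ, abs_of_nonneg hb, ← mul_rpow (by norm_num) hp.le]
    exact rpow_le_rpow hcφ.le (by linarith) hb
  clear hbound
  have hpt : ∀ φ ∈ S, ENNReal.ofReal (|cos φ| ^ β) ≤ ENNReal.ofReal ((2 / π) ^ β) *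
      (ENNReal.ofReal ((π / 2 - φ) ^ β) + ENNReal.ofReal ((φ + π / 2) ^ β)) := fun φ hφ => by
    have hcφ : 0 < cos φ := cos_pos_of_mem_Ioo hφ.1
    obtain ⟨h1, h2⟩ := hφ.1
    have h3 : 0 < π / 2 - φ := by linarith
    have h4 : 0 < φ + π / 2 := by linarith
    rw [abs_of_pos hcφ, ← ENNReal.ofReal_add (by positivity) (by positivity),
      ← ENNReal.ofReal_mul (by positivity)]
    apply ENNReal.ofReal_le_ofReal
    have hl := one_sub_le_cos h1.le h2.le
    rcases le_total 0 φ with h0 | h0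
    · rw [abs_of_nonneg h0] at hl
      have : 2 / π * (π / 2 - φ) ≤ cos φ := by
        have : 2 / π * (π / 2 - φ) = 1 - 2 / π * φ := by field_simp
        linarith
      calc cos φ ^ β ≤ (2 / π * (π / 2 - φ)) ^ β :=
            rpow_le_rpow_of_nonpos (by positivity) this hb.le
        _ = (2 / π) ^ β * (π / 2 - φ) ^ β := mul_rpow (by positivity) h3.le
        _ ≤ _ := by gcongr; linarith [rpow_pos_of_pos h4 β]
    · rw [abs_of_nonpos h0] at hl
      have : 2 / π * (φ + π / 2) ≤ cos φ := by
        have : 2 / π * (φ + π / 2) = 1 - 2 / π * -φ := by field_simp; ring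
        linarith
      calc cos φ ^ β ≤ (2 / π * (φ + π / 2)) ^ β :=
            rpow_le_rpow_of_nonpos (by positivity) this hb.le
        _ = (2 / π) ^ β * (φ + π / 2) ^ β := mul_rpow (by positivity) h4.le
        _ ≤ _ := by gcongr; linarith [rpow_pos_of_pos h3 β]
  have hm : ∀ ψ₀ : ℝ, MeasurableSet {ψ : ℝ | 0 < ψ ∧ |ψ - ψ₀| ≤ 2 * r} := fun ψ₀ =>
    (measurableSet_lt measurable_const measurable_id).inter
      (measurableSet_le (measurable_id.sub_const ψ₀).abs measurable_const)
  have hI1 : ∫⁻ φ in S, ENNReal.ofReal ((π / 2 - φ) ^ β) ≤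
      ENNReal.ofReal ((2 * (2 * r)) ^ (β + 1) / (β + 1)) := by
    refine le_trans ?_ (lintegral_rpow_le hβ hb.le (π / 2 - θ) (2 * r))
    rw [← (Measure.measurePreserving_sub_left volume (π / 2)).setLIntegral_comp_preimage (hm _)
      (by fun_prop)]
    refine lintegral_mono_set fun φ hφ => ⟨sub_pos.2 hφ.1.2, ?_⟩
    rw [sub_sub_sub_cancel_left, abs_sub_comm]
    exact hφ.2
  have hI2 : ∫⁻ φ in S, ENNReal.ofReal ((φ + π / 2) ^ β) ≤
      ENNReal.ofReal ((2 * (2 * r)) ^ (β + 1) / (β + 1)) := by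
    refine le_trans ?_ (lintegral_rpow_le hβ hb.le (θ + π / 2) (2 * r))
    rw [← (measurePreserving_add_right volume (π / 2)).setLIntegral_comp_preimage (hm _)
      (by fun_prop)]
    refine lintegral_mono_set fun φ hφ => ⟨by linarith [hφ.1.1], ?_⟩
    rw [add_sub_add_right_eq_sub]
    exact hφ.2
  calc ∫⁻ φ in S, ENNReal.ofReal (|cos φ| ^ β)
      ≤ ∫⁻ φ in S, ENNReal.ofReal ((2 / π) ^ β) *
          (ENNReal.ofReal ((π / 2 - φ) ^ β) + ENNReal.ofReal ((φ + π / 2) ^ β)) :=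
        setLIntegral_mono (by fun_prop) hpt
    _ = ENNReal.ofReal ((2 / π) ^ β) * ((∫⁻ φ in S, ENNReal.ofReal ((π / 2 - φ) ^ β)) +
          ∫⁻ φ in S, ENNReal.ofReal ((φ + π / 2) ^ β)) := by
        rw [lintegral_const_mul' _ _ ENNReal.ofReal_ne_top, lintegral_add_left (by fun_prop)]
    _ ≤ ENNReal.ofReal ((2 / π) ^ β) * (ENNReal.ofReal ((2 * (2 * r)) ^ (β + 1) / (β + 1)) +
          ENNReal.ofReal ((2 * (2 * r)) ^ (β + 1) / (β + 1))) := by gcongr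
    _ = ENNReal.ofReal ((2 / π) ^ β * (2 * (4 ^ (β + 1) / (β + 1))) * (r * r ^ β)) := by
        rw [← ENNReal.ofReal_add (by positivity) (by positivity),
          ← ENNReal.ofReal_mul (by positivity), ← mul_assoc 2 2 r, mul_rpow (by norm_num) hr.le,
          rpow_add hr, rpow_one]
        congr 1
        norm_num
        ring
    _ ≤ _ := by
        apply ENNReal.ofReal_le_ofReal
        have h5 := rpow_le_of_le_mul (a := r) (b := cos θ + r) (L := 5) hr hp (by linarith)
          (by linarith) β
        calc _ ≤ (2 / π) ^ β * (2 * (4 ^ (β + 1) / (β + 1))) *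
              (r * (5 ^ |β| * (cos θ + r) ^ β)) := by gcongr
          _ = C₀ * (r * (cos θ + r) ^ β) := by rw [hC₀]; ring
          _ ≤ _ := by gcongr; linarith [show (0 : ℝ) < 4 * 5 ^ |β| by positivity]

theorem ballMeasure_univ_le {γ : ℝ} (hγ : -(1 / 2 : ℝ) < γ) (n : ℕ) :
    ∃ C : ℝ, 0 < C ∧ ballMeasure n γ Set.univ ≤ ENNReal.ofReal C := by
  induction n with
  | zero =>
    refine ⟨1, one_pos, ?_⟩
    rw [← lintegral_one, lintegral_ballMeasure_zero γ measurable_const]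
    simp
  | succ k ih =>
    obtain ⟨C₁, hC₁, h₁⟩ := ih
    have hk : (0 : ℝ) ≤ k := Nat.cast_nonneg k
    obtain ⟨C₂, hC₂, h₂⟩ := lintegral_cos_rpow_le (β := k + 2 * γ) (by linarith)
    have hπ := pi_pos
    have h0 : (0 : ℝ) ∈ Set.Icc (-(π / 2)) (π / 2) := ⟨by linarith, by linarith⟩
    have h₃ := h₂ 0 h0 (π / 2) (by linarith)
    have hset : {φ : ℝ | φ ∈ Set.Ioo (-(π / 2)) (π / 2) ∧ |φ - 0| ≤ 2 * (π / 2)} =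
        Set.Ioo (-(π / 2)) (π / 2) := by
      ext φ
      refine ⟨fun h => h.1, fun h => ⟨h, ?_⟩⟩
      rw [sub_zero, abs_le]
      exact ⟨by linarith [h.1], by linarith [h.2]⟩
    rw [hset] at h₃
    refine ⟨C₂ * (π / 2 * (cos 0 + π / 2) ^ (k + 2 * γ)) * C₁, ?_, ?_⟩
    · rw [cos_zero]; positivity
    rw [← lintegral_one, lintegral_ballMeasure_succ 0 measurableSet_Ioo injOn_sin_Ioo
      image_sin_Ioo measurable_const, ENNReal.ofReal_mul' hC₁.le,
      lintegral_mul_const'' _ (by fun_prop)]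
    simp only [lintegral_one]
    gcongr

theorem isFiniteMeasure_ballMeasure {γ : ℝ} (hγ : -(1 / 2 : ℝ) < γ) (n : ℕ) :
    IsFiniteMeasure (ballMeasure n γ) := by
  obtain ⟨C, -, hC⟩ := ballMeasure_univ_le hγ n
  exact ⟨hC.trans_lt ENNReal.ofReal_lt_top⟩

/-- The inner product of the lifts of two points of the ball to the upper hemisphere. -/
def ballInner {n : ℕ} (x y : Fin n → ℝ) : ℝ :=
  (∑ i, x i * y i) + √(1 - ∑ i, x i ^ 2) * √(1 - ∑ i, y i ^ 2)

theorem ballInner_le_one {n : ℕ} {x y : Fin n → ℝ} (hx : ∑ i, x i ^ 2 ≤ 1)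
    (hy : ∑ i, y i ^ 2 ≤ 1) : ballInner x y ≤ 1 := by
  have h1 : ∑ i, x i * y i ≤ ∑ i, (x i ^ 2 + y i ^ 2) / 2 :=
    Finset.sum_le_sum fun i _ => by nlinarith [sq_nonneg (x i - y i)]
  rw [← Finset.sum_div, Finset.sum_add_distrib] at h1
  have h2 := sq_sqrt (sub_nonneg.2 hx)
  have h3 := sq_sqrt (sub_nonneg.2 hy)
  rw [ballInner]
  nlinarith [sq_nonneg (√(1 - ∑ i, x i ^ 2) - √(1 - ∑ i, y i ^ 2))]

theorem neg_one_le_ballInner {n : ℕ} {x y : Fin n → ℝ} (hx : ∑ i, x i ^ 2 ≤ 1)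
    (hy : ∑ i, y i ^ 2 ≤ 1) : -1 ≤ ballInner x y := by
  have h1 : ∑ i, -((x i ^ 2 + y i ^ 2) / 2) ≤ ∑ i, x i * y i :=
    Finset.sum_le_sum fun i _ => by nlinarith [sq_nonneg (x i + y i)]
  rw [Finset.sum_neg_distrib, ← Finset.sum_div, Finset.sum_add_distrib] at h1
  have h2 : 0 ≤ √(1 - ∑ i, x i ^ 2) * √(1 - ∑ i, y i ^ 2) := by positivity
  rw [ballInner]
  linarith

theorem continuous_ballInner {n : ℕ} (x : Fin n → ℝ) : Continuous (ballInner x) := by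
  unfold ballInner; fun_prop

theorem ballInner_insertNth {k : ℕ} (i : Fin (k + 1)) {θ φ : ℝ} (hθ : 0 ≤ cos θ)
    (hφ : 0 ≤ cos φ) (v w : Fin k → ℝ) :
    ballInner (i.insertNth (sin θ) (fun j => cos θ * v j) : Fin (k + 1) → ℝ)
      (i.insertNth (sin φ) (fun j => cos φ * w j) : Fin (k + 1) → ℝ) =
      sin θ * sin φ + cos θ * cos φ * ballInner v w := by
  rw [ballInner, ballInner, gap_insertNth, gap_insertNth, sqrt_mul (sq_nonneg _),
    sqrt_mul (sq_nonneg _), sqrt_sq hθ, sqrt_sq hφ, Fin.sum_univ_succAbove _ i]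
  simp only [Fin.insertNth_apply_same, Fin.insertNth_apply_succAbove]
  rw [mul_add, Finset.mul_sum]
  simp only [mul_mul_mul_comm (cos θ) _ (cos φ) _]
  ring

/-- A cap of the ball around `x`, measured by the chordal distance of the hemisphere. -/
def ballCap {n : ℕ} (x : Fin n → ℝ) (r : ℝ) : Set (Fin n → ℝ) :=
  {y | ∑ i, y i ^ 2 < 1 ∧ 2 - 2 * ballInner x y ≤ r ^ 2}

theorem measurableSet_ballCap {n : ℕ} (x : Fin n → ℝ) (r : ℝ) : MeasurableSet (ballCap x r) :=
  (measurableSet_openBall n).inter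
    (measurableSet_le (((continuous_ballInner x).measurable.const_mul 2).const_sub 2)
      measurable_const)

theorem ballMeasure_ballCap_le_of_le {γ : ℝ} (hγ : -(1 / 2 : ℝ) < γ) (n : ℕ) {δ A : ℝ}
    (hδ : 0 < δ) : ∃ C : ℝ, 0 < C ∧ ∀ x : Fin n → ℝ, ∑ i, x i ^ 2 ≤ 1 → ∀ r : ℝ, δ ≤ r → r ≤ A →
    ballMeasure n γ Set.univ ≤ ENNReal.ofReal (C * (r ^ n * (1 - ∑ i, x i ^ 2 + r ^ 2) ^ γ)) := by
  obtain ⟨C, hC, h⟩ := ballMeasure_univ_le hγ n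
  set L := 1 + A ^ 2 + (δ ^ 2)⁻¹ with hL
  have hL0 : 0 < L := by positivity
  refine ⟨C * ((δ ^ n)⁻¹ * L ^ |γ|), by positivity, fun x hx r hr hrA => h.trans ?_⟩
  apply ENNReal.ofReal_le_ofReal
  have hxn : 0 ≤ ∑ i, x i ^ 2 := Finset.sum_nonneg fun i _ => sq_nonneg _
  have hr0 : 0 < r := hδ.trans_le hr
  set g := 1 - ∑ i, x i ^ 2
  have hg : 0 ≤ g := sub_nonneg.2 hx
  have hg1 : g ≤ 1 := by simp only [g]; linarith
  have h1 : 1 ≤ L * (g + r ^ 2) := by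
    have : (δ ^ 2)⁻¹ * δ ^ 2 = 1 := inv_mul_cancel₀ (by positivity)
    calc 1 = (δ ^ 2)⁻¹ * δ ^ 2 := this.symm
      _ ≤ L * (g + r ^ 2) := by
        gcongr
        · rw [hL]; linarith [sq_nonneg A]
        · nlinarith
  have h2 : g + r ^ 2 ≤ L * 1 := by
    have : 0 < (δ ^ 2)⁻¹ := by positivity
    nlinarith
  have h3 := rpow_le_of_le_mul one_pos (by positivity) h1 h2 γ
  rw [one_rpow] at h3
  have h4 : 1 ≤ (δ ^ n)⁻¹ * r ^ n := by
    rw [inv_mul_eq_div, one_le_div (by positivity)]; gcongr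
  calc C = C * (1 * 1) := by ring
    _ ≤ C * (((δ ^ n)⁻¹ * r ^ n) * (L ^ |γ| * (g + r ^ 2) ^ γ)) := by gcongr
    _ = _ := by ring

theorem ballCap_insertNth {k : ℕ} (i : Fin (k + 1)) {θ φ r : ℝ}
    (hθ : θ ∈ Set.Icc (-(π / 2)) (π / 2)) (hφ : φ ∈ Set.Ioo (-(π / 2)) (π / 2)) (hr : 0 < r)
    (hcase : k = 0 ∨ 1 / 2 ≤ cos θ ∧ r ≤ 1 / 8) {v w : Fin k → ℝ} (hv : ∑ j, v j ^ 2 ≤ 1)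
    (hw : (i.insertNth (sin φ) (fun j => cos φ * w j) : Fin (k + 1) → ℝ) ∈
      ballCap (i.insertNth (sin θ) (fun j => cos θ * v j) : Fin (k + 1) → ℝ) r) :
    |φ - θ| ≤ 2 * r ∧ w ∈ ballCap v (3 * r) := by
  obtain ⟨h1, h2⟩ := hw
  have hcφ := cos_pos_of_mem_Ioo hφ
  have hcθ := cos_nonneg_of_mem_Icc hθ
  rw [← sub_pos, gap_insertNth] at h1
  have hw1 : ∑ j, w j ^ 2 < 1 := sub_pos.1 ((mul_pos_iff_of_pos_left (by positivity)).1 h1)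
  rw [ballInner_insertNth i hcθ hcφ.le] at h2
  have hB := ballInner_le_one hv hw1.le
  have hsplit : 2 - 2 * cos (φ - θ) + cos θ * cos φ * (2 - 2 * ballInner v w) ≤ r ^ 2 := by
    rw [cos_sub]; linarith
  have hprod : 0 ≤ cos θ * cos φ * (2 - 2 * ballInner v w) :=
    mul_nonneg (by positivity) (by linarith)
  have hdist : |φ - θ| ≤ 2 * r := by
    have hπ : |φ - θ| ≤ π := abs_le.2 ⟨by linarith [hφ.1, hθ.2], by linarith [hφ.2, hθ.1]⟩
    have hq := cos_le_one_sub_mul_cos_sq hπ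
    have h3 : 4 / π ^ 2 * (φ - θ) ^ 2 ≤ r ^ 2 := by linear_combination hsplit + hprod + 2 * hq
    have hp := pi_pos
    have hp4 := pi_le_four
    have h4 : 4 * (φ - θ) ^ 2 ≤ r ^ 2 * π ^ 2 := by
      rwa [div_mul_eq_mul_div, div_le_iff₀ (by positivity)] at h3
    refine abs_le_of_sq_le_sq ?_ (by positivity)
    nlinarith [sq_nonneg r, mul_le_mul_of_nonneg_left (show π ^ 2 ≤ 16 by nlinarith) (sq_nonneg r)]
  refine ⟨hdist, hw1, ?_⟩
  rcases hcase with rfl | ⟨hθ2, hr8⟩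
  · simp only [ballInner, Finset.univ_eq_empty, Finset.sum_empty]
    norm_num
    positivity
  · have hl := abs_le.1 ((abs_cos_sub_cos_le φ θ).trans hdist)
    have hc : 1 / 8 ≤ cos θ * cos φ := by nlinarith
    have := cos_le_one (φ - θ)
    nlinarith

/-- Upper bound for the weighted volume of caps. -/
theorem ballMeasure_ballCap_le {γ : ℝ} (hγ : -(1 / 2 : ℝ) < γ) (n : ℕ) : ∀ A : ℝ, 0 < A →
    ∃ C : ℝ, 0 < C ∧ ∀ x : Fin n → ℝ, ∑ i, x i ^ 2 ≤ 1 → ∀ r : ℝ, 0 < r → r ≤ A →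
    ballMeasure n γ (ballCap x r) ≤
      ENNReal.ofReal (C * (r ^ n * (1 - ∑ i, x i ^ 2 + r ^ 2) ^ γ)) := by
  induction n with
  | zero =>
    intro A hA
    refine ⟨(1 + A ^ 2) ^ |γ|, by positivity, fun x _ r hr hrA => ?_⟩
    refine (measure_mono (Set.subset_univ _)).trans ?_
    rw [← lintegral_one, lintegral_ballMeasure_zero γ measurable_const, ← ENNReal.ofReal_one]
    apply ENNReal.ofReal_le_ofReal
    have := rpow_le_of_le_mul (a := 1) (b := 1 + r ^ 2) (L := 1 + A ^ 2) one_pos (by positivity)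
      (by nlinarith [mul_nonneg (sq_nonneg A) (sq_nonneg r), sq_nonneg A, sq_nonneg r])
      (by nlinarith) γ
    simpa using this
  | succ k ih =>
    intro A hA
    obtain ⟨C₁, hC₁, h₁⟩ := ih (3 * A) (by positivity)
    have hk : (0 : ℝ) ≤ k := Nat.cast_nonneg k
    obtain ⟨C₂, hC₂, h₂⟩ := lintegral_cos_rpow_le (β := k + 2 * γ) (by linarith)
    obtain ⟨C₃, hC₃, h₃⟩ := gap_rpow_comparison γ k hA.le
    obtain ⟨C₄, hC₄, h₄⟩ := ballMeasure_ballCap_le_of_le hγ (k + 1) (δ := 1 / 8) (A := A)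
      (by norm_num)
    refine ⟨C₄ + C₂ * (C₁ * (3 ^ k * 9 ^ |γ|)) * C₃, by positivity, fun x hx r hr hrA => ?_⟩
    have hgx : 0 ≤ 1 - ∑ i, x i ^ 2 := sub_nonneg.2 hx
    obtain ⟨i, θ, v, hθ, hcase, hv, hxe⟩ := exists_eq_insertNth hx
    by_cases hsmall : k = 0 ∨ 1 / 2 ≤ cos θ ∧ r ≤ 1 / 8
    swap
    · have hr8 : 1 / 8 ≤ r := by
        by_contra! h
        exact hsmall (hcase.imp_right fun h' => ⟨h', h.le⟩)
      refine (measure_mono (Set.subset_univ _)).trans ((h₄ x hx r hr8 hrA).trans ?_)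
      apply ENNReal.ofReal_le_ofReal
      gcongr
      have : 0 < C₂ * (C₁ * (3 ^ k * 9 ^ |γ|)) * C₃ := by positivity
      linarith
    have hc := cos_nonneg_of_mem_Icc hθ
    set g := 1 - ∑ j, v j ^ 2 with hg
    have hg0 : 0 ≤ g := by linarith
    have hg1 : g ≤ 1 := by
      have : 0 ≤ ∑ j, v j ^ 2 := Finset.sum_nonneg fun j _ => sq_nonneg _
      linarith
    have hcmp := (h₃ (cos θ) g r hc (cos_le_one θ) hg0 hg1 hr hrA
      (hcase.imp_left fun h => ⟨h, by subst h; simp [hg]⟩)).2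
    have h9 : (g + (3 * r) ^ 2) ^ γ ≤ 9 ^ |γ| * (g + r ^ 2) ^ γ :=
      rpow_le_of_le_mul (by positivity) (by positivity) (by nlinarith) (by nlinarith) γ
    set W := {φ : ℝ | φ ∈ Set.Ioo (-(π / 2)) (π / 2) ∧ |φ - θ| ≤ 2 * r} with hW
    have hWm : MeasurableSet W := measurableSet_Ioo.inter
      (measurableSet_le (measurable_id.sub_const θ).abs measurable_const)
    have hpt : ∀ φ ∈ Set.Ioo (-(π / 2)) (π / 2), ENNReal.ofReal (|cos φ| ^ (k + 2 * γ)) *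
        ∫⁻ w, (ballCap x r).indicator 1 (i.insertNth (sin φ) fun j => cos φ * w j : Fin (k + 1) → ℝ)
          ∂ballMeasure k γ ≤ W.indicator (fun φ => ENNReal.ofReal (|cos φ| ^ (k + 2 * γ)) *
            ballMeasure k γ (ballCap v (3 * r))) φ := fun φ hφ => by
      by_cases hφW : φ ∈ W
      · rw [Set.indicator_of_mem hφW, ← lintegral_indicator_one (measurableSet_ballCap _ _)]
        refine mul_le_mul_right (lintegral_mono fun w => ?_) _
        by_cases hw : (i.insertNth (sin φ) (fun j => cos φ * w j) : Fin (k + 1) → ℝ) ∈ ballCap x r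
        · rw [Set.indicator_of_mem hw, Set.indicator_of_mem]
          · rfl
          · rw [hxe] at hw
            exact (ballCap_insertNth i hθ hφ hr hsmall hv hw).2
        · rw [Set.indicator_of_notMem hw]
          exact zero_le
      · rw [Set.indicator_of_notMem hφW]
        refine le_of_eq ?_
        rw [(lintegral_congr fun w => ?_).trans lintegral_zero, mul_zero]
        refine Set.indicator_of_notMem (fun hw => hφW ⟨hφ, ?_⟩) _
        rw [hxe] at hw
        exact (ballCap_insertNth i hθ hφ hr hsmall hv hw).1
    calc ballMeasure (k + 1) γ (ballCap x r)
        = ∫⁻ y, (ballCap x r).indicator 1 y ∂ballMeasure (k + 1) γ :=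
          (lintegral_indicator_one (measurableSet_ballCap _ _)).symm
      _ ≤ ∫⁻ φ in Set.Ioo (-(π / 2)) (π / 2),
            W.indicator (fun φ => ENNReal.ofReal (|cos φ| ^ (k + 2 * γ)) *
            ballMeasure k γ (ballCap v (3 * r))) φ := by
          rw [lintegral_ballMeasure_succ i measurableSet_Ioo injOn_sin_Ioo image_sin_Ioo
            (measurable_one.indicator (measurableSet_ballCap _ _))]
          exact setLIntegral_mono' measurableSet_Ioo hpt
      _ ≤ ∫⁻ φ, W.indicator (fun φ => ENNReal.ofReal (|cos φ| ^ (k + 2 * γ)) *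
            ballMeasure k γ (ballCap v (3 * r))) φ := setLIntegral_le_lintegral _ _
      _ = (∫⁻ φ in W, ENNReal.ofReal (|cos φ| ^ (k + 2 * γ))) *
            ballMeasure k γ (ballCap v (3 * r)) := by
          rw [lintegral_indicator hWm, lintegral_mul_const _ (by fun_prop)]
      _ ≤ ENNReal.ofReal (C₂ * (r * (cos θ + r) ^ (k + 2 * γ))) *
            ENNReal.ofReal (C₁ * ((3 * r) ^ k * (g + (3 * r) ^ 2) ^ γ)) :=
          mul_le_mul' (h₂ θ hθ r hr) (h₁ v hv (3 * r) (by positivity) (by linarith))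
      _ ≤ _ := by
          rw [← ENNReal.ofReal_mul (by positivity)]
          apply ENNReal.ofReal_le_ofReal
          have hgap : 1 - ∑ j, x j ^ 2 = cos θ ^ 2 * g := by rw [hxe, gap_insertNth]
          rw [hgap]
          calc _ ≤ C₂ * (r * (cos θ + r) ^ (k + 2 * γ)) *
                (C₁ * ((3 * r) ^ k * (9 ^ |γ| * (g + r ^ 2) ^ γ))) := by gcongr
            _ = C₂ * (C₁ * (3 ^ k * 9 ^ |γ|)) * (r ^ (k + 1) *
                ((cos θ + r) ^ (k + 2 * γ) * (g + r ^ 2) ^ γ)) := by rw [mul_pow]; ring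
            _ ≤ C₂ * (C₁ * (3 ^ k * 9 ^ |γ|)) * (r ^ (k + 1) *
                (C₃ * (cos θ ^ 2 * g + r ^ 2) ^ γ)) := by gcongr
            _ = C₂ * (C₁ * (3 ^ k * 9 ^ |γ|)) * C₃ * (r ^ (k + 1) *
                (cos θ ^ 2 * g + r ^ 2) ^ γ) := by ring
            _ ≤ _ := by gcongr; linarith

theorem ballMeasure_ballDist_lt_le {n : ℕ} (γ : ℝ) {x : Fin n → ℝ} (hx : ∑ i, x i ^ 2 ≤ 1)
    (r : ℝ) : ballMeasure n γ {y | ballDist n x y < r} ≤ ballMeasure n γ (ballCap x r) := by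
  refine measure_mono_ae ?_
  have h : ∀ᵐ y ∂ballMeasure n γ, ∑ i, y i ^ 2 < 1 :=
    (withDensity_absolutelyContinuous _ _).ae_le (ae_restrict_mem (measurableSet_openBall n))
  filter_upwards [h] with y hy hyr
  refine ⟨hy, ?_⟩
  have hyr' : arccos (ballInner x y) < r := hyr
  have hcos := cos_arccos (neg_one_le_ballInner hx hy.le) (ballInner_le_one hx hy.le)
  have h1 := one_sub_sq_div_two_le_cos (x := arccos (ballInner x y))
  have h2 : arccos (ballInner x y) ^ 2 ≤ r ^ 2 := by
    have := arccos_nonneg (ballInner x y)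
    gcongr
  linarith

theorem continuous_ballDist {n : ℕ} (x : Fin n → ℝ) : Continuous (ballDist n x) :=
  continuous_arccos.comp (continuous_ballInner x)

theorem ballDist_self {n : ℕ} {x : Fin n → ℝ} (hx : ∑ i, x i ^ 2 ≤ 1) : ballDist n x x = 0 := by
  rw [ballDist, mul_self_sqrt (sub_nonneg.2 hx)]
  simp only [← sq, add_sub_cancel, arccos_one]

theorem ballVol_pos {n : ℕ} {γ : ℝ} (hγ : -(1 / 2 : ℝ) < γ) {x : Fin n → ℝ}
    (hx : ∑ i, x i ^ 2 ≤ 1) {r : ℝ} (hr : 0 < r) : 0 < ballVol n γ x r := by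
  have := isFiniteMeasure_ballMeasure hγ n
  set B : Set (Fin n → ℝ) := {y | ∑ i, y i ^ 2 < 1} with hB
  have hBo : IsOpen B := isOpen_lt (by fun_prop) continuous_const
  have hDo : IsOpen {y | ballDist n x y < r} := isOpen_lt (continuous_ballDist x) continuous_const
  refine ENNReal.toReal_pos (fun h0 => ?_) (measure_ne_top _ _)
  rw [ballMeasure, withDensity_apply_eq_zero (measurable_ballDensity n γ)] at h0
  have hne : ({y | ballDist n x y < r} ∩ B).Nonempty := by
    have hcont : Continuous fun t : ℝ => ballDist n x (t • x) :=
      (continuous_ballDist x).comp (by fun_prop)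
    have hev : ∀ᶠ t in nhds (1 : ℝ), ballDist n x (t • x) < r := by
      refine hcont.continuousAt.eventually_lt continuousAt_const ?_
      rwa [one_smul, ballDist_self hx]
    obtain ⟨t, ⟨h1, h2⟩, h3⟩ := (((hev.and (lt_mem_nhds zero_lt_one)).filter_mono
      nhdsWithin_le_nhds).and (self_mem_nhdsWithin (s := Set.Iio (1 : ℝ)))).exists
    refine ⟨t • x, h1, ?_⟩
    simp only [hB, Set.mem_ofPred_eq, Pi.smul_apply, smul_eq_mul, mul_pow, ← Finset.mul_sum]
    have h3' : t < 1 := h3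
    have : 0 ≤ ∑ i, x i ^ 2 := Finset.sum_nonneg fun i _ => sq_nonneg _
    nlinarith
  refine ((hDo.inter hBo).measure_pos volume hne).ne' ?_
  rw [← nonpos_iff_eq_zero, ← h0, Measure.restrict_apply' (measurableSet_openBall n)]
  refine measure_mono fun y hy => ⟨⟨?_, hy.1⟩, hy.2⟩
  have hy2 : ∑ i, y i ^ 2 < 1 := hy.2
  exact (ENNReal.ofReal_pos.2 (rpow_pos_of_pos (sub_pos.2 hy2) _)).ne'

theorem min_mul_sq_le_ballEig {n : ℕ} (hn : 1 ≤ n) (γ : ℝ) (k : ℕ) :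
    min 1 (1 + 2 * γ) * (k : ℝ) ^ 2 ≤ ballEig n γ k := by
  have hn' : (1 : ℝ) ≤ n := by exact_mod_cast hn
  rcases Nat.eq_zero_or_pos k with rfl | hk
  · simp [ballEig]
  have hk' : (1 : ℝ) ≤ k := by exact_mod_cast hk
  rw [ballEig, sq, mul_left_comm]
  refine mul_le_mul_of_nonneg_left ?_ (by linarith)
  rcases le_total 0 γ with h | h
  · rw [min_eq_left (by linarith)]; linarith
  · rw [min_eq_right (by linarith)]; nlinarith

/-- Spectral localization to `[0, τ]` amounts to a degree bound comparable with `τ`. -/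
theorem exists_degree_bound {n : ℕ} (hn : 1 ≤ n) {γ : ℝ} (hγ : -(1 / 2 : ℝ) < γ) :
    ∃ C : ℝ, 0 < C ∧ ∀ τ : ℝ, 0 < τ → ∃ m : ℕ, 1 ≤ m ∧ (∀ k, √(ballEig n γ k) ≤ τ → k ≤ m) ∧
      ∀ x : Fin n → ℝ, ∑ i, x i ^ 2 ≤ 1 → ballVol n γ x τ⁻¹ ≤
        C * ((1 / m) ^ n * (1 - ∑ i, x i ^ 2 + (1 / m) ^ 2) ^ γ) := by
  set s := √(min 1 (1 + 2 * γ)) with hs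
  have hs0 : 0 < s := sqrt_pos.2 (lt_min one_pos (by linarith))
  have hs1 : s ≤ 1 := sqrt_le_one.2 (min_le_left _ _)
  set A := 2 / s with hA
  have hA1 : 1 ≤ A := by rw [hA, le_div_iff₀ hs0]; linarith
  obtain ⟨C₁, hC₁, h₁⟩ := ballMeasure_ballCap_le hγ n A (by positivity)
  obtain ⟨C₂, hC₂, h₂⟩ := ballMeasure_ballCap_le_of_le hγ n (δ := 1) (A := 1) one_pos
  refine ⟨C₁ * (A ^ n * (A ^ 2) ^ |γ|) + C₂, by positivity, fun τ hτ =>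
    ⟨⌊τ / s⌋₊ + 1, by omega, fun k hk => ?_, fun x hx => ?_⟩⟩
  · have h1 : s * k ≤ τ := by
      refine le_trans ?_ hk
      rw [hs, ← sqrt_sq (Nat.cast_nonneg k), ← sqrt_mul' _ (sq_nonneg _)]
      exact sqrt_le_sqrt (min_mul_sq_le_ballEig hn γ k)
    have : k ≤ ⌊τ / s⌋₊ := Nat.le_floor (by rwa [le_div_iff₀ hs0, mul_comm])
    omega
  have hgx : 0 ≤ 1 - ∑ i, x i ^ 2 := sub_nonneg.2 hx
  set g := 1 - ∑ i, x i ^ 2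
  rcases lt_or_ge τ s with hτs | hτs
  · have hfl : ⌊τ / s⌋₊ = 0 := Nat.floor_eq_zero.2 (by rwa [div_lt_one hs0])
    rw [hfl]
    have h := (measure_mono (Set.subset_univ {y | ballDist n x y < τ⁻¹})).trans
      (h₂ x hx 1 le_rfl le_rfl)
    refine (ENNReal.toReal_le_of_le_ofReal (by positivity) h).trans ?_
    simp only [zero_add, Nat.cast_one, div_one]
    gcongr
    have : 0 < C₁ * (A ^ n * (A ^ 2) ^ |γ|) := by positivity
    linarith
  · set m := ⌊τ / s⌋₊ + 1 with hm
    have hm0 : (0 : ℝ) < m := by rw [hm]; positivity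
    have hm1 : (1 : ℝ) ≤ m := by rw [hm]; push_cast; linarith [Nat.cast_nonneg (α := ℝ) ⌊τ / s⌋₊]
    have hmτ : (m : ℝ) ≤ A * τ := by
      have h1 : (⌊τ / s⌋₊ : ℝ) ≤ τ / s := Nat.floor_le (by positivity)
      have h2 : 1 ≤ τ / s := (one_le_div hs0).2 hτs
      have h3 : A * τ = 2 * (τ / s) := by rw [hA]; ring
      rw [hm, h3]
      push_cast
      linarith
    have hr : τ⁻¹ ≤ A * (1 / m) := by
      rw [mul_one_div, inv_le_iff_one_le_mul₀ hτ, div_mul_eq_mul_div, one_le_div hm0]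
      exact hmτ
    have hh1 : (1 : ℝ) / m ≤ 1 := div_le_one_of_le₀ hm1 hm0.le
    have hh0 : (0 : ℝ) < 1 / m := by positivity
    set h : ℝ := 1 / m
    have hV := ((measure_mono (fun y hy => lt_of_lt_of_le hy hr)).trans
      (ballMeasure_ballDist_lt_le γ hx (A * h))).trans
      (h₁ x hx (A * h) (by positivity) (mul_le_of_le_one_right (by positivity) hh1))
    refine (ENNReal.toReal_le_of_le_ofReal (by positivity) hV).trans ?_
    have hA2 : 1 ≤ A ^ 2 := one_le_pow₀ hA1
    have hcmp := rpow_le_of_le_mul (a := g + (A * h) ^ 2) (b := g + h ^ 2) (L := A ^ 2)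
      (by positivity) (by positivity) (by nlinarith)
      (by nlinarith [mul_nonneg (sub_nonneg.2 hA2) (sq_nonneg h),
        mul_nonneg (sub_nonneg.2 hA2) hgx,
        mul_nonneg (sub_nonneg.2 hA2) (sq_nonneg (A * h))]) γ
    calc _ ≤ C₁ * ((A * h) ^ n * ((A ^ 2) ^ |γ| * (g + h ^ 2) ^ γ)) := by gcongr
      _ = C₁ * (A ^ n * (A ^ 2) ^ |γ|) * (h ^ n * (g + h ^ 2) ^ γ) := by rw [mul_pow]; ring
      _ ≤ _ := by gcongr; linarith

/-- A pointwise bound for the diagonal of the reproducing kernel of an orthonormal family. -/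
theorem sum_eval_sq_mul_le {n : ℕ} {ι : Type*} [DecidableEq ι] {μ : Measure (Fin n → ℝ)}
    {p : ι → MvPolynomial (Fin n) ℝ}
    (horth : ∀ a b, ∫ x, eval x (p a) * eval x (p b) ∂μ = if a = b then 1 else 0)
    (s : Finset ι) {m : ℕ} (hdeg : ∀ a ∈ s, (p a).totalDegree ≤ m) {x : Fin n → ℝ} {C D : ℝ}
    (hC : 0 ≤ C) (hD : ∀ Q : MvPolynomial (Fin n) ℝ, Q.totalDegree ≤ m →
      ENNReal.ofReal (eval x Q ^ 2 * D) ≤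
        ENNReal.ofReal C * ∫⁻ y, ENNReal.ofReal (eval y Q ^ 2) ∂μ) :
    (∑ a ∈ s, eval x (p a) ^ 2) * D ≤ C := by
  have hmem : ∀ a, MemLp (fun y => eval y (p a)) 2 μ := fun a => by
    rw [memLp_two_iff_integrable_sq (MvPolynomial.continuous_eval _).aestronglyMeasurable]
    by_contra h
    have := horth a a
    simp only [← sq, integral_undef h, if_true] at this
    exact zero_ne_one this
  have h_int : ∀ a b, Integrable (fun y => eval y (p a) * eval y (p b)) μ := fun a b =>
    (hmem a).integrable_mul (hmem b)
  set K := ∑ a ∈ s, eval x (p a) ^ 2 with hK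
  have hK0 : 0 ≤ K := Finset.sum_nonneg fun a _ => sq_nonneg _
  set Q : MvPolynomial (Fin n) ℝ := ∑ a ∈ s, eval x (p a) • p a with hQ
  have hQe : ∀ y, eval y Q = ∑ a ∈ s, eval x (p a) * eval y (p a) := fun y => by
    simp [hQ, smul_eval]
  have hQdeg : Q.totalDegree ≤ m := totalDegree_finsetSum_le fun a ha =>
    (totalDegree_smul_le _ _).trans (hdeg a ha)
  have hQx : eval x Q = K := by rw [hQe, hK]; simp only [sq]
  have hQsq : ∀ y, eval y Q ^ 2 = ∑ a ∈ s, ∑ b ∈ s, eval x (p a) * eval x (p b) *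
      (eval y (p a) * eval y (p b)) := fun y => by
    rw [hQe, sq, Finset.sum_mul_sum]
    exact Finset.sum_congr rfl fun a _ => Finset.sum_congr rfl fun b _ => by ring
  have hQint : Integrable (fun y => eval y Q ^ 2) μ := by
    simp only [hQsq]
    exact integrable_finsetSum _ fun a _ => integrable_finsetSum _ fun b _ =>
      (h_int a b).const_mul _
  have hQval : ∫ y, eval y Q ^ 2 ∂μ = K := by
    simp only [hQsq]
    rw [integral_finsetSum _ fun a _ => integrable_finsetSum _ fun b _ =>
      (h_int a b).const_mul _]
    refine Finset.sum_congr rfl fun a ha => ?_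
    rw [integral_finsetSum _ fun b _ => (h_int a b).const_mul _]
    simp only [integral_const_mul, horth, mul_ite, mul_one, mul_zero]
    rw [Finset.sum_ite_eq, if_pos ha, sq]
  have h := hD Q hQdeg
  rw [← ofReal_integral_eq_lintegral_ofReal hQint (ae_of_all _ fun y => sq_nonneg _), hQval, hQx,
    ← ENNReal.ofReal_mul hC, ENNReal.ofReal_le_ofReal_iff (by positivity)] at h
  rcases hK0.eq_or_lt with h0 | h0
  · rw [← h0, zero_mul]; exact hC
  · nlinarith

/-- Uniform bound for the kernel `Φ(√(-L))(x,y) = Σ_k Φ(√λ_k) P_k(x,y)` for a bounded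
function `Φ` supported in `[0,τ]`. -/
theorem stmt19 (n : ℕ) (hn : 1 ≤ n) (γ : ℝ) (hγ : -(1 / 2 : ℝ) < γ)
    (P : (k : ℕ) → Fin (ballNk n k) → MvPolynomial (Fin n) ℝ)
    (hdeg : ∀ k j, (P k j).totalDegree ≤ k)
    (horth : ∀ (k : ℕ) (j : Fin (ballNk n k)) (k' : ℕ) (j' : Fin (ballNk n k')),
      ∫ x, eval x (P k j) * eval x (P k' j') ∂(ballMeasure n γ)
        = if (⟨k, j⟩ : Σ k, Fin (ballNk n k)) = ⟨k', j'⟩ then 1 else 0)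
    (hspan : ∀ m : ℕ, ∀ Q : MvPolynomial (Fin n) ℝ, Q.totalDegree ≤ m →
      Q ∈ Submodule.span ℝ {R | ∃ k ≤ m, ∃ j, R = P k j})
    (heig : ∀ (k : ℕ) (j : Fin (ballNk n k)), ∀ x : Fin n → ℝ, (∑ i, (x i) ^ 2) < 1 →
      eval x (ballOp n γ (P k j)) = -(ballEig n γ k) * eval x (P k j)) :
    ∃ c > (0 : ℝ),
      ∀ τ : ℝ, 0 < τ →
      ∀ Φ : ℝ → ℝ, (∀ s : ℝ, s ∉ Set.Icc 0 τ → Φ s = 0) →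
      ∀ M : ℝ, (∀ s : ℝ, |Φ s| ≤ M) →
      ∀ x : Fin n → ℝ, (∑ i, (x i) ^ 2) ≤ 1 →
      ∀ y : Fin n → ℝ, (∑ i, (y i) ^ 2) ≤ 1 →
        |∑' k : ℕ, Φ (Real.sqrt (ballEig n γ k))
            * ∑ j, eval x (P k j) * eval y (P k j)|
          ≤ c * M / Real.sqrt (ballVol n γ x τ⁻¹ * ballVol n γ y τ⁻¹) := by
  classical
  obtain ⟨C₁, hC₁, h₁⟩ := ball_christoffel γ n
  obtain ⟨C₂, hC₂, h₂⟩ := exists_degree_bound hn hγ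
  refine ⟨C₁ * C₂, by positivity, fun τ hτ Φ hΦ M hM x hx y hy => ?_⟩
  obtain ⟨m, hm1, hmk, hmV⟩ := h₂ τ hτ
  have hM0 : 0 ≤ M := (abs_nonneg _).trans (hM 0)
  set s : Finset (Σ k, Fin (ballNk n k)) :=
    (Finset.range (m + 1)).sigma fun k => (Finset.univ : Finset (Fin (ballNk n k))) with hs
  have hmm : (0 : ℝ) < 1 / m := by positivity
  have hVK : ∀ z : Fin n → ℝ, ∑ i, z i ^ 2 ≤ 1 → 0 < ballVol n γ z τ⁻¹ ∧
      (∑ a ∈ s, eval z (P a.1 a.2) ^ 2) * ballVol n γ z τ⁻¹ ≤ C₁ * C₂ := fun z hz => by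
    refine ⟨ballVol_pos hγ hz (inv_pos.2 hτ), ?_⟩
    have hK := sum_eval_sq_mul_le (p := fun a : Σ k, Fin (ballNk n k) => P a.1 a.2)
      (fun a b => by simpa using horth a.1 a.2 b.1 b.2) s (m := m)
      (fun a ha => (hdeg a.1 a.2).trans (by
        have := Finset.mem_range.1 (Finset.mem_sigma.1 ha).1
        omega)) hC₁.le (fun Q hQ => h₁ m hm1 Q hQ z hz)
    have hK0 : 0 ≤ ∑ a ∈ s, eval z (P a.1 a.2) ^ 2 := Finset.sum_nonneg fun a _ => sq_nonneg _
    calc _ ≤ (∑ a ∈ s, eval z (P a.1 a.2) ^ 2) *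
          (C₂ * ((1 / m) ^ n * (1 - ∑ i, z i ^ 2 + (1 / m) ^ 2) ^ γ)) := by gcongr; exact hmV z hz
      _ = C₂ * ((∑ a ∈ s, eval z (P a.1 a.2) ^ 2) *
          ((1 / m) ^ n * (1 - ∑ i, z i ^ 2 + (1 / m) ^ 2) ^ γ)) := by ring
      _ ≤ C₂ * C₁ := by gcongr
      _ = C₁ * C₂ := mul_comm _ _
  obtain ⟨hVx, hKx⟩ := hVK x hx
  obtain ⟨hVy, hKy⟩ := hVK y hy
  rw [tsum_eq_sum (s := Finset.range (m + 1)) fun k hk => by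
    rw [hΦ _ fun h => hk (Finset.mem_range.2 (Nat.lt_succ_of_le (hmk k h.2))), zero_mul],
    le_div_iff₀ (sqrt_pos.2 (mul_pos hVx hVy))]
  set Kx := ∑ a ∈ s, eval x (P a.1 a.2) ^ 2
  set Ky := ∑ a ∈ s, eval y (P a.1 a.2) ^ 2
  have hKx0 : 0 ≤ Kx := Finset.sum_nonneg fun a _ => sq_nonneg _
  have hKy0 : 0 ≤ Ky := Finset.sum_nonneg fun a _ => sq_nonneg _
  have hsum : |∑ k ∈ Finset.range (m + 1), Φ √(ballEig n γ k) *
      ∑ j, eval x (P k j) * eval y (P k j)| ≤ M * √(Kx * Ky) := by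
    simp only [Finset.mul_sum]
    rw [Finset.sum_sigma']
    calc _ ≤ ∑ a ∈ s, |Φ √(ballEig n γ a.1) * (eval x (P a.1 a.2) * eval y (P a.1 a.2))| :=
          Finset.abs_sum_le_sum_abs _ _
      _ ≤ ∑ a ∈ s, M * (|eval x (P a.1 a.2)| * |eval y (P a.1 a.2)|) :=
          Finset.sum_le_sum fun a _ => by
            rw [abs_mul, abs_mul]
            exact mul_le_mul_of_nonneg_right (hM _) (by positivity)
      _ = M * ∑ a ∈ s, |eval x (P a.1 a.2)| * |eval y (P a.1 a.2)| := by rw [Finset.mul_sum]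
      _ ≤ M * √(Kx * Ky) := by
          have := sum_mul_le_sqrt_mul_sqrt s (fun a => |eval x (P a.1 a.2)|)
            (fun a => |eval y (P a.1 a.2)|)
          simp only [sq_abs] at this
          rw [sqrt_mul hKx0]
          gcongr
  calc _ ≤ M * √(Kx * Ky) * √(ballVol n γ x τ⁻¹ * ballVol n γ y τ⁻¹) := by gcongr
    _ = M * √((Kx * ballVol n γ x τ⁻¹) * (Ky * ballVol n γ y τ⁻¹)) := by
        rw [mul_assoc, ← sqrt_mul (by positivity), mul_mul_mul_comm]
    _ ≤ M * √((C₁ * C₂) * (C₁ * C₂)) := by gcongr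
    _ = C₁ * C₂ * M := by rw [sqrt_mul_self (by positivity), mul_comm]

end
end
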